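/- arXiv:math/0607805 — 2 statements merged into one kernel-verified Lean document; each statement's English description precedes it below -/
import Mathlib

section
/- Let d ≥ 2 and 0 < α < d, and let P be a simple point process on ℝ^d satisfying Assumptions (A1) and (A2). Then there exists C < ∞ such that for every i ∈ {1,2,3}, P-a.s. for all sufficiently large L, the uniform mixing time satisfies τ^i(L) ≤ C·L². -/
open MeasureTheory Filter
open scoped ENNReal

noncomputable section

abbrev Pt (d : ℕ) := EuclideanSpace ℝ (Fin d)
abbrev Config (d : ℕ) := Set (Pt d)

def IsLocallyFinite {d : ℕ} (ξ : Config d) : Prop :=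
  ∀ A : Set (Pt d), Bornology.IsBounded A → (ξ ∩ A).Finite

instance configMS (d : ℕ) : MeasurableSpace (Config d) :=
  MeasurableSpace.generateFrom
    { E | ∃ (A : Set (Pt d)) (n : ℕ), Bornology.IsBounded A ∧ MeasurableSet A ∧
        E = {ξ : Config d | (ξ ∩ A).ncard = n} }

def IsPointProcess {d : ℕ} (P : Measure (Config d)) : Prop :=
  IsProbabilityMeasure P ∧ ∀ᵐ ξ ∂P, IsLocallyFinite ξ

def cube (d : ℕ) (L : ℝ) : Set (Pt d) := {p | ∀ i, |p i| ≤ L / 2}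

/-- The cube `B_x = Kx + [0,K)^d`. -/
def Kcube (d : ℕ) (K : ℝ) (x : Fin d → ℤ) : Set (Pt d) :=
  {p | ∀ i, K * x i ≤ p i ∧ p i < K * x i + K}

/-- Bernoulli(p) i.i.d. field on `ℤ^d`, characterized by its cylinder probabilities. -/
def IsBernoulliField (d : ℕ) (p : ℝ) (ν : Measure ((Fin d → ℤ) → Bool)) : Prop :=
  IsProbabilityMeasure ν ∧
  ∀ (S : Finset (Fin d → ℤ)) (b : (Fin d → ℤ) → Bool),
    ν {ω | ∀ x ∈ S, ω x = b x} = ∏ x ∈ S, ENNReal.ofReal (if b x then p else 1 - p)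

/-- Assumption (A1): for every p < 1 there is K such that the good-box field
dominates an i.i.d. Bernoulli(p) field, in the sense of a monotone coupling. -/
def AssumptionA1 {d : ℕ} (P : Measure (Config d)) : Prop :=
  ∀ p : ℝ, 0 < p → p < 1 → ∃ K : ℝ, 0 < K ∧
    ∃ (μ : Measure (Config d × ((Fin d → ℤ) → Bool))) (ν : Measure ((Fin d → ℤ) → Bool)),
      IsProbabilityMeasure μ ∧ IsBernoulliField d p ν ∧
      μ.map Prod.fst = P ∧ μ.map Prod.snd = ν ∧
      ∀ᵐ ω ∂μ, ∀ x : Fin d → ℤ, ω.2 x = true → (ω.1 ∩ Kcube d K x).Nonempty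

/-- `R_A(ξ) = Σ_{x ∈ ξ∩A} Σ_{y ∈ ξ} exp(-|x-y|^α)` (valued in `ℝ≥0∞`). -/
def Rfun {d : ℕ} (α : ℝ) (A : Set (Pt d)) (ξ : Config d) : ℝ≥0∞ :=
  ∑' (x : ↥(ξ ∩ A)) (y : ↥ξ), ENNReal.ofReal (Real.exp (-(dist (x : Pt d) (y : Pt d)) ^ α))

/-- The cube `V_x = L^ε x + [0, L^ε)^d`. -/
def Vcube (d : ℕ) (L : ℕ) (ε : ℝ) (x : Fin d → ℤ) : Set (Pt d) :=
  {p | ∀ i, (L : ℝ) ^ ε * x i ≤ p i ∧ p i < (L : ℝ) ^ ε * x i + (L : ℝ) ^ ε}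

/-- Assumption (A2). -/
def AssumptionA2 {d : ℕ} (α : ℝ) (P : Measure (Config d)) : Prop :=
  ∀ ε : ℝ, 0 < ε → ε < 1 → ∃ C : ℝ, 0 < C ∧
    ∀ᵐ ξ ∂P, ∀ᶠ L : ℕ in atTop,
      ∀ x : Fin d → ℤ, (Vcube d L ε x ∩ cube d L).Nonempty →
        Rfun α (Vcube d L ε x) ξ ≤ ENNReal.ofReal (C * (L : ℝ) ^ (ε * d))

noncomputable instance {d : ℕ} : DecidableEq (Pt d) := Classical.decEq _

variable {d : ℕ}

/-- jump rate `e^{-|x-y|^α}`. -/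
def rate (α : ℝ) (x y : Pt d) : ℝ := Real.exp (-(dist x y) ^ α)

/-- weights `w^i_x` for the three models `i = 1,2,3`. -/
def wgt (α : ℝ) (E : Finset (Pt d)) (i : ℕ) (x : Pt d) : ℝ :=
  if i = 1 then 1
  else if i = 2 then ∑ z ∈ E.erase x, rate α x z
  else max 1 (∑ z ∈ E.erase x, rate α x z)

/-- `W^i(U) = Σ_{x∈U} w^i_x`. -/
def Wsum (α : ℝ) (E : Finset (Pt d)) (i : ℕ) (U : Finset (Pt d)) : ℝ :=
  ∑ x ∈ U, wgt α E i x

/-- the reversible probability measure `ν^i(x) = w^i_x / W^i(ξ_L)`. -/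
def nu (α : ℝ) (E : Finset (Pt d)) (i : ℕ) (x : Pt d) : ℝ :=
  wgt α E i x / Wsum α E i E

/-- conductance `I^i_U`. -/
def conduct (α : ℝ) (E : Finset (Pt d)) (i : ℕ) (U : Finset (Pt d)) : ℝ :=
  (∑ x ∈ U, ∑ y ∈ E \ U, rate α x y) / Wsum α E i U

/-- isoperimetric profile `φ^i_L(t)` (valued in `ℝ≥0∞`; `∞` if no admissible `U`). -/
def isoProfile (α : ℝ) (E : Finset (Pt d)) (i : ℕ) (t : ℝ) : ℝ≥0∞ :=
  ⨅ (U : Finset (Pt d)) (_ : U ⊆ E) (_ : U.Nonempty)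
    (_ : Wsum α E i U ≤ t * Wsum α E i E), ENNReal.ofReal (conduct α E i U)

/-- Cheeger's constant `Φ^i_L = φ^i_L(1/2)`. -/
def cheeger (α : ℝ) (E : Finset (Pt d)) (i : ℕ) : ℝ≥0∞ := isoProfile α E i (1 / 2)

/-- Dirichlet form `E_i(f)`. -/
def dirichlet (α : ℝ) (E : Finset (Pt d)) (i : ℕ) (f : Pt d → ℝ) : ℝ :=
  (1 / 2) * ∑ x ∈ E, ∑ y ∈ E.erase x,
    nu α E i x * (rate α x y / wgt α E i x) * (f x - f y) ^ 2

/-- variance `Var_i(f) = ν^i(f²) - ν^i(f)²`. -/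
def varNu (α : ℝ) (E : Finset (Pt d)) (i : ℕ) (f : Pt d → ℝ) : ℝ :=
  (∑ x ∈ E, nu α E i x * f x ^ 2) - (∑ x ∈ E, nu α E i x * f x) ^ 2

/-- nonconstant on `E`. -/
def Nonconst (E : Finset (Pt d)) (f : Pt d → ℝ) : Prop := ∃ x ∈ E, ∃ y ∈ E, f x ≠ f y

/-- Poincaré constant `γ^i(L) = sup { Var_i f / E_i f : f nonconstant }`. -/
def gammaP (α : ℝ) (E : Finset (Pt d)) (i : ℕ) : ℝ≥0∞ :=
  ⨆ (f : Pt d → ℝ) (_ : Nonconst E f),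
    ENNReal.ofReal (varNu α E i f / dirichlet α E i f)

/-- the generator `L^i` as a matrix on `E`. -/
def gen (α : ℝ) (E : Finset (Pt d)) (i : ℕ) : Matrix ↥E ↥E ℝ :=
  Matrix.of fun x y =>
    if x = y then -(∑ z ∈ E.erase (x : Pt d), rate α (x : Pt d) z / wgt α E i (x : Pt d))
    else rate α (x : Pt d) (y : Pt d) / wgt α E i (x : Pt d)

/-- heat kernel `H^i_t = exp(t L^i)`, via the exponential series. -/
def heatKernel (α : ℝ) (E : Finset (Pt d)) (i : ℕ) (t : ℝ) (x y : ↥E) : ℝ :=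
  ∑' n : ℕ, t ^ n / (n.factorial : ℝ) * (gen α E i ^ n) x y

/-- uniform mixing time `τ^i(L)` (valued in `ℝ≥0∞`). -/
def mixTime (α : ℝ) (E : Finset (Pt d)) (i : ℕ) : ℝ≥0∞ :=
  ⨅ (t : ℝ) (_ : 0 < t)
    (_ : ∀ x y : ↥E,
      |heatKernel α E i t x y - nu α E i (y : Pt d)| / nu α E i (y : Pt d) ≤ Real.exp (-1)),
    ENNReal.ofReal t

/-- `c₀⁺(U)`: nonnegative, nonconstant, vanishing outside `U`. -/
def c0plus (E U : Finset (Pt d)) (f : Pt d → ℝ) : Prop :=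
  (∀ x ∈ E, 0 ≤ f x) ∧ Nonconst E f ∧ ∀ x ∈ E, x ∉ U → f x = 0

/-- `λ^i(U) = inf { E_i f / Var_i f : f ∈ c₀⁺(U) }`. -/
def lambdaU (α : ℝ) (E : Finset (Pt d)) (i : ℕ) (U : Finset (Pt d)) : ℝ :=
  sInf {r : ℝ | ∃ f : Pt d → ℝ, c0plus E U f ∧ r = dirichlet α E i f / varNu α E i f}

/-- `ν^i_* = min_{x∈E} ν^i(x)`. -/
def nuStar (α : ℝ) (E : Finset (Pt d)) (i : ℕ) : ℝ :=
  sInf (nu α E i '' ↑E)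

/-- `ν^i(U)` for a subset `U`. -/
def nuSet (α : ℝ) (E : Finset (Pt d)) (i : ℕ) (U : Finset (Pt d)) : ℝ :=
  ∑ x ∈ U, nu α E i x

/-- spectral profile `Λ^i(r)`. -/
def specProfile (α : ℝ) (E : Finset (Pt d)) (i : ℕ) (r : ℝ) : ℝ :=
  sInf {l : ℝ | ∃ U : Finset (Pt d), U ⊆ E ∧
    nuStar α E i ≤ nuSet α E i U ∧ nuSet α E i U ≤ r ∧ l = lambdaU α E i U}

/-- hybrid conductance profile `ψ_L(t)`: model-3 conductance, counting constraint. -/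
def hybridProfile (α : ℝ) (E : Finset (Pt d)) (t : ℝ) : ℝ≥0∞ :=
  ⨅ (U : Finset (Pt d)) (_ : U ⊆ E) (_ : U.Nonempty)
    (_ : (U.card : ℝ) ≤ t * (E.card : ℝ)), ENNReal.ofReal (conduct α E 3 U)

section Semigroup

open scoped Matrix.Norms.Operator Nat

variable {ι : Type*} [Fintype ι] [DecidableEq ι]

/-- The continuous-time semigroup generated by a matrix. -/
def semi (G : Matrix ι ι ℝ) (t : ℝ) : Matrix ι ι ℝ := NormedSpace.exp (t • G)

lemma hasSum_semi_apply (G : Matrix ι ι ℝ) (t : ℝ) (x y : ι) :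
    HasSum (fun n : ℕ => t ^ n / (n ! : ℝ) * (G ^ n) x y) (semi G t x y) := by
  have h := NormedSpace.exp_series_hasSum_exp' (𝕂 := ℝ) (t • G)
  have h1 := Pi.hasSum.1 (Pi.hasSum.1 h x) y
  have e : (fun n : ℕ => t ^ n / (n ! : ℝ) * (G ^ n) x y)
      = fun n : ℕ => ((n ! : ℝ)⁻¹ • (t • G) ^ n) x y := by
    funext n
    rw [smul_pow, Matrix.smul_apply, Matrix.smul_apply, smul_eq_mul, smul_eq_mul]
    ring
  rw [e]
  exact h1

lemma semi_add (G : Matrix ι ι ℝ) (s t : ℝ) : semi G (s + t) = semi G s * semi G t := by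
  unfold semi
  rw [add_smul, Matrix.exp_add_of_commute]
  exact ((Commute.refl G).smul_left s).smul_right t

lemma semi_zero (G : Matrix ι ι ℝ) : semi G 0 = 1 := by simp [semi]

lemma semi_nonneg {G : Matrix ι ι ℝ} (hG : ∀ x y, x ≠ y → 0 ≤ G x y) {t : ℝ} (ht : 0 ≤ t)
    (x y : ι) : 0 ≤ semi G t x y := by
  obtain ⟨lam, hlam⟩ : ∃ lam : ℝ, ∀ x, 0 ≤ lam + G x x :=
    ⟨∑ x, |G x x|, fun x => by
      have := Finset.single_le_sum (f := fun x => |G x x|) (fun i _ => abs_nonneg _)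
        (Finset.mem_univ x)
      have := neg_abs_le (G x x)
      linarith⟩
  set N : Matrix ι ι ℝ := lam • (1 : Matrix ι ι ℝ) + G with hN
  have hNn : ∀ x y, 0 ≤ N x y := by
    intro x y
    by_cases h : x = y
    · subst h; simpa [hN] using hlam x
    · simpa [hN, Matrix.one_apply_ne h] using hG x y h
  have hpow : ∀ n x y, 0 ≤ (N ^ n) x y := by
    intro n
    induction n with
    | zero => intro x y; rw [pow_zero, Matrix.one_apply]; split_ifs <;> norm_num
    | succ n ih =>
      intro x y
      rw [pow_succ, Matrix.mul_apply]
      exact Finset.sum_nonneg fun z _ => mul_nonneg (ih x z) (hNn z y)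
  have h1 : 0 ≤ semi N t x y :=
    (hasSum_semi_apply N t x y).nonneg fun n => mul_nonneg (by positivity) (hpow n x y)
  have h2 : semi G t = Real.exp (-(t * lam)) • semi N t := by
    have e : t • G = (-(t * lam)) • (1 : Matrix ι ι ℝ) + t • N := by
      rw [hN, smul_add, smul_smul]; module
    unfold semi
    rw [e, Matrix.exp_add_of_commute _ _
      (((Commute.one_left N).smul_left _).smul_right _)]
    have e2 : NormedSpace.exp ((-(t * lam)) • (1 : Matrix ι ι ℝ))
        = Real.exp (-(t * lam)) • (1 : Matrix ι ι ℝ) := by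
      have := NormedSpace.algebraMap_exp_comm (𝕂 := ℝ) (𝔸 := Matrix ι ι ℝ) (-(t * lam))
      rw [Algebra.algebraMap_eq_smul_one, Algebra.algebraMap_eq_smul_one] at this
      rw [← Real.exp_eq_exp_ℝ] at this
      exact this.symm
    rw [e2, smul_mul_assoc, one_mul]
  rw [h2, Matrix.smul_apply, smul_eq_mul]
  exact mul_nonneg (Real.exp_pos _).le h1

lemma semi_row_sum {G : Matrix ι ι ℝ} (hG : ∀ x, ∑ y, G x y = 0) (t : ℝ) (x : ι) :
    ∑ y, semi G t x y = 1 := by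
  have h := hasSum_sum (s := Finset.univ) fun y (_ : y ∈ Finset.univ) => hasSum_semi_apply G t x y
  have hz : ∀ n ≠ 0, ∑ y, t ^ n / (n ! : ℝ) * (G ^ n) x y = 0 := by
    intro n hn
    obtain ⟨m, rfl⟩ := Nat.exists_eq_succ_of_ne_zero hn
    rw [← Finset.mul_sum, pow_succ G]
    simp only [Matrix.mul_apply]
    rw [Finset.sum_comm]
    simp [← Finset.mul_sum, hG]
  have h2 := hasSum_single 0 hz
  rw [h.unique h2]
  simp [Matrix.one_apply]

lemma semi_reversible {G : Matrix ι ι ℝ} {w : ι → ℝ} (hw : ∀ x y, w x * G x y = w y * G y x)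
    (t : ℝ) (x y : ι) : w x * semi G t x y = w y * semi G t y x := by
  have hp : ∀ n x y, w x * (G ^ n) x y = w y * (G ^ n) y x := by
    intro n
    induction n with
    | zero =>
      intro x y
      by_cases h : x = y
      · rw [h]
      · simp [Matrix.one_apply_ne h, Matrix.one_apply_ne (Ne.symm h)]
    | succ n ih =>
      intro x y
      rw [pow_succ, Matrix.mul_apply, ← pow_succ, pow_succ', Matrix.mul_apply, Finset.mul_sum,
        Finset.mul_sum]
      refine Finset.sum_congr rfl fun z _ => ?_
      rw [← mul_assoc, ih, ← mul_assoc, ← hw z y]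
      ring
  refine ((hasSum_semi_apply G t x y).mul_left (w x)).unique ?_
  convert (hasSum_semi_apply G t y x).mul_left (w y) using 2 with n
  have := hp n x y
  linear_combination (t ^ n / (n ! : ℝ)) * this

lemma hasDerivAt_semi_apply (G : Matrix ι ι ℝ) (t : ℝ) (x y : ι) :
    HasDerivAt (fun t => semi G t x y) ((semi G t * G) x y) t := by
  have h : HasDerivAt (semi G) (semi G t * G) t := hasDerivAt_exp_smul_const (𝕂 := ℝ) G t
  exact hasDerivAt_pi.1 (hasDerivAt_pi.1 h x) y

end Semigroup

section Mixing

lemma exp_decay_of_deriv_le {u u' : ℝ → ℝ} {b κ : ℝ} (hκ : 0 < κ)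
    (hu : ∀ t, HasDerivAt u (u' t) t) (h : ∀ t, 0 ≤ t → u t ≤ b - κ * u' t)
    {t s : ℝ} (ht : 0 ≤ t) (hs : 0 ≤ s) :
    u (t + s) - b ≤ (u t - b) * Real.exp (-(s / κ)) := by
  have hd : ∀ r, HasDerivAt (fun r => (u r - b) * Real.exp (r / κ))
      (u' r * Real.exp (r / κ) + (u r - b) * (Real.exp (r / κ) * (1 / κ))) r := fun r =>
    ((hu r).sub_const b).mul (((hasDerivAt_id r).div_const κ).exp)
  have hanti : AntitoneOn (fun r => (u r - b) * Real.exp (r / κ)) (Set.Ici 0) := by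
    refine antitoneOn_of_deriv_nonpos (convex_Ici 0)
      (fun r _ => (hd r).continuousAt.continuousWithinAt)
      (fun r _ => (hd r).differentiableAt.differentiableWithinAt) fun r hr => ?_
    rw [interior_Ici] at hr
    rw [(hd r).deriv]
    have h1 := h r (le_of_lt hr)
    have h2 : u' r * Real.exp (r / κ) + (u r - b) * (Real.exp (r / κ) * (1 / κ))
        = (Real.exp (r / κ) / κ) * (u r - (b - κ * u' r)) := by
      field_simp
      ring
    rw [h2]
    exact mul_nonpos_of_nonneg_of_nonpos (by positivity) (by linarith)
  have h3 := hanti (Set.mem_Ici.2 ht) (Set.mem_Ici.2 (add_nonneg ht hs)) (by linarith)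
  simp only at h3
  have h4 : Real.exp ((t + s) / κ) = Real.exp (t / κ) * Real.exp (s / κ) := by
    rw [← Real.exp_add, add_div]
  rw [h4, ← mul_assoc, mul_right_comm] at h3
  have h5 := le_of_mul_le_mul_right h3 (Real.exp_pos _)
  rw [Real.exp_neg, ← div_eq_mul_inv, le_div_iff₀ (Real.exp_pos _)]
  exact h5

variable {ι : Type*} [Fintype ι] [DecidableEq ι]

/-- The (unnormalised) Dirichlet energy associated with conductances `c`. -/
def energy (c : ι → ι → ℝ) (f : ι → ℝ) : ℝ := ∑ x, ∑ y, c x y * (f x - f y) ^ 2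

lemma energy_eq {G : Matrix ι ι ℝ} {c : ι → ι → ℝ} {w : ι → ℝ}
    (hrow : ∀ x, ∑ y, G x y = 0) (hoff : ∀ x y, x ≠ y → w x * G x y = c x y)
    (hc : ∀ x y, c x y = c y x) (f : ι → ℝ) :
    energy c f = - (2 * ∑ x, w x * f x * ∑ y, G x y * f y) := by
  have e1 : energy c f = ∑ x, ∑ y, w x * G x y * (f x - f y) ^ 2 := by
    refine Finset.sum_congr rfl fun x _ => Finset.sum_congr rfl fun y _ => ?_
    by_cases h : x = y
    · subst h; simp
    · rw [hoff x y h]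
  have hsymm : ∀ x y, w x * G x y = w y * G y x := by
    intro x y
    by_cases h : x = y
    · rw [h]
    · rw [hoff x y h, hoff y x (Ne.symm h), hc]
  have e2 : ∑ x, ∑ y, w x * G x y * f x ^ 2 = 0 := by
    refine Finset.sum_eq_zero fun x _ => ?_
    rw [← Finset.sum_mul, ← Finset.mul_sum, hrow]; simp
  have e3 : ∑ x, ∑ y, w x * G x y * f y ^ 2 = 0 := by
    rw [Finset.sum_comm, ← e2]
    refine Finset.sum_congr rfl fun x _ => Finset.sum_congr rfl fun y _ => ?_
    rw [hsymm]
  have e4 : energy c f = (∑ x, ∑ y, w x * G x y * f x ^ 2)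
      + (∑ x, ∑ y, w x * G x y * f y ^ 2) - 2 * ∑ x, w x * f x * ∑ y, G x y * f y := by
    rw [e1]
    simp only [Finset.mul_sum, ← Finset.sum_add_distrib, ← Finset.sum_sub_distrib]
    refine Finset.sum_congr rfl fun x _ => Finset.sum_congr rfl fun y _ => ?_
    ring
  rw [e4, e2, e3]; ring

/-- Uniform mixing from a family of Nash type inequalities on dyadic scales. -/
theorem mixing_of_nash {G : Matrix ι ι ℝ} {c : ι → ι → ℝ} {w : ι → ℝ}
    (hw : ∀ x, 0 < w x) (hc0 : ∀ x y, 0 ≤ c x y)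
    (hrow : ∀ x, ∑ y, G x y = 0) (hoff : ∀ x y, x ≠ y → w x * G x y = c x y)
    (hc : ∀ x y, c x y = c y x) {h₀ H : ℕ} (hH : h₀ ≤ H) {A β Λ : ℝ} (hA : 0 < A) (hβ : 1 ≤ β)
    {b : ℕ → ℝ} (hb : ∀ h, 0 < b h) (hbs : ∀ h, h₀ ≤ h → h < H → b h ≤ β * b (h + 1))
    (hbH : b H = 1 / ∑ x, w x)
    (hNash : ∀ h, h₀ ≤ h → h ≤ H → ∀ f : ι → ℝ, (∀ x, 0 ≤ f x) → ∑ x, w x * f x = 1 →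
      ∑ x, w x * f x ^ 2 ≤ b h + A * 4 ^ h * energy c f)
    (hΛ : Λ * 4 ^ h₀ ≤ 4 ^ H) (hinit : ∀ x, 1 / w x ≤ b h₀ * Real.exp Λ) (x y : ι) :
    |semi G (2 * ((2 + 4 * β) * A * 4 ^ H)) x y - w y / ∑ x, w x| / (w y / ∑ x, w x)
      ≤ Real.exp (-1) := by
  have hsymm : ∀ x y, w x * G x y = w y * G y x := by
    intro x y
    by_cases h : x = y
    · rw [h]
    · rw [hoff x y h, hoff y x (Ne.symm h), hc]
  have hGn : ∀ x y, x ≠ y → 0 ≤ G x y := fun x y h => by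
    have := hc0 x y
    rw [← hoff x y h] at this
    exact nonneg_of_mul_nonneg_right this (hw x)
  set W := ∑ x, w x with hW
  have hWpos : 0 < W := Finset.sum_pos (fun x _ => hw x) ⟨x, Finset.mem_univ x⟩
  set F : ι → ℝ → ι → ℝ := fun x t y => semi G t x y / w y with hF
  have hF1 : ∀ x t, ∑ y, w y * F x t y = 1 := by
    intro x t
    rw [← semi_row_sum hrow t x]
    refine Finset.sum_congr rfl fun y _ => ?_
    have := (hw y).ne'
    simp only [hF]; field_simp
  have hF0 : ∀ x t, 0 ≤ t → ∀ y, 0 ≤ F x t y := fun x t ht y =>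
    div_nonneg (semi_nonneg hGn ht x y) (hw y).le
  set u : ι → ℝ → ℝ := fun x t => ∑ y, w y * F x t y ^ 2 with hu
  have hud : ∀ x t, HasDerivAt (u x) (-energy c (F x t)) t := by
    intro x t
    have h1 : ∀ y, HasDerivAt (fun t => w y * F x t y ^ 2)
        (w y * (2 * F x t y * ((semi G t * G) x y / w y))) t := by
      intro y
      have := (((hasDerivAt_semi_apply G t x y).div_const (w y)).pow 2).const_mul (w y)
      simpa using this
    have h2 := HasDerivAt.fun_sum (u := Finset.univ) fun y _ => h1 y
    refine h2.congr_deriv ?_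
    rw [energy_eq hrow hoff hc, neg_neg, Finset.mul_sum]
    refine Finset.sum_congr rfl fun y _ => ?_
    have e : (semi G t * G) x y / w y = ∑ z, G y z * F x t z := by
      rw [Matrix.mul_apply, Finset.sum_div]
      refine Finset.sum_congr rfl fun z _ => ?_
      have h3 := (hw y).ne'
      have h4 := (hw z).ne'
      have h5 := hsymm y z
      simp only [hF]
      field_simp
      linear_combination -(semi G t x z) * h5
    rw [e]; ring
  have hdec : ∀ x h, h₀ ≤ h → h ≤ H → ∀ t s, 0 ≤ t → 0 ≤ s →
      u x (t + s) - b h ≤ (u x t - b h) * Real.exp (-(s / (A * 4 ^ h))) := by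
    intro x h h1 h2 t s ht hs
    refine exp_decay_of_deriv_le (by positivity) (hud x) (fun r hr => ?_) ht hs
    have := hNash h h1 h2 (F x r) (hF0 x r hr) (hF1 x r)
    linarith
  have hu0 : ∀ x, u x 0 = 1 / w x := by
    intro x
    simp only [hu, hF, semi_zero]
    rw [Finset.sum_eq_single x]
    · have := (hw x).ne'
      rw [Matrix.one_apply_eq]; field_simp
    · intro y _ hy
      rw [Matrix.one_apply_ne (Ne.symm hy)]; simp
    · simp
  have hstep : ∀ x n, h₀ + n ≤ H →
      u x (A * 4 ^ H + 4 * β * A * 4 ^ (h₀ + n)) ≤ 2 * b (h₀ + n) := by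
    intro x n
    induction n with
    | zero =>
      intro _
      have h1 := hdec x h₀ le_rfl hH 0 (A * 4 ^ H + 4 * β * A * 4 ^ h₀) le_rfl (by positivity)
      rw [zero_add, hu0] at h1
      have h2 : Real.exp (-((A * 4 ^ H + 4 * β * A * 4 ^ h₀) / (A * 4 ^ h₀))) ≤ Real.exp (-Λ) := by
        rw [Real.exp_le_exp, neg_le_neg_iff, le_div_iff₀ (by positivity)]
        have := mul_le_mul_of_nonneg_left hΛ hA.le
        have : 0 ≤ 4 * β * A * 4 ^ h₀ := by positivity
        linarith
      have h3 : (1 / w x - b h₀) * Real.exp (-((A * 4 ^ H + 4 * β * A * 4 ^ h₀) / (A * 4 ^ h₀)))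
          ≤ b h₀ := by
        calc _ ≤ 1 / w x * Real.exp (-((A * 4 ^ H + 4 * β * A * 4 ^ h₀) / (A * 4 ^ h₀))) :=
              mul_le_mul_of_nonneg_right (by linarith [hb h₀]) (Real.exp_pos _).le
          _ ≤ (b h₀ * Real.exp Λ) * Real.exp (-Λ) :=
              mul_le_mul (hinit x) h2 (Real.exp_pos _).le (by have := hb h₀; positivity)
          _ = b h₀ := by rw [mul_assoc, ← Real.exp_add]; simp
      simp only [add_zero]
      linarith
    | succ n ih =>
      intro hn
      have hn' : h₀ + n < H := by omega
      have h1 := ih hn'.le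
      have h2 := hdec x (h₀ + (n + 1)) (by omega) hn (A * 4 ^ H + 4 * β * A * 4 ^ (h₀ + n))
        (12 * β * A * 4 ^ (h₀ + n)) (by positivity) (by positivity)
      have e1 : A * 4 ^ H + 4 * β * A * 4 ^ (h₀ + n) + 12 * β * A * 4 ^ (h₀ + n)
          = A * 4 ^ H + 4 * β * A * 4 ^ (h₀ + (n + 1)) := by
        rw [← add_assoc h₀, pow_succ]; ring
      have e2 : 12 * β * A * 4 ^ (h₀ + n) / (A * 4 ^ (h₀ + (n + 1))) = 3 * β := by
        rw [← add_assoc h₀, pow_succ]; field_simp; norm_num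
      rw [e1, e2] at h2
      have h3 := hbs (h₀ + n) (by omega) hn'
      rw [add_assoc] at h3
      have h4 : 2 * β * Real.exp (-(3 * β)) ≤ 1 := by
        rw [Real.exp_neg, ← div_eq_mul_inv, div_le_one (Real.exp_pos _)]
        linarith [Real.add_one_le_exp (3 * β)]
      have hb' := hb (h₀ + (n + 1))
      have h5 : (u x (A * 4 ^ H + 4 * β * A * 4 ^ (h₀ + n)) - b (h₀ + (n + 1)))
          * Real.exp (-(3 * β)) ≤ b (h₀ + (n + 1)) := by
        calc _ ≤ (2 * β * b (h₀ + (n + 1))) * Real.exp (-(3 * β)) :=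
              mul_le_mul_of_nonneg_right (by linarith) (Real.exp_pos _).le
          _ = b (h₀ + (n + 1)) * (2 * β * Real.exp (-(3 * β))) := by ring
          _ ≤ b (h₀ + (n + 1)) * 1 := mul_le_mul_of_nonneg_left h4 hb'.le
          _ = _ := mul_one _
      linarith
  set T := (2 + 4 * β) * A * 4 ^ H with hT
  have hfin : ∀ x, u x T - 1 / W ≤ 1 / W * Real.exp (-1) := by
    intro x
    obtain ⟨n, rfl⟩ := Nat.exists_eq_add_of_le hH
    have h1 := hstep x n le_rfl
    have h2 := hdec x (h₀ + n) hH le_rfl (A * 4 ^ (h₀ + n) + 4 * β * A * 4 ^ (h₀ + n))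
      (A * 4 ^ (h₀ + n)) (by positivity) (by positivity)
    rw [div_self (by positivity), hbH] at h2
    have e : A * 4 ^ (h₀ + n) + 4 * β * A * 4 ^ (h₀ + n) + A * 4 ^ (h₀ + n) = T := by
      rw [hT]; ring
    rw [e] at h2
    refine h2.trans (mul_le_mul_of_nonneg_right ?_ (Real.exp_pos _).le)
    rw [hbH] at h1
    linarith
  have hvar : ∀ x, ∑ z, w z * (F x T z - 1 / W) ^ 2 = u x T - 1 / W := by
    intro x
    have : ∀ z, w z * (F x T z - 1 / W) ^ 2
        = w z * F x T z ^ 2 - 2 / W * (w z * F x T z) + 1 / W ^ 2 * w z := fun z => by ring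
    simp only [this, Finset.sum_add_distrib, Finset.sum_sub_distrib, ← Finset.mul_sum]
    rw [hF1, ← hW]
    simp only [hu]
    field_simp
    ring
  have hcov : semi G (2 * T) x y / (w y / W) - 1
      = W * ∑ z, w z * ((F x T z - 1 / W) * (F y T z - 1 / W)) := by
    have h1 : ∀ z, w z * ((F x T z - 1 / W) * (F y T z - 1 / W))
        = w z * F x T z * F y T z - 1 / W * (w z * F x T z) - 1 / W * (w z * F y T z)
          + 1 / W ^ 2 * w z := fun z => by ring
    simp only [h1, Finset.sum_add_distrib, Finset.sum_sub_distrib, ← Finset.mul_sum]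
    rw [hF1, hF1, ← hW, two_mul, semi_add, Matrix.mul_apply]
    have h2 : ∑ z, semi G T x z * semi G T z y = w y * ∑ z, w z * F x T z * F y T z := by
      rw [Finset.mul_sum]
      refine Finset.sum_congr rfl fun z _ => ?_
      have h3 := semi_reversible hsymm T z y
      have h4 := (hw z).ne'
      simp only [hF]
      field_simp
      linear_combination (semi G T x z) * h3
    rw [h2]
    have := (hw y).ne'
    field_simp
    ring
  have hq : 0 < w y / W := div_pos (hw y) hWpos
  have e1 : |semi G (2 * T) x y - w y / W| / (w y / W) = |semi G (2 * T) x y / (w y / W) - 1| := by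
    rw [← abs_of_pos hq, ← abs_div, abs_of_pos hq, sub_div, div_self hq.ne']
  rw [e1, hcov, abs_mul, abs_of_pos hWpos]
  have h6 : |∑ z, w z * ((F x T z - 1 / W) * (F y T z - 1 / W))|
      ≤ ∑ z, (w z * (F x T z - 1 / W) ^ 2 / 2 + w z * (F y T z - 1 / W) ^ 2 / 2) := by
    refine (Finset.abs_sum_le_sum_abs _ _).trans (Finset.sum_le_sum fun z _ => ?_)
    rw [abs_mul, abs_of_pos (hw z)]
    have : |(F x T z - 1 / W) * (F y T z - 1 / W)|
        ≤ ((F x T z - 1 / W) ^ 2 + (F y T z - 1 / W) ^ 2) / 2 := by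
      rw [abs_le]
      constructor <;> nlinarith [sq_nonneg (F x T z - 1 / W + (F y T z - 1 / W)),
        sq_nonneg (F x T z - 1 / W - (F y T z - 1 / W))]
    nlinarith [mul_le_mul_of_nonneg_left this (hw z).le]
  rw [Finset.sum_add_distrib, ← Finset.sum_div, ← Finset.sum_div, hvar, hvar] at h6
  have h7 := hfin x
  have h8 := hfin y
  calc _ ≤ W * (1 / W * Real.exp (-1)) := mul_le_mul_of_nonneg_left (by linarith) hWpos.le
    _ = Real.exp (-1) := by field_simp

end Mixing

section Grid

variable {d : ℕ}

/-- The index of the dyadic tile of side `2 ^ h` containing a cell. -/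
def coarse (h : ℕ) (z : Fin d → ℕ) : Fin d → ℕ := fun i => z i / 2 ^ h

/-- The dyadic tile of side `2 ^ h` with index `b`. -/
def tile (h : ℕ) (b : Fin d → ℕ) : Finset (Fin d → ℕ) :=
  Fintype.piFinset fun i => Finset.Ico (b i * 2 ^ h) ((b i + 1) * 2 ^ h)

lemma mem_tile {h : ℕ} {b z : Fin d → ℕ} : z ∈ tile h b ↔ coarse h z = b := by
  have hp : 0 < 2 ^ h := by positivity
  simp only [tile, Fintype.mem_piFinset, Finset.mem_Ico, funext_iff, coarse]
  refine forall_congr' fun i => ?_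
  rw [Nat.div_eq_iff hp]
  have : (b i + 1) * 2 ^ h = b i * 2 ^ h + 2 ^ h := by ring
  omega

lemma card_tile (h : ℕ) (b : Fin d → ℕ) : (tile h b).card = 2 ^ (h * d) := by
  simp only [tile, Fintype.card_piFinset, Nat.card_Ico]
  have : ∀ i, (b i + 1) * 2 ^ h - b i * 2 ^ h = 2 ^ h := fun i => by
    rw [add_mul, one_mul, Nat.add_sub_cancel_left]
  simp [this, pow_mul]

lemma coarse_coarse (h k : ℕ) (z : Fin d → ℕ) : coarse k (coarse h z) = coarse (h + k) z := by
  funext i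
  simp [coarse, Nat.div_div_eq_div_mul, pow_add]

lemma coarse_congr {h k : ℕ} (hk : h ≤ k) {z z' : Fin d → ℕ} (e : coarse h z = coarse h z') :
    coarse k z = coarse k z' := by
  obtain ⟨n, rfl⟩ := Nat.exists_eq_add_of_le hk
  rw [← coarse_coarse, ← coarse_coarse, e]

lemma sum_tile_split {M : Type*} [AddCommMonoid M] {h k : ℕ} (hk : h ≤ k) (b : Fin d → ℕ)
    (φ : (Fin d → ℕ) → M) :
    ∑ b' ∈ tile (k - h) b, ∑ z ∈ tile h b', φ z = ∑ z ∈ tile k b, φ z := by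
  have hmaps : ∀ z ∈ tile k b, coarse h z ∈ tile (k - h) b := fun z hz => by
    rw [mem_tile, coarse_coarse, Nat.add_sub_cancel' hk]; exact mem_tile.1 hz
  rw [← Finset.sum_fiberwise_of_maps_to hmaps]
  refine Finset.sum_congr rfl fun b' hb' => Finset.sum_congr ?_ fun _ _ => rfl
  ext z
  rw [Finset.mem_filter, mem_tile, mem_tile]
  constructor
  · rintro rfl
    refine ⟨?_, rfl⟩
    have := mem_tile.1 hb'
    rwa [coarse_coarse, Nat.add_sub_cancel' hk] at this
  · exact fun h => h.2

lemma update_mem_tile {h : ℕ} {b z : Fin d → ℕ} (hz : z ∈ tile h b) {k : Fin d} {t : ℕ}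
    (ht : t ∈ Finset.Ico (b k * 2 ^ h) ((b k + 1) * 2 ^ h)) : Function.update z k t ∈ tile h b := by
  simp only [tile, Fintype.mem_piFinset] at hz ⊢
  intro i
  by_cases hi : i = k
  · subst hi; simpa using ht
  · rw [Function.update_of_ne hi]; exact hz i

lemma piecewise_mem_tile {h : ℕ} {b z z' : Fin d → ℕ} (hz : z ∈ tile h b) (hz' : z' ∈ tile h b)
    (S : Finset (Fin d)) : S.piecewise z' z ∈ tile h b := by
  simp only [tile, Fintype.mem_piFinset] at hz hz' ⊢
  intro i
  by_cases hi : i ∈ S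
  · rw [Finset.piecewise_eq_of_mem _ _ _ hi]; exact hz' i
  · rw [Finset.piecewise_eq_of_notMem _ _ _ hi]; exact hz i

/-- The cell following `z` in direction `k`. -/
def next (k : Fin d) (z : Fin d → ℕ) : Fin d → ℕ := Function.update z k (z k + 1)

lemma next_injective (k : Fin d) : Function.Injective (next (d := d) k) := by
  intro z z' h
  funext i
  have hi := congrFun h i
  by_cases e : i = k
  · subst e; simpa [next] using hi
  · simpa [next, Function.update_of_ne e] using hi

/-- Absolute increment of `g` in direction `k` inside a tile. -/
def incr (g : (Fin d → ℕ) → ℝ) (P : Finset (Fin d → ℕ)) (k : Fin d) (z : Fin d → ℕ) : ℝ :=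
  if next k z ∈ P then |g (next k z) - g z| else 0

lemma incr_nonneg (g : (Fin d → ℕ) → ℝ) (P : Finset (Fin d → ℕ)) (k : Fin d) (z : Fin d → ℕ) :
    0 ≤ incr g P k z := by
  unfold incr; split_ifs <;> positivity

lemma line_bound (g : (Fin d → ℕ) → ℝ) {h : ℕ} {b z : Fin d → ℕ} (hz : z ∈ tile h b) {k : Fin d}
    {t : ℕ} (ht : t ∈ Finset.Ico (b k * 2 ^ h) ((b k + 1) * 2 ^ h)) :
    |g (Function.update z k t) - g z| ≤
      ∑ s ∈ Finset.Ico (b k * 2 ^ h) ((b k + 1) * 2 ^ h),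
        incr g (tile h b) k (Function.update z k s) := by
  set I := Finset.Ico (b k * 2 ^ h) ((b k + 1) * 2 ^ h) with hI
  have key : ∀ m n, m ≤ n → m ∈ I → n ∈ I →
      |g (Function.update z k m) - g (Function.update z k n)| ≤
        ∑ s ∈ I, incr g (tile h b) k (Function.update z k s) := by
    intro m n hmn hm hn
    have h1 := dist_le_Ico_sum_dist (fun s => g (Function.update z k s)) hmn
    rw [Real.dist_eq] at h1
    refine h1.trans ?_
    have hsub : Finset.Ico m n ⊆ I := by
      intro s hs
      rw [hI, Finset.mem_Ico] at *
      omega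
    refine le_trans (Finset.sum_le_sum fun s hs => ?_)
      (Finset.sum_le_sum_of_subset_of_nonneg hsub fun s _ _ => incr_nonneg _ _ _ _)
    have hs1 : s + 1 ∈ I := by
      rw [hI, Finset.mem_Ico] at *
      omega
    have e : next k (Function.update z k s) = Function.update z k (s + 1) := by simp [next]
    rw [incr, e, if_pos (update_mem_tile hz hs1), Real.dist_eq, abs_sub_comm]
  have hzk : z k ∈ I := by
    simp only [tile, Fintype.mem_piFinset] at hz
    exact hz k
  rcases le_total (z k) t with hle | hle
  · have := key _ _ hle hzk ht
    rw [Function.update_eq_self, abs_sub_comm] at this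
    exact this
  · have := key _ _ hle ht hzk
    rwa [Function.update_eq_self] at this

lemma sum_line (F : (Fin d → ℕ) → ℝ) (h : ℕ) (b : Fin d → ℕ) (k : Fin d) :
    ∑ z ∈ tile h b, ∑ s ∈ Finset.Ico (b k * 2 ^ h) ((b k + 1) * 2 ^ h), F (Function.update z k s)
      = 2 ^ h * ∑ z ∈ tile h b, F z := by
  set I := Finset.Ico (b k * 2 ^ h) ((b k + 1) * 2 ^ h) with hI
  have hcard : (I.card : ℝ) = 2 ^ h := by
    rw [hI, Nat.card_Ico, add_mul, one_mul, Nat.add_sub_cancel_left]; push_cast; rfl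
  have h1 : ∑ z ∈ tile h b, ∑ s ∈ I, F z = 2 ^ h * ∑ z ∈ tile h b, F z := by
    rw [Finset.mul_sum]
    refine Finset.sum_congr rfl fun z _ => ?_
    rw [Finset.sum_const, nsmul_eq_mul, hcard]
  rw [← h1, ← Finset.sum_product', ← Finset.sum_product']
  have hmem : ∀ p ∈ tile h b ×ˢ I, (Function.update p.1 k p.2, p.1 k) ∈ tile h b ×ˢ I := by
    rintro ⟨z, s⟩ hp
    rw [Finset.mem_product] at hp ⊢
    refine ⟨update_mem_tile hp.1 hp.2, ?_⟩
    have := hp.1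
    simp only [tile, Fintype.mem_piFinset] at this
    exact this k
  refine Finset.sum_nbij' (fun p => (Function.update p.1 k p.2, p.1 k))
    (fun p => (Function.update p.1 k p.2, p.1 k)) hmem hmem ?_ ?_ ?_
  · rintro ⟨z, s⟩ _; simp
  · rintro ⟨z, s⟩ _; simp
  · rintro ⟨z, s⟩ _; rfl

/-- Total variation of `g` on a tile. -/
def gradSum (g : (Fin d → ℕ) → ℝ) (P : Finset (Fin d → ℕ)) : ℝ := ∑ k, ∑ z ∈ P, incr g P k z

lemma abs_sub_le_gradSum (g : (Fin d → ℕ) → ℝ) {h : ℕ} {b z z' : Fin d → ℕ} (hz : z ∈ tile h b)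
    (hz' : z' ∈ tile h b) : |g z' - g z| ≤ gradSum g (tile h b) := by
  have key : ∀ S : Finset (Fin d), |g (S.piecewise z' z) - g z|
      ≤ ∑ k ∈ S, ∑ z ∈ tile h b, incr g (tile h b) k z := by
    intro S
    induction S using Finset.induction_on with
    | empty => simp
    | insert k S hk ih =>
      rw [Finset.sum_insert hk, Finset.piecewise_insert]
      set u := S.piecewise z' z with hu
      have hu' : u ∈ tile h b := piecewise_mem_tile hz hz' S
      have ht : z' k ∈ Finset.Ico (b k * 2 ^ h) ((b k + 1) * 2 ^ h) := by
        simp only [tile, Fintype.mem_piFinset] at hz'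
        exact hz' k
      have h1 := line_bound g hu' ht
      have h2 : ∑ s ∈ Finset.Ico (b k * 2 ^ h) ((b k + 1) * 2 ^ h),
          incr g (tile h b) k (Function.update u k s) ≤ ∑ z ∈ tile h b, incr g (tile h b) k z := by
        rw [← Finset.sum_image (f := fun z => incr g (tile h b) k z)
          (g := fun s => Function.update u k s)
          (fun s _ t _ e => by simpa using congrFun e k)]
        refine Finset.sum_le_sum_of_subset_of_nonneg ?_ fun s _ _ => incr_nonneg _ _ _ _
        intro v hv
        obtain ⟨s, hs, rfl⟩ := Finset.mem_image.1 hv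
        exact update_mem_tile hu' hs
      have h3 := abs_sub_le (g (Function.update u k (z' k))) (g u) (g z)
      linarith
  have := key Finset.univ
  rwa [Finset.piecewise_univ] at this

lemma sum_abs_sub_le_gradSum (g : (Fin d → ℕ) → ℝ) (h : ℕ) (b : Fin d → ℕ) :
    ∑ z ∈ tile h b, ∑ z' ∈ tile h b, |g z' - g z|
      ≤ 2 ^ (h * d) * 2 ^ h * gradSum g (tile h b) := by
  have key : ∀ S : Finset (Fin d),
      ∑ z ∈ tile h b, ∑ z' ∈ tile h b, |g (S.piecewise z' z) - g z|
      ≤ 2 ^ (h * d) * 2 ^ h * ∑ k ∈ S, ∑ z ∈ tile h b, incr g (tile h b) k z := by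
    intro S
    induction S using Finset.induction_on with
    | empty => simp
    | insert k S hk ih =>
      rw [Finset.sum_insert hk, mul_add]
      have h1 : ∑ z ∈ tile h b, ∑ z' ∈ tile h b,
            |g (Function.update (S.piecewise z' z) k (z' k)) - g (S.piecewise z' z)|
          = ∑ z ∈ tile h b, ∑ z' ∈ tile h b, |g (Function.update z k (z' k)) - g z| := by
        rw [← Finset.sum_product', ← Finset.sum_product']
        have hmem : ∀ p ∈ tile h b ×ˢ tile h b,
            (S.piecewise p.2 p.1, S.piecewise p.1 p.2) ∈ tile h b ×ˢ tile h b := by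
          rintro ⟨z, z'⟩ hp
          rw [Finset.mem_product] at hp ⊢
          exact ⟨piecewise_mem_tile hp.1 hp.2 S, piecewise_mem_tile hp.2 hp.1 S⟩
        have hinv : ∀ p : (Fin d → ℕ) × (Fin d → ℕ),
            (S.piecewise (S.piecewise p.1 p.2) (S.piecewise p.2 p.1),
              S.piecewise (S.piecewise p.2 p.1) (S.piecewise p.1 p.2)) = p := by
          rintro ⟨z, z'⟩
          refine Prod.ext ?_ ?_ <;> funext i <;> by_cases hi : i ∈ S <;> simp [hi]
        refine Finset.sum_nbij' (fun p => (S.piecewise p.2 p.1, S.piecewise p.1 p.2))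
          (fun p => (S.piecewise p.2 p.1, S.piecewise p.1 p.2)) hmem hmem
          (fun p _ => hinv p) (fun p _ => hinv p) ?_
        rintro ⟨z, z'⟩ _
        simp [Finset.piecewise_eq_of_notMem _ _ _ hk]
      have h2 : ∑ z ∈ tile h b, ∑ z' ∈ tile h b, |g (Function.update z k (z' k)) - g z|
          ≤ 2 ^ (h * d) * 2 ^ h * ∑ z ∈ tile h b, incr g (tile h b) k z := by
        calc _ ≤ ∑ z ∈ tile h b, ∑ z' ∈ tile h b,
              ∑ s ∈ Finset.Ico (b k * 2 ^ h) ((b k + 1) * 2 ^ h),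
                incr g (tile h b) k (Function.update z k s) := by
              refine Finset.sum_le_sum fun z hz => Finset.sum_le_sum fun z' hz' => ?_
              refine line_bound g hz ?_
              simp only [tile, Fintype.mem_piFinset] at hz'
              exact hz' k
          _ = _ := by
              simp only [Finset.sum_const, card_tile, nsmul_eq_mul]
              rw [← Finset.mul_sum, sum_line]
              push_cast
              ring
      rw [← h1] at h2
      refine le_trans ?_ (add_le_add h2 ih)
      rw [← Finset.sum_add_distrib]
      refine Finset.sum_le_sum fun z _ => ?_
      rw [← Finset.sum_add_distrib]
      refine Finset.sum_le_sum fun z' _ => ?_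
      rw [Finset.piecewise_insert]
      exact abs_sub_le _ _ _
  have := key Finset.univ
  simp only [Finset.piecewise_univ] at this
  exact this

/-- The average of `g` over a tile. -/
def tileAvg (g : (Fin d → ℕ) → ℝ) (h : ℕ) (b : Fin d → ℕ) : ℝ :=
  (∑ z ∈ tile h b, g z) / 2 ^ (h * d)

lemma abs_sub_tileAvg_le (g : (Fin d → ℕ) → ℝ) {h : ℕ} {b z : Fin d → ℕ} (hz : z ∈ tile h b) :
    |g z - tileAvg g h b| ≤ gradSum g (tile h b) := by
  have hp : (0 : ℝ) < 2 ^ (h * d) := by positivity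
  have hc : ((tile h b).card : ℝ) = 2 ^ (h * d) := by rw [card_tile]; push_cast; rfl
  have e : g z - tileAvg g h b = (∑ z' ∈ tile h b, (g z - g z')) / 2 ^ (h * d) := by
    rw [tileAvg, Finset.sum_sub_distrib, Finset.sum_const, nsmul_eq_mul, hc]; field_simp
  rw [e, abs_div, abs_of_pos hp, div_le_iff₀ hp]
  refine (Finset.abs_sum_le_sum_abs _ _).trans ?_
  calc _ ≤ ∑ z' ∈ tile h b, gradSum g (tile h b) :=
        Finset.sum_le_sum fun z' hz' => abs_sub_le_gradSum g hz' hz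
    _ = _ := by rw [Finset.sum_const, nsmul_eq_mul, hc, mul_comm]

lemma abs_tileAvg_sub_le (g : (Fin d → ℕ) → ℝ) (h : ℕ) {b b' : Fin d → ℕ}
    (hb : b ∈ tile 1 b') :
    |tileAvg g h b - tileAvg g (h + 1) b'|
      ≤ 2 ^ (h + 1) / 2 ^ (h * d) * gradSum g (tile (h + 1) b') := by
  have hp : (0 : ℝ) < 2 ^ (h * d) := by positivity
  have hp' : (0 : ℝ) < 2 ^ ((h + 1) * d) := by positivity
  have hc : ((tile h b).card : ℝ) = 2 ^ (h * d) := by rw [card_tile]; push_cast; rfl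
  have hc' : ((tile (h + 1) b').card : ℝ) = 2 ^ ((h + 1) * d) := by
    rw [card_tile]; push_cast; rfl
  have e : tileAvg g h b - tileAvg g (h + 1) b'
      = (∑ z ∈ tile h b, ∑ z' ∈ tile (h + 1) b', (g z - g z'))
        / (2 ^ (h * d) * 2 ^ ((h + 1) * d)) := by
    simp only [tileAvg, Finset.sum_sub_distrib, Finset.sum_const, nsmul_eq_mul, hc, hc',
      ← Finset.mul_sum]
    field_simp
  rw [e, abs_div, abs_of_pos (by positivity : (0 : ℝ) < 2 ^ (h * d) * 2 ^ ((h + 1) * d)),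
    div_le_iff₀ (by positivity)]
  have hsub : tile h b ⊆ tile (h + 1) b' := by
    intro z hz
    rw [mem_tile] at hz hb ⊢
    rw [← coarse_coarse, hz, hb]
  calc |∑ z ∈ tile h b, ∑ z' ∈ tile (h + 1) b', (g z - g z')|
      ≤ ∑ z ∈ tile h b, ∑ z' ∈ tile (h + 1) b', |g z' - g z| := by
        refine (Finset.abs_sum_le_sum_abs _ _).trans (Finset.sum_le_sum fun z _ => ?_)
        refine (Finset.abs_sum_le_sum_abs _ _).trans (Finset.sum_le_sum fun z' _ => ?_)
        rw [abs_sub_comm]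
    _ ≤ ∑ z ∈ tile (h + 1) b', ∑ z' ∈ tile (h + 1) b', |g z' - g z| :=
        Finset.sum_le_sum_of_subset_of_nonneg hsub fun z _ _ =>
          Finset.sum_nonneg fun _ _ => abs_nonneg _
    _ ≤ _ := sum_abs_sub_le_gradSum g (h + 1) b'
    _ = _ := by field_simp

end Grid

section Net

variable {ι : Type*} [Fintype ι] {d : ℕ}

/-- A weighted graph covered by a dyadic hierarchy of tiles: each cell `z` has a representative
`pt z` in the tile of side `2 ^ lev z` around it, representatives of neighbouring cells are
joined by edges of resistance at most `R`, and cells of high level are rare. -/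
structure DyadicNet (H J : ℕ) (CR Cw c₀ : ℝ) (R : ℕ → ℝ) (w : ι → ℝ) (c : ι → ι → ℝ)
    (cl : ι → Fin d → ℕ) (pt : (Fin d → ℕ) → ι) (lev : (Fin d → ℕ) → ℕ) : Prop where
  cl_mem : ∀ x, cl x ∈ tile H 0
  lev_le : ∀ z ∈ tile H 0, lev z ≤ J
  coarse_pt : ∀ z ∈ tile H 0, coarse (lev z) (cl (pt z)) = coarse (lev z) z
  R_nonneg : ∀ j, 1 ≤ R j
  c_nonneg : ∀ x y, 0 ≤ c x y
  c_symm : ∀ x y, c x y = c y x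
  w_pos : ∀ x, 0 < w x
  w_pt : ∀ z ∈ tile H 0, c₀ ≤ w (pt z)
  adj : ∀ k, ∀ z ∈ tile H 0, next k z ∈ tile H 0 →
    1 ≤ R (max (lev z) (lev (next k z))) * c (pt z) (pt (next k z))
  attach : ∀ x, 1 ≤ R (lev (cl x)) * c x (pt (cl x))
  w_lower : ∀ x, 1 ≤ R (lev (cl x)) * w x
  density : ∀ b ∈ tile (H - J) 0,
    ∑ z ∈ tile J b, R (lev z) * 2 ^ (lev z * (d + 1)) ≤ CR * 2 ^ (J * d)
  upper : ∀ b ∈ tile (H - J) 0, ∑ x with coarse J (cl x) = b, w x ≤ Cw * 2 ^ (J * d)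

namespace DyadicNet

variable {H J : ℕ} {CR Cw c₀ : ℝ} {R : ℕ → ℝ} {w : ι → ℝ} {c : ι → ι → ℝ}
  {cl : ι → Fin d → ℕ} {pt : (Fin d → ℕ) → ι} {lev : (Fin d → ℕ) → ℕ}

lemma tile_subset {h k : ℕ} (hk : h ≤ k) {b b' : Fin d → ℕ} (hb : b ∈ tile (k - h) b') :
    tile h b ⊆ tile k b' := by
  intro z hz
  rw [mem_tile] at *
  rw [← Nat.add_sub_cancel' hk, ← coarse_coarse, hz, hb]

lemma coarse_mem {h k : ℕ} (hk : h ≤ k) {z b : Fin d → ℕ} (hz : z ∈ tile k b) :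
    coarse h z ∈ tile (k - h) b := by
  rw [mem_tile, coarse_coarse, Nat.add_sub_cancel' hk]
  exact mem_tile.1 hz

section

variable (N : DyadicNet H J CR Cw c₀ R w c cl pt lev)
include N

lemma sum_cells (h : ℕ) (hH : h ≤ H) (φ : ι → ℝ) :
    ∑ b ∈ tile (H - h) (0 : Fin d → ℕ), ∑ x with coarse h (cl x) = b, φ x = ∑ x, φ x :=
  Finset.sum_fiberwise_of_maps_to (fun x _ => coarse_mem hH (N.cl_mem x)) φ

lemma sum_tile_density {h : ℕ} (hJ : J ≤ h) (hH : h ≤ H) {b : Fin d → ℕ}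
    (hb : b ∈ tile (H - h) 0) :
    ∑ z ∈ tile h b, R (lev z) * 2 ^ (lev z * (d + 1)) ≤ CR * 2 ^ (h * d) := by
  rw [← sum_tile_split hJ]
  refine (Finset.sum_le_card_nsmul _ _ (CR * 2 ^ (J * d)) fun b' hb' => N.density b' ?_).trans ?_
  · have : H - h = (H - J) - (h - J) := by omega
    rw [this] at hb
    exact tile_subset (by omega) hb hb'
  · rw [card_tile, nsmul_eq_mul]
    push_cast
    obtain ⟨n, rfl⟩ := Nat.exists_eq_add_of_le hJ
    rw [Nat.add_sub_cancel_left]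
    apply le_of_eq
    ring

lemma weight_le {h : ℕ} (hJ : J ≤ h) (hH : h ≤ H) {b : Fin d → ℕ} (hb : b ∈ tile (H - h) 0) :
    ∑ x with coarse h (cl x) = b, w x ≤ Cw * 2 ^ (h * d) := by
  have hmaps : ∀ x ∈ Finset.univ.filter (fun x => coarse h (cl x) = b),
      coarse J (cl x) ∈ tile (h - J) b := by
    intro x hx
    exact coarse_mem hJ (mem_tile.2 (Finset.mem_filter.1 hx).2)
  rw [← Finset.sum_fiberwise_of_maps_to hmaps]
  refine (Finset.sum_le_card_nsmul _ _ (Cw * 2 ^ (J * d)) fun b' hb' => ?_).trans ?_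
  · refine le_trans ?_ (N.upper b' ?_)
    · refine Finset.sum_le_sum_of_subset_of_nonneg ?_ fun x _ _ => (N.w_pos x).le
      intro x hx
      rw [Finset.mem_filter] at hx ⊢
      exact ⟨Finset.mem_univ _, hx.2⟩
    · have : H - h = (H - J) - (h - J) := by omega
      rw [this] at hb
      exact tile_subset (by omega) hb hb'
  · rw [card_tile, nsmul_eq_mul]
    push_cast
    obtain ⟨n, rfl⟩ := Nat.exists_eq_add_of_le hJ
    rw [Nat.add_sub_cancel_left]
    apply le_of_eq
    ring

lemma coarse_cl_pt {h : ℕ} (hJ : J ≤ h) (hH : h ≤ H) {b z : Fin d → ℕ}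
    (hb : b ∈ tile (H - h) 0) (hz : z ∈ tile h b) : coarse h (cl (pt z)) = b := by
  have hz' := tile_subset hH hb hz
  rw [coarse_congr ((N.lev_le z hz').trans hJ) (N.coarse_pt z hz')]
  exact mem_tile.1 hz

lemma sum_pt_le {h : ℕ} (hJ : J ≤ h) (hH : h ≤ H) {b : Fin d → ℕ} (hb : b ∈ tile (H - h) 0)
    (F : ι → ℝ) (hF : ∀ x, 0 ≤ F x) :
    ∑ z ∈ tile h b, F (pt z) / 2 ^ (lev z * (d + 1))
      ≤ 2 * ∑ x with coarse h (cl x) = b, F x := by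
  classical
  have hmaps : ∀ z ∈ tile h b, pt z ∈ Finset.univ.filter fun x => coarse h (cl x) = b :=
    fun z hz => Finset.mem_filter.2 ⟨Finset.mem_univ _, N.coarse_cl_pt hJ hH hb hz⟩
  rw [← Finset.sum_fiberwise_of_maps_to hmaps, Finset.mul_sum]
  refine Finset.sum_le_sum fun x _ => ?_
  have hx : ∑ z ∈ tile h b with pt z = x, F (pt z) / 2 ^ (lev z * (d + 1))
      = F x * ∑ z ∈ tile h b with pt z = x, (1 / 2 ^ (lev z * (d + 1)) : ℝ) := by
    rw [Finset.mul_sum]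
    refine Finset.sum_congr rfl fun z hz => ?_
    rw [(Finset.mem_filter.1 hz).2]
    ring
  rw [hx, mul_comm (2 : ℝ)]
  refine mul_le_mul_of_nonneg_left ?_ (hF x)
  have hlev : ∀ z ∈ (tile h b).filter (fun z => pt z = x), lev z ∈ Finset.range (J + 1) := by
    intro z hz
    have := N.lev_le z (tile_subset hH hb (Finset.mem_filter.1 hz).1)
    exact Finset.mem_range.2 (by omega)
  rw [← Finset.sum_fiberwise_of_maps_to hlev]
  calc _ ≤ ∑ i ∈ Finset.range (J + 1), (1 / 2 : ℝ) ^ i := by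
        refine Finset.sum_le_sum fun i _ => ?_
        calc _ ≤ ∑ z ∈ tile i (coarse i (cl x)), (1 / 2 ^ (i * (d + 1)) : ℝ) := by
              have : ∀ z ∈ ((tile h b).filter (fun z => pt z = x)).filter (fun z => lev z = i),
                  (1 / 2 ^ (lev z * (d + 1)) : ℝ) = 1 / 2 ^ (i * (d + 1)) := fun z hz => by
                rw [(Finset.mem_filter.1 hz).2]
              rw [Finset.sum_congr rfl this]
              refine Finset.sum_le_sum_of_subset_of_nonneg ?_ fun _ _ _ => by positivity
              intro z hz
              rw [Finset.mem_filter, Finset.mem_filter] at hz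
              obtain ⟨⟨hz1, rfl⟩, rfl⟩ := hz
              rw [mem_tile]
              exact (N.coarse_pt z (tile_subset hH hb hz1)).symm
          _ = _ := by
              rw [Finset.sum_const, card_tile, nsmul_eq_mul, mul_add, mul_one, pow_add, one_div_pow]
              push_cast
              field_simp
    _ ≤ 2 := sum_geometric_two_le _

lemma sq_gradSum_le {h : ℕ} (hJ : J ≤ h) (hH : h ≤ H) {b : Fin d → ℕ} (hb : b ∈ tile (H - h) 0)
    (f : ι → ℝ) :
    gradSum (fun z => f (pt z)) (tile h b) ^ 2 ≤ 4 * (d : ℝ) ^ 2 * CR * 2 ^ (h * d) *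
      ∑ x with coarse h (cl x) = b, ∑ y with coarse h (cl y) = b, c x y * (f x - f y) ^ 2 := by
  set P := tile h b with hP
  set X := Finset.univ.filter (fun x => coarse h (cl x) = b) with hX
  set ρ : (Fin d → ℕ) → ℝ := fun z => R (lev z) * 2 ^ (lev z * (d + 1)) with hρ
  have hρ0 : ∀ z, 0 ≤ ρ z := fun z => by
    have := N.R_nonneg (lev z)
    positivity
  set Q : ι → ℝ := fun x => ∑ y ∈ X, c x y * (f x - f y) ^ 2 with hQ
  have hQ0 : ∀ x, 0 ≤ Q x := fun x =>
    Finset.sum_nonneg fun y _ => mul_nonneg (N.c_nonneg x y) (sq_nonneg _)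
  set r : (Fin d) × (Fin d → ℕ) → ℝ := fun p => incr (fun z => f (pt z)) P p.1 p.2
  set A : (Fin d) × (Fin d → ℕ) → ℝ := fun p =>
    if next p.1 p.2 ∈ P then ρ p.2 + ρ (next p.1 p.2) else 0 with hA
  set B : (Fin d) × (Fin d → ℕ) → ℝ := fun p => Q (pt p.2) / 2 ^ (lev p.2 * (d + 1)) with hB
  have hg : gradSum (fun z => f (pt z)) P = ∑ p ∈ Finset.univ ×ˢ P, r p := by
    rw [Finset.sum_product]; rfl
  have hAs : ∑ p ∈ Finset.univ ×ˢ P, A p ≤ d * (2 * (CR * 2 ^ (h * d))) := by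
    rw [Finset.sum_product]
    refine (Finset.sum_le_card_nsmul _ _ (2 * (CR * 2 ^ (h * d))) fun k _ => ?_).trans ?_
    · have hd := N.sum_tile_density hJ hH hb
      have h1 : ∑ z ∈ P, A (k, z) ≤
          ∑ z ∈ P with next k z ∈ P, ρ z + ∑ z ∈ P with next k z ∈ P, ρ (next k z) := by
        rw [← Finset.sum_add_distrib, Finset.sum_filter]
      have h2 : ∑ z ∈ P with next k z ∈ P, ρ z ≤ ∑ z ∈ P, ρ z :=
        Finset.sum_le_sum_of_subset_of_nonneg (Finset.filter_subset _ _) fun z _ _ => hρ0 z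
      have h3 : ∑ z ∈ P with next k z ∈ P, ρ (next k z) ≤ ∑ z ∈ P, ρ z := by
        rw [← Finset.sum_image (f := ρ) (g := next k) (fun _ _ _ _ e => next_injective k e)]
        refine Finset.sum_le_sum_of_subset_of_nonneg ?_ fun z _ _ => hρ0 z
        intro z hz
        obtain ⟨u, hu, rfl⟩ := Finset.mem_image.1 hz
        exact (Finset.mem_filter.1 hu).2
      linarith
    · rw [Finset.card_univ, Fintype.card_fin, nsmul_eq_mul]
  have hBs : ∑ p ∈ Finset.univ ×ˢ P, B p ≤ d * (2 * ∑ x ∈ X, Q x) := by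
    rw [Finset.sum_product]
    refine (Finset.sum_le_card_nsmul _ _ (2 * ∑ x ∈ X, Q x) fun k _ =>
      N.sum_pt_le hJ hH hb Q hQ0).trans ?_
    rw [Finset.card_univ, Fintype.card_fin, nsmul_eq_mul]
  have hA0 : ∀ p, 0 ≤ A p := fun p => by
    simp only [hA]
    split_ifs
    · exact add_nonneg (hρ0 _) (hρ0 _)
    · exact le_rfl
  have hB0 : ∀ p, 0 ≤ B p := fun p => div_nonneg (hQ0 _) (by positivity)
  have hcs := Finset.sum_sq_le_sum_mul_sum_of_sq_le_mul (Finset.univ ×ˢ P) (r := r) (f := A)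
    (g := B) (fun p _ => hA0 p) (fun p _ => hB0 p) (by
      rintro ⟨k, z⟩ hp
      have hz : z ∈ P := (Finset.mem_product.1 hp).2
      simp only [r, hA, hB, incr]
      split_ifs with hn
      · have hzH := tile_subset hH hb hz
        have hnH := tile_subset hH hb hn
        have ha := N.adj k z hzH hnH
        set m := max (lev z) (lev (next k z)) with hm
        set u := pt z
        set v := pt (next k z)
        have hR : R m * 2 ^ (m * (d + 1)) ≤ ρ z + ρ (next k z) := by
          have e1 := hρ0 z
          have e2 := hρ0 (next k z)
          rcases max_choice (lev z) (lev (next k z)) with e | e <;> rw [hm, e]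
          · exact le_add_of_nonneg_right e2
          · exact le_add_of_nonneg_left e1
        have hq : c u v * (f u - f v) ^ 2 ≤ Q u := by
          refine Finset.single_le_sum (f := fun y => c u y * (f u - f y) ^ 2)
            (fun y _ => mul_nonneg (N.c_nonneg u y) (sq_nonneg _)) ?_
          exact Finset.mem_filter.2 ⟨Finset.mem_univ _, N.coarse_cl_pt hJ hH hb hn⟩
        have hpow : (2 : ℝ) ^ (lev z * (d + 1)) ≤ 2 ^ (m * (d + 1)) :=
          pow_le_pow_right₀ (by norm_num) (Nat.mul_le_mul_right _ (le_max_left _ _))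
        rw [sq_abs]
        have hp1 : (0 : ℝ) < 2 ^ (lev z * (d + 1)) := by positivity
        calc (f v - f u) ^ 2 ≤ R m * c u v * (f v - f u) ^ 2 :=
              le_mul_of_one_le_left (sq_nonneg _) ha
          _ = R m * (c u v * (f u - f v) ^ 2) := by ring
          _ ≤ R m * Q u := mul_le_mul_of_nonneg_left hq (by have := N.R_nonneg m; linarith)
          _ = R m * 2 ^ (lev z * (d + 1)) * (Q u / 2 ^ (lev z * (d + 1))) := by field_simp
          _ ≤ _ := by
              refine mul_le_mul_of_nonneg_right ?_ (div_nonneg (hQ0 _) hp1.le)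
              refine le_trans ?_ hR
              exact mul_le_mul_of_nonneg_left hpow (by have := N.R_nonneg m; linarith)
      · simp)
  rw [hg]
  refine hcs.trans ?_
  calc _ ≤ (d * (2 * (CR * 2 ^ (h * d)))) * (d * (2 * ∑ x ∈ X, Q x)) :=
        mul_le_mul hAs hBs (Finset.sum_nonneg fun p _ => hB0 p)
          ((Finset.sum_nonneg fun p _ => hA0 p).trans hAs)
    _ = _ := by ring

lemma energy_split_le {h : ℕ} (hH : h ≤ H) (f : ι → ℝ) :
    ∑ b ∈ tile (H - h) (0 : Fin d → ℕ), ∑ x with coarse h (cl x) = b,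
      ∑ y with coarse h (cl y) = b, c x y * (f x - f y) ^ 2 ≤ energy c f := by
  unfold energy
  rw [← N.sum_cells h hH]
  refine Finset.sum_le_sum fun b _ => Finset.sum_le_sum fun x _ => ?_
  exact Finset.sum_le_sum_of_subset_of_nonneg (Finset.filter_subset _ _) fun y _ _ =>
    mul_nonneg (N.c_nonneg x y) (sq_nonneg _)

lemma tile_energy_nonneg (h : ℕ) (b : Fin d → ℕ) (f : ι → ℝ) :
    0 ≤ ∑ x with coarse h (cl x) = b, ∑ y with coarse h (cl y) = b, c x y * (f x - f y) ^ 2 :=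
  Finset.sum_nonneg fun x _ => Finset.sum_nonneg fun y _ =>
    mul_nonneg (N.c_nonneg x y) (sq_nonneg _)

lemma sum_weight_sq_le {h : ℕ} (hJ : J ≤ h) (hH : h ≤ H) (f u : ι → ℝ) {M : ℝ} (hM : 0 ≤ M)
    (hu : ∀ x, u x ^ 2 ≤ M * ∑ x' with coarse h (cl x') = coarse h (cl x),
      ∑ y with coarse h (cl y) = coarse h (cl x), c x' y * (f x' - f y) ^ 2) :
    ∑ x, w x * u x ^ 2 ≤ Cw * 2 ^ (h * d) * M * energy c f := by
  rw [← N.sum_cells h hH]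
  have hCw : ∀ b ∈ tile (H - h) (0 : Fin d → ℕ), 0 ≤ Cw * 2 ^ (h * d) := fun b hb =>
    (Finset.sum_nonneg fun x _ => (N.w_pos x).le).trans (N.weight_le hJ hH hb)
  calc _ ≤ ∑ b ∈ tile (H - h) (0 : Fin d → ℕ), Cw * 2 ^ (h * d) * M *
        ∑ x with coarse h (cl x) = b, ∑ y with coarse h (cl y) = b, c x y * (f x - f y) ^ 2 := by
        refine Finset.sum_le_sum fun b hb => ?_
        have hE := N.tile_energy_nonneg h b f
        set E := ∑ x with coarse h (cl x) = b, ∑ y with coarse h (cl y) = b,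
          c x y * (f x - f y) ^ 2
        calc _ ≤ ∑ x with coarse h (cl x) = b, w x * (M * E) := by
              refine Finset.sum_le_sum fun x hx => ?_
              have := hu x
              rw [(Finset.mem_filter.1 hx).2] at this
              exact mul_le_mul_of_nonneg_left this (N.w_pos x).le
          _ = (∑ x with coarse h (cl x) = b, w x) * (M * E) := by rw [Finset.sum_mul]
          _ ≤ Cw * 2 ^ (h * d) * (M * E) :=
              mul_le_mul_of_nonneg_right (N.weight_le hJ hH hb) (mul_nonneg hM hE)
          _ = _ := by ring
    _ ≤ _ := by
        rw [← Finset.mul_sum]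
        have h0 : (0 : Fin d → ℕ) ∈ tile (H - h) 0 := by
          rw [mem_tile]; funext i; simp [coarse]
        exact mul_le_mul_of_nonneg_left (N.energy_split_le hH f) (mul_nonneg (hCw 0 h0) hM)

/-- Oscillation of `f` around its level-`h` averages. -/
lemma sum_sub_tileAvg_le (hCR : 0 ≤ CR) (hCw : 0 ≤ Cw) (f : ι → ℝ) {h : ℕ} (hJ : J ≤ h)
    (hH : h ≤ H) :
    ∑ x, w x * (f x - tileAvg (fun z => f (pt z)) h (coarse h (cl x))) ^ 2
      ≤ (16 * (d : ℝ) ^ 2 * CR * Cw * 4 ^ d * 4 ^ h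
        + 2 ^ (h - J) * (CR * (2 + 8 * (d : ℝ) ^ 2) * Cw * 2 ^ (2 * J * d))) * energy c f := by
  induction h, hJ using Nat.le_induction with
  | base =>
    have hx : ∀ x, (f x - tileAvg (fun z => f (pt z)) J (coarse J (cl x))) ^ 2
        ≤ CR * (2 + 8 * (d : ℝ) ^ 2) * 2 ^ (J * d) *
          ∑ x' with coarse J (cl x') = coarse J (cl x),
            ∑ y with coarse J (cl y) = coarse J (cl x), c x' y * (f x' - f y) ^ 2 := by
      intro x
      have hb : coarse J (cl x) ∈ tile (H - J) (0 : Fin d → ℕ) := coarse_mem hH (N.cl_mem x)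
      have hz : cl x ∈ tile J (coarse J (cl x)) := mem_tile.2 rfl
      have h1 := N.sq_gradSum_le le_rfl hH hb f
      have h2 := abs_sub_tileAvg_le (fun z => f (pt z)) hz
      have h2' := sq_le_sq' (by have := abs_nonneg (f (pt (cl x)) -
        tileAvg (fun z => f (pt z)) J (coarse J (cl x))); linarith) h2
      rw [sq_abs] at h2'
      set E := ∑ x' with coarse J (cl x') = coarse J (cl x),
            ∑ y with coarse J (cl y) = coarse J (cl x), c x' y * (f x' - f y) ^ 2 with hE
      have hq : c x (pt (cl x)) * (f x - f (pt (cl x))) ^ 2 ≤ E := by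
        have hpm : pt (cl x) ∈ Finset.univ.filter
            (fun y => coarse J (cl y) = coarse J (cl x)) :=
          Finset.mem_filter.2 ⟨Finset.mem_univ _, N.coarse_cl_pt le_rfl hH hb hz⟩
        have hxm : x ∈ Finset.univ.filter
            (fun y => coarse J (cl y) = coarse J (cl x)) :=
          Finset.mem_filter.2 ⟨Finset.mem_univ _, rfl⟩
        have e1 := Finset.single_le_sum (f := fun y => c x y * (f x - f y) ^ 2)
          (fun y _ => mul_nonneg (N.c_nonneg x y) (sq_nonneg _)) hpm
        have e2 := Finset.single_le_sum (f := fun x' => ∑ y with coarse J (cl y) = coarse J (cl x),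
            c x' y * (f x' - f y) ^ 2)
          (fun x' _ => Finset.sum_nonneg fun y _ =>
            mul_nonneg (N.c_nonneg x' y) (sq_nonneg _)) hxm
        exact e1.trans e2
      have hE0 : 0 ≤ E := N.tile_energy_nonneg J _ f
      have hR : R (lev (cl x)) ≤ CR * 2 ^ (J * d) := by
        refine le_trans ?_ (N.density _ hb)
        refine le_trans ?_ (Finset.single_le_sum
          (f := fun z => R (lev z) * 2 ^ (lev z * (d + 1))) (fun z _ => ?_) hz)
        · have := N.R_nonneg (lev (cl x))
          exact le_mul_of_one_le_right (by linarith) (one_le_pow₀ (by norm_num))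
        · have := N.R_nonneg (lev z)
          positivity
      have h3 : (f x - f (pt (cl x))) ^ 2 ≤ CR * 2 ^ (J * d) * E := by
        calc _ ≤ R (lev (cl x)) * c x (pt (cl x)) * (f x - f (pt (cl x))) ^ 2 :=
              le_mul_of_one_le_left (sq_nonneg _) (N.attach x)
          _ = R (lev (cl x)) * (c x (pt (cl x)) * (f x - f (pt (cl x))) ^ 2) := by ring
          _ ≤ R (lev (cl x)) * E :=
              mul_le_mul_of_nonneg_left hq (by have := N.R_nonneg (lev (cl x)); linarith)
          _ ≤ _ := mul_le_mul_of_nonneg_right hR hE0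
      have h4 := add_sq_le (a := f x - f (pt (cl x)))
        (b := f (pt (cl x)) - tileAvg (fun z => f (pt z)) J (coarse J (cl x)))
      rw [sub_add_sub_cancel] at h4
      nlinarith
    refine (N.sum_weight_sq_le le_rfl hH f _ (by positivity) hx).trans (le_of_eq_of_le ?_
      (mul_le_mul_of_nonneg_right (le_add_of_nonneg_left ?_) ?_))
    · rw [Nat.sub_self, mul_assoc 2 J d, two_mul (J * d), pow_add]
      ring
    · positivity
    · unfold energy
      exact Finset.sum_nonneg fun x _ => Finset.sum_nonneg fun y _ =>
        mul_nonneg (N.c_nonneg x y) (sq_nonneg _)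
  | succ h hJh ih =>
    have ih := ih (by omega)
    have hx : ∀ x, (tileAvg (fun z => f (pt z)) h (coarse h (cl x))
          - tileAvg (fun z => f (pt z)) (h + 1) (coarse (h + 1) (cl x))) ^ 2
        ≤ (2 ^ (h + 1) / 2 ^ (h * d)) ^ 2 * (4 * (d : ℝ) ^ 2 * CR * 2 ^ ((h + 1) * d)) *
          ∑ x' with coarse (h + 1) (cl x') = coarse (h + 1) (cl x),
            ∑ y with coarse (h + 1) (cl y) = coarse (h + 1) (cl x),
              c x' y * (f x' - f y) ^ 2 := by
      intro x
      have hb : coarse (h + 1) (cl x) ∈ tile (H - (h + 1)) (0 : Fin d → ℕ) :=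
        coarse_mem hH (N.cl_mem x)
      have hb1 : coarse h (cl x) ∈ tile 1 (coarse (h + 1) (cl x)) := by
        rw [mem_tile, coarse_coarse]
      have h1 := N.sq_gradSum_le (by omega) hH hb f
      have h2 := abs_tileAvg_sub_le (fun z => f (pt z)) h hb1
      have h2' := pow_le_pow_left₀ (abs_nonneg _) h2 2
      rw [sq_abs, mul_pow] at h2'
      refine h2'.trans ?_
      rw [mul_assoc]
      exact mul_le_mul_of_nonneg_left h1 (sq_nonneg _)
    have h3 := N.sum_weight_sq_le (by omega) hH f _ (by positivity) hx
    have h5 : Cw * 2 ^ ((h + 1) * d) *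
        ((2 ^ (h + 1) / 2 ^ (h * d)) ^ 2 * (4 * (d : ℝ) ^ 2 * CR * 2 ^ ((h + 1) * d)))
        = 16 * (d : ℝ) ^ 2 * CR * Cw * 4 ^ d * 4 ^ h := by
      have e1 : (2 : ℝ) ^ ((h + 1) * d) = 2 ^ (h * d) * 2 ^ d := by rw [add_mul, one_mul, pow_add]
      have e2 : (4 : ℝ) ^ d = 2 ^ d * 2 ^ d := by rw [← mul_pow]; norm_num
      have e3 : (4 : ℝ) ^ h = 2 ^ h * 2 ^ h := by rw [← mul_pow]; norm_num
      rw [e1, e2, e3, pow_succ 2 h]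
      field_simp
      ring
    rw [h5] at h3
    have h4 : ∑ x, w x * (f x - tileAvg (fun z => f (pt z)) (h + 1) (coarse (h + 1) (cl x))) ^ 2
        ≤ 2 * ∑ x, w x * (f x - tileAvg (fun z => f (pt z)) h (coarse h (cl x))) ^ 2
          + 2 * ∑ x, w x * (tileAvg (fun z => f (pt z)) h (coarse h (cl x))
          - tileAvg (fun z => f (pt z)) (h + 1) (coarse (h + 1) (cl x))) ^ 2 := by
      rw [Finset.mul_sum, Finset.mul_sum, ← Finset.sum_add_distrib]
      refine Finset.sum_le_sum fun x _ => ?_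
      have h6 := add_sq_le (a := f x - tileAvg (fun z => f (pt z)) h (coarse h (cl x)))
        (b := tileAvg (fun z => f (pt z)) h (coarse h (cl x))
          - tileAvg (fun z => f (pt z)) (h + 1) (coarse (h + 1) (cl x)))
      rw [sub_add_sub_cancel] at h6
      have := mul_le_mul_of_nonneg_left h6 (N.w_pos x).le
      linarith
    have e1 : h + 1 - J = (h - J) + 1 := by omega
    rw [e1, pow_succ (2 : ℝ) (h - J), pow_succ (4 : ℝ) h]
    linarith

lemma le_weight (hc₀ : 0 < c₀) {h : ℕ} (hJ : J ≤ h) (hH : h ≤ H) {b : Fin d → ℕ}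
    (hb : b ∈ tile (H - h) 0) :
    c₀ * 2 ^ (h * d) ≤ 2 * CR * ∑ x with coarse h (cl x) = b, w x := by
  have h1 := Finset.sum_sq_le_sum_mul_sum_of_sq_le_mul (tile h b) (r := fun _ => (1 : ℝ))
    (f := fun z => R (lev z) * 2 ^ (lev z * (d + 1))) (g := fun z => 1 / 2 ^ (lev z * (d + 1)))
    (fun z _ => by have := N.R_nonneg (lev z); positivity) (fun z _ => by positivity)
    (fun z _ => by
      have := N.R_nonneg (lev z)
      field_simp
      linarith)
  have h2 := N.sum_tile_density hJ hH hb
  have h3 := N.sum_pt_le hJ hH hb w fun x => (N.w_pos x).le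
  have h4 : c₀ * ∑ z ∈ tile h b, (1 / 2 ^ (lev z * (d + 1)) : ℝ)
      ≤ ∑ z ∈ tile h b, w (pt z) / 2 ^ (lev z * (d + 1)) := by
    rw [Finset.mul_sum]
    refine Finset.sum_le_sum fun z hz => ?_
    rw [mul_one_div]
    exact div_le_div_of_nonneg_right (N.w_pt z (tile_subset hH hb hz)) (by positivity)
  rw [Finset.sum_const, card_tile, nsmul_eq_mul, mul_one] at h1
  push_cast at h1
  set S := ∑ z ∈ tile h b, (1 / 2 ^ (lev z * (d + 1)) : ℝ) with hS
  have hS0 : 0 ≤ S := Finset.sum_nonneg fun z _ => by positivity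
  have hp : (0 : ℝ) < 2 ^ (h * d) := by positivity
  have h5 : (2 : ℝ) ^ (h * d) ≤ CR * S := by
    have : (2 ^ (h * d) : ℝ) * 2 ^ (h * d) ≤ (CR * S) * 2 ^ (h * d) := by
      calc _ = ((2 : ℝ) ^ (h * d)) ^ 2 := by ring
        _ ≤ _ := h1
        _ ≤ CR * 2 ^ (h * d) * S := mul_le_mul_of_nonneg_right h2 hS0
        _ = _ := by ring
    exact le_of_mul_le_mul_right this hp
  have hCR : 0 ≤ CR := by
    by_contra hneg
    have := mul_nonpos_of_nonpos_of_nonneg (not_le.1 hneg).le hS0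
    linarith
  calc _ ≤ c₀ * (CR * S) := mul_le_mul_of_nonneg_left h5 hc₀.le
    _ = CR * (c₀ * S) := by ring
    _ ≤ CR * (2 * ∑ x with coarse h (cl x) = b, w x) :=
        mul_le_mul_of_nonneg_left (h4.trans h3) hCR
    _ = _ := by ring

lemma sum_sq_le {h : ℕ} (hH : h ≤ H) {f : ι → ℝ} (hf : ∀ x, 0 ≤ f x)
    (hf1 : ∑ x, w x * f x = 1) {m : ℝ} (hm : 0 < m)
    (hmw : ∀ b ∈ tile (H - h) (0 : Fin d → ℕ), m ≤ ∑ x with coarse h (cl x) = b, w x)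
    (a : (Fin d → ℕ) → ℝ) :
    ∑ x, w x * f x ^ 2 ≤ 1 / m + ∑ x, w x * (f x - a (coarse h (cl x))) ^ 2 := by
  have hwf : ∀ x, 0 ≤ w x * f x := fun x => mul_nonneg (N.w_pos x).le (hf x)
  have key : ∀ b ∈ tile (H - h) (0 : Fin d → ℕ), ∑ x with coarse h (cl x) = b, w x * f x ^ 2
      ≤ 1 / m * ∑ x with coarse h (cl x) = b, w x * f x
        + ∑ x with coarse h (cl x) = b, w x * (f x - a (coarse h (cl x))) ^ 2 := by
    intro b hb
    have hW := hmw b hb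
    set X := Finset.univ.filter (fun x => coarse h (cl x) = b)
    set W := ∑ x ∈ X, w x with hWd
    set S := ∑ x ∈ X, w x * f x with hS
    have hS0 : 0 ≤ S := Finset.sum_nonneg fun x _ => hwf x
    have hS1 : S ≤ 1 := by
      rw [← hf1]
      exact Finset.sum_le_sum_of_subset_of_nonneg (Finset.filter_subset _ _) fun x _ _ => hwf x
    have e : ∑ x ∈ X, w x * (f x - a (coarse h (cl x))) ^ 2
        = ∑ x ∈ X, w x * f x ^ 2 - 2 * a b * S + a b ^ 2 * W := by
      rw [hS, hWd, Finset.mul_sum, Finset.mul_sum, ← Finset.sum_sub_distrib,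
        ← Finset.sum_add_distrib]
      refine Finset.sum_congr rfl fun x hx => ?_
      rw [(Finset.mem_filter.1 hx).2]
      ring
    rw [e]
    have hW0 : 0 < W := hm.trans_le hW
    have h1 : 2 * a b * S - a b ^ 2 * W ≤ S ^ 2 / W := by
      rw [le_div_iff₀ hW0]
      nlinarith [sq_nonneg (a b * W - S)]
    have h2 : S ^ 2 / W ≤ 1 / m * S := by
      rw [one_div, inv_mul_eq_div, div_le_div_iff₀ hW0 hm]
      nlinarith [mul_nonneg hS0 hm.le]
    linarith
  rw [← N.sum_cells h hH (fun x => w x * f x ^ 2),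
    ← N.sum_cells h hH (fun x => w x * (f x - a (coarse h (cl x))) ^ 2)]
  refine (Finset.sum_le_sum key).trans (le_of_eq ?_)
  rw [Finset.sum_add_distrib, ← Finset.mul_sum, N.sum_cells h hH (fun x => w x * f x), hf1,
    mul_one]

end

lemma mixing [DecidableEq ι] (N : DyadicNet H J CR Cw c₀ R w c cl pt lev) (hCR : 0 < CR)
    (hCw : 0 < Cw)
    (hc₀ : 0 < c₀) (hc₁ : c₀ ≤ 1) (hd : 1 ≤ d) (hJH : 2 * J * d < H)
    (hΛ : (2 * (H * d) : ℝ) * 4 ^ (2 * J * d) ≤ 4 ^ H) (G : Matrix ι ι ℝ)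
    (hrow : ∀ x, ∑ y, G x y = 0) (hoff : ∀ x y, x ≠ y → w x * G x y = c x y) (x y : ι) :
    |semi G (2 * ((2 + 4 * (2 ^ d * (1 + 2 * CR * Cw / c₀))) *
        (16 * (d : ℝ) ^ 2 * CR * Cw * 4 ^ d + CR * (2 + 8 * (d : ℝ) ^ 2) * Cw) * 4 ^ H)) x y
      - w y / ∑ z, w z| / (w y / ∑ z, w z) ≤ Real.exp (-1) := by
  have hJ1 : J ≤ 2 * J * d := by nlinarith
  have h00 : (0 : Fin d → ℕ) ∈ tile (H - H) 0 := by
    rw [mem_tile]; funext i; simp [coarse]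
  have hall : ∀ x, coarse H (cl x) = 0 := fun x => mem_tile.1 (N.cl_mem x)
  have hWeq : ∑ z with coarse H (cl z) = 0, w z = ∑ z, w z := by
    rw [Finset.filter_true_of_mem fun z _ => hall z]
  have hWle : ∑ z, w z ≤ Cw * 2 ^ (H * d) := by
    rw [← hWeq]; exact N.weight_le (by omega) le_rfl h00
  have hWpos : 0 < ∑ z, w z := Finset.sum_pos (fun z _ => N.w_pos z) ⟨x, Finset.mem_univ x⟩
  have hlow : ∀ {h}, J ≤ h → h ≤ H → ∀ b ∈ tile (H - h) (0 : Fin d → ℕ),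
      c₀ * 2 ^ (h * d) / (2 * CR) ≤ ∑ x with coarse h (cl x) = b, w x := by
    intro h hJh hhH b hb
    rw [div_le_iff₀ (by positivity)]
    have := N.le_weight hc₀ hJh hhH hb
    linarith
  set b : ℕ → ℝ := fun h => if h < H then 1 / (c₀ * 2 ^ (h * d) / (2 * CR)) else 1 / ∑ z, w z
    with hb
  have hcCR : c₀ / 2 ≤ CR * Cw := by
    have h1 := hlow (by omega) le_rfl 0 h00
    rw [hWeq] at h1
    have h2 := h1.trans hWle
    rw [div_le_iff₀ (by positivity)] at h2
    have hp : (0 : ℝ) < 2 ^ (H * d) := by positivity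
    have : c₀ * 2 ^ (H * d) ≤ (2 * (CR * Cw)) * 2 ^ (H * d) := by linarith
    have := le_of_mul_le_mul_right this hp
    linarith
  have hd0 : (0 : ℝ) < d := by exact_mod_cast hd
  refine mixing_of_nash (w := w) (c := c) (G := G) (h₀ := 2 * J * d) (H := H) (b := b)
    (Λ := 2 * (H * d)) N.w_pos N.c_nonneg hrow hoff N.c_symm hJH.le (by positivity) ?_ ?_ ?_ ?_ ?_
    hΛ ?_ x y
  · have : 0 ≤ 2 * CR * Cw / c₀ := by positivity
    have h2 : (1 : ℝ) ≤ 2 ^ d := one_le_pow₀ (by norm_num)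
    nlinarith
  · intro h
    simp only [hb]
    split_ifs
    · positivity
    · positivity
  · intro h _ hlt
    simp only [hb, if_pos hlt]
    have e1 : (2 : ℝ) ^ ((h + 1) * d) = 2 ^ (h * d) * 2 ^ d := by rw [add_mul, one_mul, pow_add]
    split_ifs with h1
    · rw [e1]
      have h2 : 0 ≤ 2 * CR * Cw / c₀ := by positivity
      have h3 : 2 ^ d * (1 + 2 * CR * Cw / c₀) * (1 / (c₀ * (2 ^ (h * d) * 2 ^ d) / (2 * CR)))
        = (1 + 2 * CR * Cw / c₀) * (1 / (c₀ * 2 ^ (h * d) / (2 * CR))) := by field_simp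
      rw [h3]
      exact le_mul_of_one_le_left (by positivity) (by linarith)
    · have hh : h + 1 = H := by omega
      rw [mul_one_div, div_le_div_iff₀ (by positivity) hWpos, one_mul]
      rw [← hh, e1] at hWle
      have : 2 ^ d * (1 + 2 * CR * Cw / c₀) * (c₀ * 2 ^ (h * d) / (2 * CR))
        = 2 ^ d * 2 ^ (h * d) * c₀ / (2 * CR) + Cw * (2 ^ (h * d) * 2 ^ d) := by
        field_simp
      rw [this]
      have : 0 ≤ 2 ^ d * 2 ^ (h * d) * c₀ / (2 * CR) := by positivity
      linarith
  · simp [hb]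
  · intro h hh₀ hhH f hf hf1
    have hJh : J ≤ h := hJ1.trans hh₀
    have h1 := N.sum_sub_tileAvg_le hCR.le hCw.le f hJh hhH
    have hE : 0 ≤ energy c f := Finset.sum_nonneg fun x _ => Finset.sum_nonneg fun y _ =>
        mul_nonneg (N.c_nonneg x y) (sq_nonneg _)
    have h2 : (16 * (d : ℝ) ^ 2 * CR * Cw * 4 ^ d * 4 ^ h
        + 2 ^ (h - J) * (CR * (2 + 8 * (d : ℝ) ^ 2) * Cw * 2 ^ (2 * J * d)))
        ≤ (16 * (d : ℝ) ^ 2 * CR * Cw * 4 ^ d + CR * (2 + 8 * (d : ℝ) ^ 2) * Cw) * 4 ^ h := by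
      have e3 : (2 : ℝ) ^ (h - J) * 2 ^ (2 * J * d) ≤ 4 ^ h := by
        have : (4 : ℝ) ^ h = 2 ^ h * 2 ^ h := by rw [← mul_pow]; norm_num
        rw [this]
        exact mul_le_mul (pow_le_pow_right₀ (by norm_num) (Nat.sub_le _ _))
          (pow_le_pow_right₀ (by norm_num) hh₀) (by positivity) (by positivity)
      have := mul_le_mul_of_nonneg_left e3
        (by positivity : (0 : ℝ) ≤ CR * (2 + 8 * (d : ℝ) ^ 2) * Cw)
      nlinarith
    have h3 := mul_le_mul_of_nonneg_right h2 hE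
    simp only [hb]
    split_ifs with hlt
    · have := N.sum_sq_le hhH hf hf1 (by positivity) (hlow hJh hhH)
        (tileAvg (fun z => f (pt z)) h)
      linarith
    · obtain rfl : h = H := by omega
      have := N.sum_sq_le le_rfl hf hf1 hWpos (fun b' hb' => by
        have : b' = 0 := by
          rw [Nat.sub_self, mem_tile] at hb'
          rw [← hb']; funext i; simp [coarse]
        rw [this, hWeq]) (tileAvg (fun z => f (pt z)) h)
      linarith
  · intro z
    simp only [hb, if_pos hJH]
    have hz : cl z ∈ tile J (coarse J (cl z)) := mem_tile.2 rfl
    have hR : R (lev (cl z)) ≤ CR * 2 ^ (J * d) := by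
      refine le_trans ?_ (N.density _ (coarse_mem (by omega) (N.cl_mem z)))
      refine le_trans ?_ (Finset.single_le_sum
        (f := fun z => R (lev z) * 2 ^ (lev z * (d + 1))) (fun z _ => ?_) hz)
      · have := N.R_nonneg (lev (cl z))
        exact le_mul_of_one_le_right (by linarith) (one_le_pow₀ (by norm_num))
      · have := N.R_nonneg (lev z)
        positivity
    have h1 : 1 / w z ≤ CR * 2 ^ (J * d) := by
      rw [div_le_iff₀ (N.w_pos z)]
      exact (N.w_lower z).trans (mul_le_mul_of_nonneg_right hR (N.w_pos z).le)
    refine h1.trans ?_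
    have h2 : (2 : ℝ) ^ (J * d) * 2 ^ (2 * J * d * d) ≤ Real.exp (2 * (H * d)) := by
      have e1 : (2 : ℝ) ^ (J * d) * 2 ^ (2 * J * d * d) ≤ 2 ^ (H * d + H * d) := by
        rw [← pow_add]
        refine pow_le_pow_right₀ (by norm_num) (add_le_add ?_ ?_)
        · exact Nat.mul_le_mul_right _ (by omega)
        · exact Nat.mul_le_mul_right _ (by omega)
      refine e1.trans ?_
      have e2 : (2 : ℝ) ≤ Real.exp 1 := by
        have := Real.add_one_le_exp (1 : ℝ); linarith
      calc (2 : ℝ) ^ (H * d + H * d) ≤ Real.exp 1 ^ (H * d + H * d) :=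
            pow_le_pow_left₀ (by norm_num) e2 _
        _ = _ := by rw [← Real.exp_nat_mul]; push_cast; ring_nf
    have e3 : 1 / (c₀ * 2 ^ (2 * J * d * d) / (2 * CR)) * Real.exp (2 * (H * d))
      = 2 * CR * Real.exp (2 * (H * d)) / (c₀ * 2 ^ (2 * J * d * d)) := by field_simp
    rw [e3, le_div_iff₀ (by positivity)]
    have hp : (0 : ℝ) < 2 ^ (J * d) * 2 ^ (2 * J * d * d) := by positivity
    calc CR * 2 ^ (J * d) * (c₀ * 2 ^ (2 * J * d * d))
        = CR * (c₀ * (2 ^ (J * d) * 2 ^ (2 * J * d * d))) := by ring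
      _ ≤ CR * (1 * Real.exp (2 * (H * d))) :=
          mul_le_mul_of_nonneg_left (mul_le_mul hc₁ h2 hp.le (by norm_num)) hCR.le
      _ ≤ 2 * CR * Real.exp (2 * (H * d)) := by
          have := mul_pos hCR (Real.exp_pos (2 * ((H : ℝ) * d)))
          linarith

end DyadicNet

end Net

section Sparse

variable {d : ℕ}

/-- All cells of the tile of side `2 ^ j` with index `b` are bad. -/
def AllBad (bad : (Fin d → ℕ) → Prop) (j : ℕ) (b : Fin d → ℕ) : Prop := ∀ z ∈ tile j b, bad z

open Classical in
/-- In every tile of side `2 ^ J`, entirely bad subtiles of side `2 ^ j` are rare. -/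
def SparseBad (bad : (Fin d → ℕ) → Prop) (m : ℕ → ℝ) (H J j₀ : ℕ) : Prop :=
  ∀ c ∈ tile (H - J) (0 : Fin d → ℕ), ∀ j ∈ Finset.Icc j₀ J,
    (((tile (J - j) c).filter fun b => AllBad bad j b).card : ℝ) * (2 ^ (j * d) * m j)
      ≤ 2 ^ (J * d)

lemma SparseBad.mono {bad bad' : (Fin d → ℕ) → Prop} {m : ℕ → ℝ} {H J j₀ : ℕ}
    (hm : ∀ j, 0 ≤ m j) (h : ∀ z, bad' z → bad z) (hs : SparseBad bad m H J j₀) :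
    SparseBad bad' m H J j₀ := by
  classical
  intro c hc j hj
  refine le_trans ?_ (hs c hc j hj)
  refine mul_le_mul_of_nonneg_right ?_ (mul_nonneg (by positivity) (hm j))
  refine Nat.cast_le.2 (Finset.card_le_card fun b hb => ?_)
  rw [Finset.mem_filter] at hb ⊢
  exact ⟨hb.1, fun z hz => h z (hb.2 z hz)⟩

lemma measurableSet_sparseBad {Ω : Type*} [MeasurableSpace Ω] {bad : Ω → (Fin d → ℕ) → Prop}
    (hbad : ∀ z, MeasurableSet {ω | bad ω z}) (m : ℕ → ℝ) (H J j₀ : ℕ) :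
    MeasurableSet {ω | SparseBad (bad ω) m H J j₀} := by
  classical
  have h : ∀ j b, MeasurableSet {ω | AllBad (bad ω) j b} := by
    intro j b
    simp only [AllBad, Set.ofPred_forall]
    exact Finset.measurableSet_biInter _ fun z _ => hbad z
  simp only [SparseBad, Set.ofPred_forall]
  refine Finset.measurableSet_biInter _ fun c _ => Finset.measurableSet_biInter _ fun j _ => ?_
  refine measurableSet_le (Measurable.mul_const ?_ _) measurable_const
  simp only [Finset.card_filter, Nat.cast_sum]
  refine Finset.measurable_sum _ fun b _ => ?_
  simp only [Nat.cast_ite, Nat.cast_one, Nat.cast_zero]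
  exact Measurable.ite (h j b) measurable_const measurable_const

/-- The smallest scale at which the tile around `z` contains a good cell. -/
def goodLevel (bad : (Fin d → ℕ) → Prop) (z : Fin d → ℕ) : ℕ :=
  sInf {j | ¬ AllBad bad j (coarse j z)}

lemma SparseBad.not_allBad {bad : (Fin d → ℕ) → Prop} {m : ℕ → ℝ} {H J j₀ : ℕ}
    (hm : 1 < m J) (hj : j₀ ≤ J) (hJ : J ≤ H) (hs : SparseBad bad m H J j₀) {z : Fin d → ℕ}
    (hz : z ∈ tile H 0) : ¬ AllBad bad J (coarse J z) := by
  classical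
  intro hbad
  have h := hs (coarse J z) (DyadicNet.coarse_mem hJ hz) J (Finset.mem_Icc.2 ⟨hj, le_rfl⟩)
  have hc : 1 ≤ ((tile (J - J) (coarse J z)).filter fun b => AllBad bad J b).card := by
    refine Finset.card_pos.2 ⟨coarse J z, Finset.mem_filter.2 ⟨?_, hbad⟩⟩
    rw [mem_tile, Nat.sub_self]
    funext i
    simp [coarse]
  have hc' : (1 : ℝ) ≤ ((tile (J - J) (coarse J z)).filter fun b => AllBad bad J b).card := by
    exact_mod_cast hc
  have hp : (0 : ℝ) < 2 ^ (J * d) := by positivity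
  have h1 : (2 : ℝ) ^ (J * d) < 2 ^ (J * d) * m J := lt_mul_of_one_lt_right hp hm
  exact absurd (h.trans_lt h1) (not_lt.2 (le_mul_of_one_le_left (hp.trans h1).le hc'))

lemma not_allBad_goodLevel {bad : (Fin d → ℕ) → Prop} {J : ℕ} {z : Fin d → ℕ}
    (h : ¬ AllBad bad J (coarse J z)) :
    ¬ AllBad bad (goodLevel bad z) (coarse (goodLevel bad z) z) :=
  Nat.sInf_mem (s := {j | ¬ AllBad bad j (coarse j z)}) ⟨J, h⟩

lemma goodLevel_le {bad : (Fin d → ℕ) → Prop} {J : ℕ} {z : Fin d → ℕ}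
    (h : ¬ AllBad bad J (coarse J z)) : goodLevel bad z ≤ J :=
  Nat.sInf_le (s := {j | ¬ AllBad bad j (coarse j z)}) h

lemma allBad_of_lt_goodLevel {bad : (Fin d → ℕ) → Prop} {j : ℕ} {z : Fin d → ℕ}
    (h : j < goodLevel bad z) : AllBad bad j (coarse j z) := by
  by_contra hn
  exact absurd (goodLevel_le hn) (by omega)

lemma SparseBad.sum_goodLevel_le {bad : (Fin d → ℕ) → Prop} {ρ : ℕ → ℝ} {H J j₀ : ℕ}
    (hρ : ∀ j, 1 ≤ ρ j) (hρm : Monotone ρ) (hj : j₀ ≤ J) (hJ : J ≤ H) (hJ1 : 1 ≤ J)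
    (hs : SparseBad bad (fun j => 2 ^ j * ρ (j + 1)) H J j₀)
    {c : Fin d → ℕ} (hc : c ∈ tile (H - J) 0) :
    ∑ z ∈ tile J c, ρ (goodLevel bad z) ≤ (ρ j₀ + 2) * 2 ^ (J * d) := by
  classical
  have hm : (1 : ℝ) < 2 ^ J * ρ (J + 1) := by
    have h1 : (1 : ℝ) < 2 ^ J := one_lt_pow₀ (by norm_num) (by omega)
    have := hρ (J + 1)
    nlinarith
  have hlev : ∀ z ∈ tile J c, goodLevel bad z ≤ J := fun z hz =>
    goodLevel_le (hs.not_allBad hm hj hJ (DyadicNet.tile_subset hJ hc hz))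
  have hpt : ∀ z ∈ tile J c, ρ (goodLevel bad z) ≤ ρ j₀ + ∑ j ∈ Finset.Ico j₀ J,
      if AllBad bad j (coarse j z) then ρ (j + 1) else 0 := by
    intro z hz
    have hnn : ∀ j ∈ Finset.Ico j₀ J,
        0 ≤ if AllBad bad j (coarse j z) then ρ (j + 1) else (0 : ℝ) := fun j _ => by
      have := hρ (j + 1)
      split_ifs <;> linarith
    rcases le_or_gt (goodLevel bad z) j₀ with h | h
    · exact (hρm h).trans (le_add_of_nonneg_right (Finset.sum_nonneg hnn))
    · obtain ⟨j, hjl⟩ : ∃ j, goodLevel bad z = j + 1 := ⟨goodLevel bad z - 1, by omega⟩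
      have hjm : j ∈ Finset.Ico j₀ J := by
        have := hlev z hz
        rw [Finset.mem_Ico]; omega
      have := Finset.single_le_sum hnn hjm
      rw [if_pos (allBad_of_lt_goodLevel (by omega))] at this
      rw [hjl]
      have := hρ j₀
      linarith
  refine (Finset.sum_le_sum hpt).trans ?_
  rw [Finset.sum_add_distrib, Finset.sum_const, card_tile, nsmul_eq_mul, Finset.sum_comm]
  have hj' : ∀ j ∈ Finset.Ico j₀ J,
      ∑ z ∈ tile J c, (if AllBad bad j (coarse j z) then ρ (j + 1) else 0)
        ≤ (1 / 2) ^ j * 2 ^ (J * d) := by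
    intro j hjm
    rw [Finset.mem_Ico] at hjm
    have h1 := hs c hc j (Finset.mem_Icc.2 ⟨hjm.1, hjm.2.le⟩)
    rw [← sum_tile_split hjm.2.le]
    have h2 : ∀ b ∈ tile (J - j) c,
        ∑ z ∈ tile j b, (if AllBad bad j (coarse j z) then ρ (j + 1) else 0)
          = if AllBad bad j b then 2 ^ (j * d) * ρ (j + 1) else 0 := by
      intro b _
      have : ∀ z ∈ tile j b, (if AllBad bad j (coarse j z) then ρ (j + 1) else 0)
          = if AllBad bad j b then ρ (j + 1) else 0 := fun z hz => by rw [mem_tile.1 hz]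
      rw [Finset.sum_congr rfl this, Finset.sum_const, card_tile, nsmul_eq_mul]
      push_cast
      split_ifs <;> simp
    rw [Finset.sum_congr rfl h2, ← Finset.sum_filter, Finset.sum_const, nsmul_eq_mul,
      one_div_pow, one_div_mul_eq_div, le_div_iff₀ (by positivity)]
    linarith
  have h3 : ∑ j ∈ Finset.Ico j₀ J, (1 / 2 : ℝ) ^ j * 2 ^ (J * d) ≤ 2 * 2 ^ (J * d) := by
    rw [← Finset.sum_mul]
    refine mul_le_mul_of_nonneg_right ?_ (by positivity)
    refine le_trans (Finset.sum_le_sum_of_subset_of_nonneg (t := Finset.range J) ?_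
      fun _ _ _ => by positivity) (sum_geometric_two_le J)
    intro j hj
    rw [Finset.mem_Ico] at hj
    exact Finset.mem_range.2 hj.2
  have := (Finset.sum_le_sum hj').trans h3
  push_cast
  linarith

lemma choose_mul_le {N n s : ℕ} (hn : 0 < n) {m δ : ℝ} (hm : (N : ℝ) ≤ n * m)
    (hδ : δ ≤ 1 / 3) (hme : Real.exp 1 * m ≤ Real.exp (δ * s)) :
    (N.choose n : ℝ) * (1 / 4) ^ (n * s) ≤ Real.exp (-(n * s)) := by
  have hn0 : (0 : ℝ) < n := by exact_mod_cast hn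
  have hm0 : 0 ≤ m := by
    have : (0 : ℝ) ≤ n * m := le_trans (Nat.cast_nonneg _) hm
    by_contra hneg
    nlinarith
  have h1 : (N.choose n : ℝ) ≤ Real.exp (δ * s) ^ n := by
    calc (N.choose n : ℝ) ≤ (N : ℝ) ^ n / (n.factorial : ℝ) := Nat.choose_le_pow_div n N
      _ ≤ (n * m) ^ n / (n.factorial : ℝ) := by gcongr
      _ = m ^ n * ((n : ℝ) ^ n / (n.factorial : ℝ)) := by rw [mul_pow]; ring
      _ ≤ m ^ n * Real.exp n := by
          gcongr
          exact Real.pow_div_factorial_le_exp (n : ℝ) hn0.le n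
      _ = (Real.exp 1 * m) ^ n := by
          rw [mul_pow, ← Real.exp_nat_mul, mul_one, mul_comm]
      _ ≤ _ := pow_le_pow_left₀ (by positivity) hme n
  have h2 : (1 / 4 : ℝ) ≤ Real.exp (-(4 / 3)) := by
    have h3 : (1 / 4 : ℝ) = Real.exp (-(2 * Real.log 2)) := by
      rw [Real.exp_neg, two_mul, Real.exp_add, Real.exp_log (by norm_num)]; norm_num
    rw [h3]
    refine Real.exp_le_exp.2 ?_
    have := Real.log_two_gt_d9
    linarith
  calc _ ≤ Real.exp (δ * s) ^ n * Real.exp (-(4 / 3)) ^ (n * s) := by gcongr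
    _ = Real.exp (n * s * (δ - 4 / 3)) := by
        rw [← Real.exp_nat_mul, ← Real.exp_nat_mul, ← Real.exp_add]
        push_cast
        ring_nf
    _ ≤ _ := by
        refine Real.exp_le_exp.2 ?_
        have : (0 : ℝ) ≤ n * s := by positivity
        nlinarith

variable {Ω : Type*} [MeasurableSpace Ω]

open Classical in
lemma measure_many_bad_le (ν : Measure Ω) {bad : Ω → (Fin d → ℕ) → Prop}
    (hbad : ∀ S : Finset (Fin d → ℕ),
      ν {ω | ∀ z ∈ S, bad ω z} ≤ ENNReal.ofReal ((1 / 4) ^ S.card))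
    {m δ X : ℝ} {j J : ℕ} (hj : j ≤ J) (hm : 0 < m) (hδ0 : 0 ≤ δ) (hδ : δ ≤ 1 / 3)
    (hme : Real.exp 1 * m ≤ Real.exp (δ * 2 ^ (j * d)))
    (hX : X ≤ 2 ^ (J * d) * Real.exp (-(δ * X))) (c : Fin d → ℕ) :
    ν {ω | ¬ ((((tile (J - j) c).filter fun b => AllBad (bad ω) j b).card : ℝ)
      * (2 ^ (j * d) * m) ≤ 2 ^ (J * d))} ≤ ENNReal.ofReal (Real.exp (-X)) := by
  set s : ℕ := 2 ^ (j * d) with hs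
  set n : ℕ := ⌊(2 ^ (J * d) / (2 ^ (j * d) * m) : ℝ)⌋₊ + 1 with hn
  have hsr : (s : ℝ) = 2 ^ (j * d) := by rw [hs]; push_cast; rfl
  have hs0 : (0 : ℝ) < 2 ^ (j * d) := by positivity
  have hnlt : (2 ^ (J * d) / (2 ^ (j * d) * m) : ℝ) < n := by
    rw [hn]; push_cast; exact Nat.lt_floor_add_one _
  rw [div_lt_iff₀ (by positivity)] at hnlt
  have hsub : {ω | ¬ ((((tile (J - j) c).filter fun b => AllBad (bad ω) j b).card : ℝ)
      * (2 ^ (j * d) * m) ≤ 2 ^ (J * d))} ⊆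
      ⋃ T ∈ (tile (J - j) c).powersetCard n, {ω | ∀ z ∈ T.biUnion (tile j), bad ω z} := by
    intro ω hω
    have hω : (2 : ℝ) ^ (J * d) < (((tile (J - j) c).filter fun b => AllBad (bad ω) j b).card : ℝ)
      * (2 ^ (j * d) * m) := not_le.1 hω
    rw [← div_lt_iff₀ (by positivity)] at hω
    have hcard : n ≤ ((tile (J - j) c).filter fun b => AllBad (bad ω) j b).card := by
      have := (Nat.floor_lt (by positivity)).2 hω
      omega
    obtain ⟨T, hT, hTc⟩ := Finset.exists_subset_card_eq hcard
    simp only [Set.mem_iUnion]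
    refine ⟨T, Finset.mem_powersetCard.2 ⟨hT.trans (Finset.filter_subset _ _), hTc⟩, ?_⟩
    intro z hz
    obtain ⟨b, hb, hzb⟩ := Finset.mem_biUnion.1 hz
    exact (Finset.mem_filter.1 (hT hb)).2 z hzb
  have hcardU : ∀ T : Finset (Fin d → ℕ), (T.biUnion (tile j)).card = T.card * s := by
    intro T
    rw [Finset.card_biUnion]
    · simp [card_tile, hs]
    · intro b _ b' _ hne
      rw [Function.onFun, Finset.disjoint_left]
      intro z hz hz'
      exact hne ((mem_tile.1 hz).symm.trans (mem_tile.1 hz'))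
  have hN : ((2 ^ ((J - j) * d) : ℕ) : ℝ) ≤ n * m := by
    have e : (2 : ℝ) ^ (J * d) = 2 ^ ((J - j) * d) * 2 ^ (j * d) := by
      rw [← pow_add, ← add_mul, Nat.sub_add_cancel hj]
    rw [e] at hnlt
    push_cast
    have : (2 : ℝ) ^ ((J - j) * d) * 2 ^ (j * d) ≤ (n * m) * 2 ^ (j * d) := by linarith
    exact le_of_mul_le_mul_right this hs0
  have hn1 : 0 < n := by rw [hn]; omega
  have hns : X ≤ n * s := by
    rw [hsr]
    have hn1' : (1 : ℝ) ≤ n := by exact_mod_cast hn1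
    rcases le_or_gt X (2 ^ (j * d)) with h | h
    · nlinarith
    · refine hX.trans ?_
      have h1 : Real.exp (-(δ * X)) ≤ Real.exp (-(δ * 2 ^ (j * d))) := by
        refine Real.exp_le_exp.2 ?_
        nlinarith
      have h2 : Real.exp (-(δ * 2 ^ (j * d))) * m ≤ 1 := by
        rw [Real.exp_neg, inv_mul_le_one₀ (Real.exp_pos _)]
        refine le_trans ?_ hme
        exact le_mul_of_one_le_left hm.le (Real.one_le_exp (by norm_num))
      have h3 : Real.exp (-(δ * X)) * m ≤ 1 :=
        (mul_le_mul_of_nonneg_right h1 hm.le).trans h2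
      have h4 : (2 : ℝ) ^ (J * d) * Real.exp (-(δ * X))
          ≤ n * (2 ^ (j * d) * m) * Real.exp (-(δ * X)) :=
        mul_le_mul_of_nonneg_right hnlt.le (Real.exp_pos _).le
      refine h4.trans ?_
      calc _ = n * 2 ^ (j * d) * (Real.exp (-(δ * X)) * m) := by ring
        _ ≤ n * 2 ^ (j * d) * 1 := mul_le_mul_of_nonneg_left h3 (by positivity)
        _ = _ := mul_one _
  calc _ ≤ ∑ T ∈ (tile (J - j) c).powersetCard n, ν {ω | ∀ z ∈ T.biUnion (tile j), bad ω z} :=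
        (measure_mono hsub).trans (measure_biUnion_finset_le _ _)
    _ ≤ ∑ T ∈ (tile (J - j) c).powersetCard n, ENNReal.ofReal ((1 / 4) ^ (n * s)) := by
        refine Finset.sum_le_sum fun T hT => ?_
        refine (hbad _).trans (le_of_eq ?_)
        rw [hcardU, (Finset.mem_powersetCard.1 hT).2]
    _ = ENNReal.ofReal (((2 ^ ((J - j) * d)).choose n : ℕ) * (1 / 4) ^ (n * s)) := by
        rw [Finset.sum_const, Finset.card_powersetCard, card_tile, nsmul_eq_mul,
          ENNReal.ofReal_mul (Nat.cast_nonneg _), ENNReal.ofReal_natCast]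
    _ ≤ _ := by
        refine ENNReal.ofReal_le_ofReal ?_
        refine (choose_mul_le hn1 hN hδ (by rw [hsr]; exact hme)).trans ?_
        exact Real.exp_le_exp.2 (neg_le_neg hns)

lemma measure_not_sparseBad_le (ν : Measure Ω) {bad : Ω → (Fin d → ℕ) → Prop}
    (hbad : ∀ S : Finset (Fin d → ℕ),
      ν {ω | ∀ z ∈ S, bad ω z} ≤ ENNReal.ofReal ((1 / 4) ^ S.card))
    {m : ℕ → ℝ} {H J j₀ : ℕ} (hm : ∀ j, 0 < m j) (hd : 1 ≤ d)
    (hme : ∀ j, j₀ ≤ j → Real.exp 1 * m j ≤ Real.exp (1 / (32 * (d + 2)) * 2 ^ (j * d)))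
    (hJ : J ≤ H) (hH : H ≤ 8 * d * J)
    (hX : (8 * d * (d + 2) * J : ℝ) ≤ 2 ^ (J * d) * Real.exp (-(J * d / 4))) :
    ν {ω | ¬ SparseBad (bad ω) m H J j₀} ≤ ENNReal.ofReal ((1 / 4) ^ H) := by
  classical
  set X : ℝ := 8 * d * (d + 2) * J with hXd
  have hd2 : (0 : ℝ) < d + 2 := by positivity
  have hδ : (1 / (32 * ((d : ℝ) + 2))) ≤ 1 / 3 := by
    apply one_div_le_one_div_of_le <;> nlinarith [(Nat.cast_nonneg d : (0 : ℝ) ≤ d)]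
  have hX' : X ≤ 2 ^ (J * d) * Real.exp (-(1 / (32 * ((d : ℝ) + 2)) * X)) := by
    have : 1 / (32 * ((d : ℝ) + 2)) * X = J * d / 4 := by
      rw [hXd]; field_simp; ring
    rw [this]; exact hX
  have hsub : {ω | ¬ SparseBad (bad ω) m H J j₀} ⊆
      ⋃ c ∈ tile (H - J) (0 : Fin d → ℕ), ⋃ j ∈ Finset.Icc j₀ J,
        {ω | ¬ ((((tile (J - j) c).filter fun b => AllBad (bad ω) j b).card : ℝ)
          * (2 ^ (j * d) * m j) ≤ 2 ^ (J * d))} := by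
    intro ω hω
    simp only [Set.mem_ofPred_eq, SparseBad, not_forall] at hω
    obtain ⟨c, hc, j, hj, h⟩ := hω
    simp only [Set.mem_iUnion]
    exact ⟨c, hc, j, hj, h⟩
  have hbound : ∀ c ∈ tile (H - J) (0 : Fin d → ℕ),
      ν (⋃ j ∈ Finset.Icc j₀ J,
        {ω | ¬ ((((tile (J - j) c).filter fun b => AllBad (bad ω) j b).card : ℝ)
          * (2 ^ (j * d) * m j) ≤ 2 ^ (J * d))})
      ≤ (2 ^ J : ℕ) • ENNReal.ofReal (Real.exp (-X)) := by
    intro c _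
    refine (measure_biUnion_finset_le _ _).trans ?_
    refine (Finset.sum_le_card_nsmul _ _ (ENNReal.ofReal (Real.exp (-X))) fun j hj => ?_).trans ?_
    · rw [Finset.mem_Icc] at hj
      exact measure_many_bad_le ν hbad hj.2 (hm j) (by positivity) hδ (hme j hj.1) hX' c
    · refine nsmul_le_nsmul_left zero_le ?_
      rw [Nat.card_Icc]
      have : J < 2 ^ J := Nat.lt_two_pow_self
      omega
  calc _ ≤ _ := (measure_mono hsub).trans (measure_biUnion_finset_le _ _)
    _ ≤ _ := Finset.sum_le_card_nsmul _ _ _ hbound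
    _ = ENNReal.ofReal (2 ^ ((H - J) * d) * (2 ^ J * Real.exp (-X))) := by
        rw [card_tile, nsmul_eq_mul, nsmul_eq_mul, ENNReal.ofReal_mul (by positivity),
          ENNReal.ofReal_mul (by positivity)]
        norm_num [ENNReal.ofReal_pow]
    _ ≤ _ := by
        refine ENNReal.ofReal_le_ofReal ?_
        have h1 : (2 : ℝ) ^ ((H - J) * d) * 2 ^ J ≤ 2 ^ (H * d) := by
          rw [← pow_add]
          refine pow_le_pow_right₀ (by norm_num) ?_
          obtain ⟨k, rfl⟩ := Nat.exists_eq_add_of_le hJ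
          rw [Nat.add_sub_cancel_left]
          nlinarith
        have h2 : Real.exp (-X) ≤ (1 / 2) ^ (H * d + 2 * H) := by
          have e1 : Real.exp (-1) ≤ 1 / 2 := by
            have := Real.exp_neg_one_lt_d9
            linarith
          calc Real.exp (-X) ≤ Real.exp (-1) ^ (H * d + 2 * H) := by
                rw [← Real.exp_nat_mul]
                refine Real.exp_le_exp.2 ?_
                push_cast
                have : (H : ℝ) ≤ 8 * d * J := by exact_mod_cast hH
                nlinarith
            _ ≤ _ := pow_le_pow_left₀ (Real.exp_pos _).le e1 _
        calc _ = (2 : ℝ) ^ ((H - J) * d) * 2 ^ J * Real.exp (-X) := by ring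
          _ ≤ 2 ^ (H * d) * (1 / 2) ^ (H * d + 2 * H) := by gcongr
          _ = (1 / 4) ^ H := by
              rw [pow_add, ← mul_assoc, ← mul_pow, pow_mul (1 / 2 : ℝ) 2 H]
              norm_num

end Sparse

section Percolation

lemma bernoulli_bad_le {d : ℕ} {ν : Measure ((Fin d → ℤ) → Bool)}
    (hν : IsBernoulliField d (7 / 8) ν) {κ κ' : (Fin d → ℕ) → Fin d → ℤ}
    (hκ : ∀ z z', z ≠ z' → κ z ≠ κ z' ∧ κ' z ≠ κ' z' ∧ κ z ≠ κ' z') (S : Finset (Fin d → ℕ)) :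
    ν {ω | ∀ z ∈ S, ω (κ z) = false ∨ ω (κ' z) = false}
      ≤ ENNReal.ofReal ((1 / 4) ^ S.card) := by
  classical
  have hsub : {ω : (Fin d → ℤ) → Bool | ∀ z ∈ S, ω (κ z) = false ∨ ω (κ' z) = false} ⊆
      ⋃ U ∈ S.powerset, {ω | ∀ x ∈ S.image (fun z => if z ∈ U then κ z else κ' z),
        ω x = (fun _ => false : (Fin d → ℤ) → Bool) x} := by
    intro ω hω
    simp only [Set.mem_iUnion]
    refine ⟨S.filter fun z => ω (κ z) = false, Finset.mem_powerset.2 (Finset.filter_subset _ _),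
      fun x hx => ?_⟩
    obtain ⟨z, hz, rfl⟩ := Finset.mem_image.1 hx
    by_cases h : ω (κ z) = false
    · simp [hz, h]
    · simpa [hz, h] using (hω z hz).resolve_left h
  refine ((measure_mono hsub).trans (measure_biUnion_finset_le _ _)).trans ?_
  have hU : ∀ U ∈ S.powerset, ν {ω | ∀ x ∈ S.image (fun z => if z ∈ U then κ z else κ' z),
      ω x = (fun _ => false : (Fin d → ℤ) → Bool) x} = ENNReal.ofReal ((1 / 8) ^ S.card) := by
    intro U _
    rw [hν.2, Finset.prod_const, Finset.card_image_of_injOn, ENNReal.ofReal_pow (by norm_num)]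
    · norm_num
    · intro z _ z' _ h
      by_contra hne
      obtain ⟨h1, h2, h3⟩ := hκ z z' hne
      obtain ⟨-, -, h4⟩ := hκ z' z (Ne.symm hne)
      simp only at h
      split_ifs at h
      · exact h1 h
      · exact h3 h
      · exact h4 h.symm
      · exact h2 h
  rw [Finset.sum_congr rfl hU, Finset.sum_const, Finset.card_powerset, nsmul_eq_mul]
  apply le_of_eq
  rw [← ENNReal.ofReal_natCast, ← ENNReal.ofReal_mul (Nat.cast_nonneg _)]
  push_cast
  rw [← mul_pow]
  norm_num

/-- Number of dyadic scales in a box of side `L`, for a percolation scale `K`. -/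
def topScale (K : ℝ) (L : ℕ) : ℕ := Nat.log 2 ⌊(L : ℝ) / (4 * K)⌋₊

/-- The scale below which the graph may be irregular. -/
def microScale (d : ℕ) (K : ℝ) (L : ℕ) : ℕ := topScale K L / (4 * d)

/-- Side of the finest cells. -/
def cellSide (K : ℝ) (L : ℕ) : ℝ := L / 2 ^ topScale K L

/-- Lower corner of a cell. -/
def cellCorner {d : ℕ} (K : ℝ) (L : ℕ) (z : Fin d → ℕ) (i : Fin d) : ℝ :=
  -((L : ℝ) / 2) + cellSide K L * z i

/-- Index of the first percolation cube in a cell. -/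
def cubeIdx {d : ℕ} (K : ℝ) (L : ℕ) (z : Fin d → ℕ) (i : Fin d) : ℤ := ⌈cellCorner K L z i / K⌉

/-- A cell is bad if one of two designated percolation cubes in it has no point. -/
def BadCell {d : ℕ} (K : ℝ) (L : ℕ) (ξ : Config d) (z : Fin d → ℕ) : Prop :=
  (ξ ∩ Kcube d K (cubeIdx K L z)).ncard = 0 ∨ (ξ ∩ Kcube d K (cubeIdx K L z + 1)).ncard = 0

lemma pow_topScale_le {K : ℝ} (hK : 0 < K) {L : ℕ} (hL : 4 * K ≤ L) :
    (2 : ℝ) ^ topScale K L * (4 * K) ≤ L := by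
  have h1 : ⌊(L : ℝ) / (4 * K)⌋₊ ≠ 0 := by
    rw [← Nat.pos_iff_ne_zero, Nat.floor_pos, one_le_div₀ (by positivity)]
    exact hL
  have h2 := Nat.pow_log_le_self 2 h1
  have h3 : ((2 ^ topScale K L : ℕ) : ℝ) ≤ (L : ℝ) / (4 * K) :=
    (Nat.cast_le.2 h2).trans (Nat.floor_le (by positivity))
  rw [le_div_iff₀ (by positivity)] at h3
  exact_mod_cast h3

lemma lt_pow_topScale {K : ℝ} (hK : 0 < K) (L : ℕ) :
    (L : ℝ) < 2 ^ topScale K L * (8 * K) := by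
  have h2 := Nat.lt_pow_succ_log_self (b := 2) (by norm_num) ⌊(L : ℝ) / (4 * K)⌋₊
  have h3 : (L : ℝ) / (4 * K) < ((2 ^ (topScale K L).succ : ℕ) : ℝ) :=
    (Nat.floor_lt' (by positivity)).1 h2
  rw [div_lt_iff₀ (by positivity)] at h3
  push_cast at h3
  rw [pow_succ] at h3
  linarith

lemma le_cellSide {K : ℝ} (hK : 0 < K) {L : ℕ} (hL : 4 * K ≤ L) : 4 * K ≤ cellSide K L := by
  rw [cellSide, le_div_iff₀ (by positivity)]
  linarith [pow_topScale_le hK hL]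

lemma cellSide_lt {K : ℝ} (hK : 0 < K) (L : ℕ) : cellSide K L < 8 * K := by
  rw [cellSide, div_lt_iff₀ (by positivity)]
  linarith [lt_pow_topScale hK L]

lemma cubeIdx_add_four_le {d : ℕ} {K : ℝ} (hK : 0 < K) {L : ℕ} (hL : 4 * K ≤ L)
    {z z' : Fin d → ℕ} {i : Fin d} (h : z i < z' i) : cubeIdx K L z i + 4 ≤ cubeIdx K L z' i := by
  have h1 : cellCorner K L z i / K + (4 : ℕ) ≤ cellCorner K L z' i / K := by
    rw [div_add' _ _ _ hK.ne']
    refine div_le_div_of_nonneg_right ?_ hK.le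
    unfold cellCorner
    have h2 : (z i : ℝ) + 1 ≤ z' i := by exact_mod_cast h
    have := le_cellSide hK hL
    push_cast
    nlinarith
  have := Int.ceil_le_ceil h1
  rwa [Int.ceil_add_natCast] at this

lemma cubeIdx_ne {d : ℕ} {K : ℝ} (hK : 0 < K) {L : ℕ} (hL : 4 * K ≤ L) (z z' : Fin d → ℕ)
    (h : z ≠ z') : cubeIdx K L z ≠ cubeIdx K L z' ∧ cubeIdx K L z + 1 ≠ cubeIdx K L z' + 1 ∧
      cubeIdx K L z ≠ cubeIdx K L z' + 1 := by
  obtain ⟨i, hi⟩ := Function.ne_iff.1 h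
  have key : cubeIdx K L z i + 4 ≤ cubeIdx K L z' i ∨ cubeIdx K L z' i + 4 ≤ cubeIdx K L z i :=
    (lt_or_gt_of_ne hi).imp (cubeIdx_add_four_le hK hL) (cubeIdx_add_four_le hK hL)
  refine ⟨fun e => ?_, fun e => ?_, fun e => ?_⟩ <;>
  · have := congrFun e i
    try simp only [Pi.add_apply, Pi.one_apply] at this
    omega

lemma tendsto_microScale {d : ℕ} (hd : 1 ≤ d) {K : ℝ} (hK : 0 < K) :
    Tendsto (microScale d K) atTop atTop := by
  refine tendsto_atTop.2 fun N => ?_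
  obtain ⟨L₀, hL₀⟩ := exists_nat_ge ((2 : ℝ) ^ (4 * d * N) * (4 * K))
  filter_upwards [eventually_ge_atTop L₀] with L hL
  rw [microScale, Nat.le_div_iff_mul_le (by positivity)]
  refine Nat.le_log_of_pow_le (by norm_num) (Nat.le_floor ?_)
  rw [le_div_iff₀ (by positivity)]
  push_cast
  rw [mul_comm N]
  have : (L₀ : ℝ) ≤ L := by exact_mod_cast hL
  linarith

/-- Resistance of an edge between good cells at scale `j`. -/
def scaleRes (α D : ℝ) (j : ℕ) : ℝ := Real.exp (D * ((2 : ℝ) ^ α) ^ j)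

/-- Cost of a cell of level `j`. -/
def scaleCost (d : ℕ) (α D : ℝ) (j : ℕ) : ℝ := scaleRes α D j * 2 ^ (j * (d + 1))

lemma one_le_scaleRes {α D : ℝ} (hD : 0 ≤ D) (j : ℕ) : 1 ≤ scaleRes α D j :=
  Real.one_le_exp (by positivity)

lemma scaleRes_mono {α D : ℝ} (hα : 0 ≤ α) (hD : 0 ≤ D) : Monotone (scaleRes α D) := by
  intro i j hij
  refine Real.exp_le_exp.2 (mul_le_mul_of_nonneg_left ?_ hD)
  exact pow_le_pow_right₀ (Real.one_le_rpow (by norm_num) hα) hij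

lemma one_le_scaleCost {d : ℕ} {α D : ℝ} (hD : 0 ≤ D) (j : ℕ) : 1 ≤ scaleCost d α D j :=
  one_le_mul_of_one_le_of_one_le (one_le_scaleRes hD j) (one_le_pow₀ (by norm_num))

lemma scaleCost_mono {d : ℕ} {α D : ℝ} (hα : 0 ≤ α) (hD : 0 ≤ D) :
    Monotone (scaleCost d α D) := by
  intro i j hij
  exact mul_le_mul (scaleRes_mono hα hD hij)
    (pow_le_pow_right₀ (by norm_num) (Nat.mul_le_mul_right _ hij)) (by positivity)
    (Real.exp_pos _).le

lemma eventually_scaleCost_le {d : ℕ} {α D : ℝ} (hα : 0 < α) (hαd : α < d) :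
    ∀ᶠ j : ℕ in atTop, Real.exp 1 * (2 ^ j * scaleCost d α D (j + 1))
      ≤ Real.exp (1 / (32 * (d + 2)) * 2 ^ (j * d)) := by
  have hθ : (2 : ℝ) ^ α < 2 ^ d := by
    rw [← Real.rpow_natCast]
    exact Real.rpow_lt_rpow_of_exponent_lt (by norm_num) hαd
  have hθ0 : (0 : ℝ) < 2 ^ α := by positivity
  have hd1 : (1 : ℝ) < 2 ^ d := lt_of_le_of_lt (Real.one_le_rpow (by norm_num) hα.le) hθ
  have hl0 := isLittleO_pow_const_const_pow_of_one_lt (R := ℝ) 0 hd1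
  have hl1 := isLittleO_pow_const_const_pow_of_one_lt (R := ℝ) 1 hd1
  have hl2 := isLittleO_pow_pow_of_lt_left hθ0.le hθ
  have h := ((hl0.const_mul_left (d + 2)).add (hl1.const_mul_left (d + 2))).add
    (hl2.const_mul_left (D * 2 ^ α))
  filter_upwards [h.def (by positivity : (0 : ℝ) < 1 / (32 * (d + 2)))] with j hj
  have e2 : (2 : ℝ) ≤ Real.exp 1 := by
    have := Real.add_one_le_exp (1 : ℝ); linarith
  have hp : ∀ n : ℕ, (2 : ℝ) ^ n ≤ Real.exp n := fun n => by
    rw [← mul_one (n : ℝ), Real.exp_nat_mul]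
    exact pow_le_pow_left₀ (by norm_num) e2 n
  have hj' := (le_abs_self _).trans hj
  rw [Real.norm_of_nonneg (by positivity)] at hj'
  simp only [pow_zero, mul_one, pow_one] at hj'
  calc _ ≤ Real.exp 1 * (Real.exp j * (Real.exp (D * ((2 : ℝ) ^ α) ^ (j + 1))
        * Real.exp (((j + 1) * (d + 1) : ℕ) : ℝ))) := by
        unfold scaleCost scaleRes
        gcongr
        · exact hp j
        · exact hp _
    _ = Real.exp (1 + (j + (D * ((2 : ℝ) ^ α) ^ (j + 1) + ((j + 1) * (d + 1) : ℕ)))) := by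
        simp only [Real.exp_add]
    _ ≤ _ := by
        refine Real.exp_le_exp.2 ?_
        rw [mul_comm j d, pow_mul]
        refine le_trans (le_of_eq ?_) hj'
        push_cast
        ring

lemma eventually_microScale_cond (d : ℕ) (hd : 1 ≤ d) : ∀ᶠ J : ℕ in atTop,
    (8 * d * (d + 2) * J : ℝ) ≤ 2 ^ (J * d) * Real.exp (-(J * d / 4)) := by
  have hr : (1 : ℝ) < Real.exp (1 / 4) := Real.one_lt_exp_iff.2 (by norm_num)
  have h := (isLittleO_pow_const_const_pow_of_one_lt (R := ℝ) 1 hr).const_mul_left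
    (8 * d * (d + 2))
  filter_upwards [h.def zero_lt_one] with J hJ
  have hJ' := (le_abs_self _).trans hJ
  rw [Real.norm_of_nonneg (by positivity), one_mul, pow_one] at hJ'
  refine hJ'.trans ?_
  have h1 : Real.exp (1 / 2) ≤ 2 := by
    rw [← Real.le_log_iff_exp_le (by norm_num)]
    have := Real.log_two_gt_d9
    linarith
  have h2 : Real.exp (1 / 2) ^ (J * d) ≤ 2 ^ (J * d) :=
    pow_le_pow_left₀ (Real.exp_pos _).le h1 _
  calc Real.exp (1 / 4) ^ J ≤ Real.exp (1 / 2) ^ (J * d) * Real.exp (-(J * d / 4)) := by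
        rw [← Real.exp_nat_mul, ← Real.exp_nat_mul, ← Real.exp_add]
        refine Real.exp_le_exp.2 ?_
        have h3 : (1 : ℝ) ≤ d := by exact_mod_cast hd
        have h4 : (0 : ℝ) ≤ J := Nat.cast_nonneg J
        push_cast
        nlinarith
    _ ≤ _ := mul_le_mul_of_nonneg_right h2 (Real.exp_pos _).le

lemma topScale_le_microScale {d : ℕ} (hd : 1 ≤ d) {K : ℝ} {L : ℕ} (h : 1 ≤ microScale d K L) :
    topScale K L ≤ 8 * d * microScale d K L := by
  have h1 : topScale K L < 4 * d * (microScale d K L + 1) :=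
    Nat.lt_mul_div_succ _ (by positivity)
  nlinarith

lemma bernoulli_eventually_sparse {d : ℕ} (hd : 1 ≤ d) {K : ℝ} (hK : 0 < K)
    {ν : Measure ((Fin d → ℤ) → Bool)} (hν : IsBernoulliField d (7 / 8) ν) {m : ℕ → ℝ} {j₀ : ℕ}
    (hm : ∀ j, 0 < m j)
    (hme : ∀ j, j₀ ≤ j → Real.exp 1 * m j ≤ Real.exp (1 / (32 * (d + 2)) * 2 ^ (j * d))) :
    ∀ᵐ ω ∂ν, ∀ᶠ L : ℕ in atTop,
      SparseBad (fun z => ω (cubeIdx K L z) = false ∨ ω (cubeIdx K L z + 1) = false) m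
        (topScale K L) (microScale d K L) j₀ := by
  have hev : ∀ᶠ L : ℕ in atTop, ν {ω | ¬ SparseBad (fun z => ω (cubeIdx K L z) = false ∨
      ω (cubeIdx K L z + 1) = false) m (topScale K L) (microScale d K L) j₀}
      ≤ ENNReal.ofReal (64 * K ^ 2 * (1 / (L : ℝ) ^ 2)) := by
    obtain ⟨L₀, hL₀⟩ := exists_nat_ge (4 * K)
    filter_upwards [eventually_ge_atTop L₀, eventually_ge_atTop 1,
      (tendsto_microScale hd hK).eventually (eventually_microScale_cond d hd),
      (tendsto_microScale hd hK).eventually_ge_atTop 1] with L hL hL1 hX hJ1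
    have hKL : 4 * K ≤ L := hL₀.trans (by exact_mod_cast hL)
    refine (measure_not_sparseBad_le ν
      (bernoulli_bad_le hν (κ := cubeIdx K L) (κ' := fun z => cubeIdx K L z + 1)
        (cubeIdx_ne hK hKL)) hm hd hme (Nat.div_le_self _ _)
      (topScale_le_microScale hd hJ1) hX).trans ?_
    refine ENNReal.ofReal_le_ofReal ?_
    have hL0 : (0 : ℝ) < L := by exact_mod_cast hL1
    have h1 := lt_pow_topScale hK L
    rw [one_div_pow, mul_one_div, div_le_div_iff₀ (by positivity) (by positivity), one_mul]
    have h4 : (4 : ℝ) ^ topScale K L = (2 ^ topScale K L) ^ 2 := by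
      rw [← pow_mul, mul_comm, pow_mul]; norm_num
    rw [h4]
    nlinarith
  obtain ⟨L₀, hL₀⟩ := eventually_atTop.1 hev
  have hsum : ∑' L : ℕ, ν {ω | L₀ ≤ L ∧ ¬ SparseBad (fun z => ω (cubeIdx K L z) = false ∨
      ω (cubeIdx K L z + 1) = false) m (topScale K L) (microScale d K L) j₀} ≠ ⊤ := by
    refine ne_top_of_le_ne_top ((Real.summable_one_div_nat_pow.2 one_lt_two).mul_left
      (64 * K ^ 2)).tsum_ofReal_ne_top (ENNReal.tsum_le_tsum fun L => ?_)
    by_cases h : L₀ ≤ L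
    · simpa only [h, true_and] using hL₀ L h
    · simp [h]
  filter_upwards [ae_eventually_notMem hsum] with ω hω
  filter_upwards [hω, eventually_ge_atTop L₀] with L hL hLL
  by_contra hn
  exact hL ⟨hLL, hn⟩

lemma measurableSet_Kcube (d : ℕ) (K : ℝ) (x : Fin d → ℤ) : MeasurableSet (Kcube d K x) := by
  unfold Kcube
  simp only [Set.ofPred_forall]
  refine MeasurableSet.iInter fun i => ?_
  have h : Measurable fun p : Pt d => p i := by fun_prop
  exact (measurableSet_le measurable_const h).inter (measurableSet_lt h measurable_const)

lemma isBounded_of_coord {d : ℕ} {A : Set (Pt d)} {r : ℝ} (h : ∀ p ∈ A, ∀ i, |p i| ≤ r) :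
    Bornology.IsBounded A := by
  rcases A.eq_empty_or_nonempty with rfl | ⟨p₀, hp₀⟩
  · exact Bornology.isBounded_empty
  refine isBounded_iff_forall_norm_le.2 ⟨√(∑ _i : Fin d, r ^ 2), fun p hp => ?_⟩
  rw [EuclideanSpace.norm_eq]
  refine Real.sqrt_le_sqrt (Finset.sum_le_sum fun i _ => ?_)
  rw [Real.norm_eq_abs]
  exact pow_le_pow_left₀ (abs_nonneg _) (h p hp i) 2

lemma isBounded_Kcube (d : ℕ) (K : ℝ) (x : Fin d → ℤ) : Bornology.IsBounded (Kcube d K x) := by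
  refine isBounded_of_coord (r := ∑ i, (|K * x i| + |K|)) fun p hp i => ?_
  refine le_trans ?_ (Finset.single_le_sum (f := fun i => |K * (x i : ℝ)| + |K|)
    (fun i _ => by positivity) (Finset.mem_univ i))
  have h := hp i
  rw [abs_le]
  constructor
  · have := neg_abs_le (K * (x i : ℝ))
    have := abs_nonneg K
    linarith
  · have := le_abs_self (K * (x i : ℝ))
    have := le_abs_self K
    linarith

lemma measurableSet_badCell {d : ℕ} (K : ℝ) (L : ℕ) (z : Fin d → ℕ) :
    MeasurableSet {ξ : Config d | BadCell K L ξ z} := by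
  have h : ∀ x, MeasurableSet {ξ : Config d | (ξ ∩ Kcube d K x).ncard = 0} := fun x =>
    MeasurableSpace.measurableSet_generateFrom
      ⟨_, 0, isBounded_Kcube d K x, measurableSet_Kcube d K x, rfl⟩
  exact (h _).union (h _)

/-- Under the domination assumption, bad cells are almost surely eventually sparse. -/
lemma eventually_sparse {d : ℕ} (hd : 1 ≤ d) {P : Measure (Config d)} (hP : IsPointProcess P)
    (hA1 : AssumptionA1 P) : ∃ K : ℝ, 0 < K ∧ ∀ (m : ℕ → ℝ) (j₀ : ℕ), (∀ j, 0 < m j) →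
    (∀ j, j₀ ≤ j → Real.exp 1 * m j ≤ Real.exp (1 / (32 * (d + 2)) * 2 ^ (j * d))) →
    ∀ᵐ ξ ∂P, ∀ᶠ L : ℕ in atTop,
      SparseBad (BadCell K L ξ) m (topScale K L) (microScale d K L) j₀ := by
  obtain ⟨K, hK, μ, ν, hμ, hν, h1, h2, hdom⟩ := hA1 (7 / 8) (by norm_num) (by norm_num)
  refine ⟨K, hK, fun m j₀ hm hme => ?_⟩
  have hs := bernoulli_eventually_sparse hd hK hν hm hme
  rw [← h2] at hs
  have hs' := ae_of_ae_map measurable_snd.aemeasurable hs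
  have hlf := hP.2
  rw [← h1] at hlf ⊢
  have hlf' := ae_of_ae_map measurable_fst.aemeasurable hlf
  rw [ae_map_iff measurable_fst.aemeasurable]
  · filter_upwards [hs', hlf', hdom] with ω hω hfin hle
    filter_upwards [hω] with L hL
    refine hL.mono (fun j => (hm j).le) fun z hz => ?_
    have key : ∀ x, (ω.1 ∩ Kcube d K x).ncard = 0 → ω.2 x = false := by
      intro x hx
      rw [Set.ncard_eq_zero (hfin _ (isBounded_Kcube d K x))] at hx
      by_contra hne
      rw [Bool.not_eq_false] at hne
      exact (hle x hne).ne_empty hx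
    exact hz.imp (key _) (key _)
  · simp only [eventually_atTop, Set.ofPred_exists, Set.ofPred_forall]
    exact MeasurableSet.iUnion fun N => MeasurableSet.iInter fun L => MeasurableSet.iInter fun _ =>
      measurableSet_sparseBad (measurableSet_badCell K L) m _ _ j₀

end Percolation

section Geometry

/-- The dyadic cell of the box of side `L` containing a point. -/
def cellOf {d : ℕ} (K : ℝ) (L : ℕ) (p : Pt d) (i : Fin d) : ℕ :=
  min ⌊(p i + L / 2) / cellSide K L⌋₊ (2 ^ topScale K L - 1)

lemma mem_tile_zero {d : ℕ} {H : ℕ} {z : Fin d → ℕ} : z ∈ tile H 0 ↔ ∀ i, z i < 2 ^ H := by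
  rw [mem_tile, funext_iff]
  refine forall_congr' fun i => ?_
  simp [coarse, Nat.div_eq_zero_iff]

lemma cellOf_mem_tile {d : ℕ} (K : ℝ) (L : ℕ) (p : Pt d) : cellOf K L p ∈ tile (topScale K L) 0 :=
  mem_tile_zero.2 fun i => by
    have : 0 < 2 ^ topScale K L := by positivity
    unfold cellOf
    omega

lemma pow_mul_cellSide (K : ℝ) (L : ℕ) : 2 ^ topScale K L * cellSide K L = L := by
  unfold cellSide
  field_simp

lemma cellOf_spec {d : ℕ} {K : ℝ} (hK : 0 < K) {L : ℕ} (hL : 4 * K ≤ L) {p : Pt d}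
    (hp : p ∈ cube d L) (i : Fin d) :
    cellCorner K L (cellOf K L p) i ≤ p i ∧
      p i ≤ cellCorner K L (cellOf K L p) i + cellSide K L := by
  have ha : 0 < cellSide K L := by linarith [le_cellSide hK hL]
  obtain ⟨h1, h2⟩ := abs_le.1 (hp i)
  have hx0 : 0 ≤ (p i + L / 2) / cellSide K L := div_nonneg (by linarith) ha.le
  have hx1 : (p i + L / 2) / cellSide K L ≤ 2 ^ topScale K L := by
    rw [div_le_iff₀ ha, pow_mul_cellSide]
    linarith
  have key : (cellOf K L p i : ℝ) ≤ (p i + L / 2) / cellSide K L ∧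
      (p i + L / 2) / cellSide K L ≤ cellOf K L p i + 1 := by
    constructor
    · exact (Nat.cast_le.2 (min_le_left _ _)).trans (Nat.floor_le hx0)
    · rcases min_choice ⌊(p i + L / 2) / cellSide K L⌋₊ (2 ^ topScale K L - 1) with h | h
      · rw [cellOf, h]
        exact (Nat.lt_floor_add_one _).le
      · rw [cellOf, h, Nat.cast_sub Nat.one_le_two_pow]
        push_cast
        linarith
  rw [le_div_iff₀ ha, div_le_iff₀ ha] at key
  unfold cellCorner
  constructor <;> nlinarith

lemma cellOf_eq {d : ℕ} {K : ℝ} (hK : 0 < K) {L : ℕ} (hL : 4 * K ≤ L) {p : Pt d}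
    {z : Fin d → ℕ} (hz : z ∈ tile (topScale K L) 0)
    (h : ∀ i, cellCorner K L z i ≤ p i ∧ p i < cellCorner K L z i + cellSide K L) :
    cellOf K L p = z := by
  have ha : 0 < cellSide K L := by linarith [le_cellSide hK hL]
  funext i
  have h1 : ⌊(p i + L / 2) / cellSide K L⌋₊ = z i := by
    obtain ⟨h1, h2⟩ := h i
    unfold cellCorner at h1 h2
    rw [Nat.floor_eq_iff (div_nonneg (by nlinarith [(z i).cast_nonneg (α := ℝ)]) ha.le),
      le_div_iff₀ ha, div_lt_iff₀ ha]
    constructor <;> nlinarith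
  have := mem_tile_zero.1 hz i
  rw [cellOf, h1]
  omega

lemma exists_pair_of_not_badCell {d : ℕ} (hd : 1 ≤ d) {K : ℝ} (hK : 0 < K) {L : ℕ}
    (hL : 4 * K ≤ L) {ξ : Config d} {z : Fin d → ℕ} (hz : z ∈ tile (topScale K L) 0)
    (h : ¬ BadCell K L ξ z) :
    ∃ p ∈ ξ ∩ cube d L, ∃ q ∈ ξ ∩ cube d L, p ≠ q ∧ cellOf K L p = z ∧ cellOf K L q = z := by
  rw [BadCell, not_or] at h
  obtain ⟨p, hpξ, hp⟩ := Set.nonempty_of_ncard_ne_zero h.1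
  obtain ⟨q, hqξ, hq⟩ := Set.nonempty_of_ncard_ne_zero h.2
  have ha := le_cellSide hK hL
  have hκ : ∀ i, cellCorner K L z i ≤ K * cubeIdx K L z i ∧
      K * cubeIdx K L z i < cellCorner K L z i + K := by
    intro i
    have h1 := Int.le_ceil (cellCorner K L z i / K)
    have h2 := Int.ceil_lt_add_one (cellCorner K L z i / K)
    rw [div_le_iff₀ hK] at h1
    rw [← sub_lt_iff_lt_add, lt_div_iff₀ hK] at h2
    unfold cubeIdx
    constructor <;> linarith
  have hq' : ∀ i, K * cubeIdx K L z i + K ≤ q i ∧ q i < K * cubeIdx K L z i + K + K := by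
    intro i
    obtain ⟨h1, h2⟩ := hq i
    simp only [Pi.add_apply, Pi.one_apply, Int.cast_add, Int.cast_one] at h1 h2
    constructor <;> linarith
  have hpc : ∀ i, cellCorner K L z i ≤ p i ∧ p i < cellCorner K L z i + cellSide K L := by
    intro i
    obtain ⟨h1, h2⟩ := hp i
    obtain ⟨h3, h4⟩ := hκ i
    constructor <;> linarith
  have hqc : ∀ i, cellCorner K L z i ≤ q i ∧ q i < cellCorner K L z i + cellSide K L := by
    intro i
    obtain ⟨h1, h2⟩ := hq' i
    obtain ⟨h3, h4⟩ := hκ i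
    constructor <;> linarith
  have hcube : ∀ p : Pt d,
      (∀ i, cellCorner K L z i ≤ p i ∧ p i < cellCorner K L z i + cellSide K L) →
      p ∈ cube d L := by
    intro p hp i
    obtain ⟨h1, h2⟩ := hp i
    have h3 : (z i : ℝ) + 1 ≤ 2 ^ topScale K L := by exact_mod_cast mem_tile_zero.1 hz i
    have h4 := pow_mul_cellSide K L
    unfold cellCorner at h1 h2
    rw [abs_le]
    constructor <;> nlinarith [(z i).cast_nonneg (α := ℝ)]
  refine ⟨p, ⟨hpξ, hcube p hpc⟩, q, ⟨hqξ, hcube q hqc⟩, ?_, cellOf_eq hK hL hz hpc,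
    cellOf_eq hK hL hz hqc⟩
  rintro rfl
  linarith [(hp ⟨0, hd⟩).2, (hq' ⟨0, hd⟩).1]

lemma dist_le_of_coord {d : ℕ} {p q : Pt d} {r : ℝ} (h : ∀ i, |p i - q i| ≤ r) :
    dist p q ≤ d * r := by
  rcases Nat.eq_zero_or_pos d with rfl | hd
  · simp [EuclideanSpace.dist_eq]
  have hr : 0 ≤ r := (abs_nonneg _).trans (h ⟨0, hd⟩)
  have hd1 : (1 : ℝ) ≤ d := by exact_mod_cast hd
  rw [EuclideanSpace.dist_eq]
  refine Real.sqrt_le_iff.2 ⟨by positivity, ?_⟩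
  calc ∑ i, dist (p i) (q i) ^ 2 ≤ ∑ _i : Fin d, r ^ 2 :=
        Finset.sum_le_sum fun i _ => pow_le_pow_left₀ dist_nonneg (h i) 2
    _ = d * r ^ 2 := by simp
    _ ≤ (d * r) ^ 2 := by nlinarith [sq_nonneg r, mul_nonneg (sub_nonneg.2 hd1) (sq_nonneg r)]

lemma dist_le_of_cellOf {d : ℕ} {K : ℝ} (hK : 0 < K) {L : ℕ} (hL : 4 * K ≤ L) {p q : Pt d}
    (hp : p ∈ cube d L) (hq : q ∈ cube d L) {m : ℕ}
    (h : ∀ i, |(cellOf K L p i : ℝ) - cellOf K L q i| ≤ 3 * 2 ^ m) :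
    dist p q ≤ 32 * K * d * 2 ^ m := by
  have ha : 0 < cellSide K L := by linarith [le_cellSide hK hL]
  have ha' := cellSide_lt hK L
  have h1m : (1 : ℝ) ≤ 2 ^ m := one_le_pow₀ (by norm_num)
  refine (dist_le_of_coord (r := cellSide K L * (3 * 2 ^ m + 1)) fun i => ?_).trans ?_
  · have h1 := cellOf_spec hK hL hp i
    have h2 := cellOf_spec hK hL hq i
    have h3 := abs_le.1 (h i)
    unfold cellCorner at h1 h2
    rw [abs_le]
    constructor <;> nlinarith
  · have : cellSide K L * (3 * 2 ^ m + 1) ≤ 8 * K * (4 * 2 ^ m) :=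
      mul_le_mul ha'.le (by linarith) (by positivity) (by positivity)
    nlinarith [mul_le_mul_of_nonneg_left this (Nat.cast_nonneg (α := ℝ) d)]

lemma abs_sub_le_of_coarse_eq {d : ℕ} {j : ℕ} {z z' : Fin d → ℕ} (h : coarse j z = coarse j z')
    (i : Fin d) : |(z i : ℝ) - z' i| ≤ 2 ^ j := by
  have h1 : z i / 2 ^ j = z' i / 2 ^ j := congrFun h i
  have h2 := Nat.div_add_mod (z i) (2 ^ j)
  have h3 := Nat.div_add_mod (z' i) (2 ^ j)
  have h4 := Nat.mod_lt (z i) (y := 2 ^ j) (by positivity)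
  have h5 := Nat.mod_lt (z' i) (y := 2 ^ j) (by positivity)
  rw [h1] at h2
  have h6 : z i ≤ z' i + 2 ^ j := by omega
  have h7 : z' i ≤ z i + 2 ^ j := by omega
  have h8 : (z i : ℝ) ≤ z' i + 2 ^ j := by exact_mod_cast h6
  have h9 : (z' i : ℝ) ≤ z i + 2 ^ j := by exact_mod_cast h7
  rw [abs_le]
  constructor <;> linarith

lemma abs_sub_next_le {d : ℕ} (k : Fin d) (z : Fin d → ℕ) (i : Fin d) :
    |(z i : ℝ) - next k z i| ≤ 1 := by
  by_cases h : i = k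
  · subst h
    simp [next]
  · simp [next, h]

lemma one_le_scaleRes_mul_rate {d : ℕ} {α : ℝ} (hα : 0 ≤ α) {r : ℝ} (hr : 0 ≤ r) {m : ℕ}
    {x y : Pt d} (h : dist x y ≤ r * 2 ^ m) : 1 ≤ scaleRes α (r ^ α) m * rate α x y := by
  have h1 : dist x y ^ α ≤ r ^ α * ((2 : ℝ) ^ α) ^ m := by
    refine (Real.rpow_le_rpow dist_nonneg h hα).trans_eq ?_
    rw [Real.mul_rpow hr (by positivity), ← Real.rpow_natCast, ← Real.rpow_natCast,
      ← Real.rpow_mul (by norm_num), ← Real.rpow_mul (by norm_num), mul_comm α]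
  rw [scaleRes, rate, ← Real.exp_add]
  exact Real.one_le_exp (by linarith)

end Geometry

section Network

lemma rate_symm {d : ℕ} (α : ℝ) (x y : Pt d) : rate α x y = rate α y x := by
  rw [rate, rate, dist_comm]

lemma rate_pos {d : ℕ} (α : ℝ) (x y : Pt d) : 0 < rate α x y := Real.exp_pos _

lemma rate_self {d : ℕ} {α : ℝ} (hα : 0 < α) (x : Pt d) : rate α x x = 1 := by
  simp [rate, Real.zero_rpow hα.ne']

lemma wgt_le_sum_rate {d : ℕ} {α : ℝ} (hα : 0 < α) {E : Finset (Pt d)} (i : ℕ) {x : Pt d}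
    (hx : x ∈ E) : wgt α E i x ≤ ∑ y ∈ E, rate α x y := by
  rw [← Finset.add_sum_erase E _ hx, rate_self hα]
  have h : 0 ≤ ∑ z ∈ E.erase x, rate α x z := Finset.sum_nonneg fun z _ => (rate_pos α x z).le
  unfold wgt
  split_ifs
  · linarith
  · linarith
  · exact max_le (by linarith) (by linarith)

lemma one_le_mul_wgt {d : ℕ} {α : ℝ} {E : Finset (Pt d)} (i : ℕ) {x y : Pt d} {R : ℝ}
    (hR : 1 ≤ R) (hy : y ∈ E) (hne : y ≠ x) (h : 1 ≤ R * rate α x y) : 1 ≤ R * wgt α E i x := by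
  have h1 : rate α x y ≤ ∑ z ∈ E.erase x, rate α x z :=
    Finset.single_le_sum (f := fun z => rate α x z) (fun z _ => (rate_pos α x z).le)
      (Finset.mem_erase.2 ⟨hne, hy⟩)
  unfold wgt
  split_ifs
  · linarith
  · nlinarith
  · nlinarith [le_max_left 1 (∑ z ∈ E.erase x, rate α x z)]

theorem exists_dyadicNet {d : ℕ} (hd : 1 ≤ d) {α : ℝ} (hα : 0 < α) {K : ℝ} (hK : 0 < K) {L : ℕ}
    (hL : 4 * K ≤ L) {ξ : Config d} (hfin : (ξ ∩ cube d L).Finite) {j₀ : ℕ}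
    (hj : j₀ ≤ microScale d K L) (hJ1 : 1 ≤ microScale d K L)
    (hs : SparseBad (BadCell K L ξ)
      (fun j => 2 ^ j * scaleCost d α ((32 * K * d) ^ α) (j + 1))
      (topScale K L) (microScale d K L) j₀)
    (i : ℕ) {Cw : ℝ}
    (hup : ∀ b : Fin d → ℕ,
      ∑ x : ↥hfin.toFinset with coarse (microScale d K L) (cellOf K L x.1) = b,
        wgt α hfin.toFinset i x ≤ Cw * 2 ^ (microScale d K L * d)) :
    ∃ pt : (Fin d → ℕ) → ↥hfin.toFinset,
      DyadicNet (topScale K L) (microScale d K L) (scaleCost d α ((32 * K * d) ^ α) j₀ + 2) Cw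
        (1 / scaleRes α ((32 * K * d) ^ α) 0) (scaleRes α ((32 * K * d) ^ α))
        (fun x : ↥hfin.toFinset => wgt α hfin.toFinset i x) (fun x y => rate α x.1 y.1)
        (fun x => cellOf K L x.1) pt (goodLevel (BadCell K L ξ)) := by
  set D : ℝ := (32 * K * d) ^ α with hD
  have hr : (0 : ℝ) ≤ 32 * K * d := by positivity
  have hD0 : 0 ≤ D := by positivity
  have hR := one_le_scaleRes (α := α) hD0
  have hJH : microScale d K L ≤ topScale K L := Nat.div_le_self _ _
  have hcube : ∀ x : ↥hfin.toFinset, x.1 ∈ cube d L := fun x => (hfin.mem_toFinset.1 x.2).2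
  have hnb : ∀ z ∈ tile (topScale K L) 0,
      ¬ AllBad (BadCell K L ξ) (microScale d K L) (coarse (microScale d K L) z) := by
    refine fun z hz => SparseBad.not_allBad ?_ hj hJH hs hz
    have h1 := one_le_scaleCost (d := d) (α := α) hD0 (microScale d K L + 1)
    have h2 : (2 : ℝ) ^ 1 ≤ 2 ^ microScale d K L := pow_le_pow_right₀ (by norm_num) hJ1
    nlinarith
  have hgood : ∀ z ∈ tile (topScale K L) 0, ∃ u ∈ tile (topScale K L) 0,
      coarse (goodLevel (BadCell K L ξ) z) u = coarse (goodLevel (BadCell K L ξ) z) z ∧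
        ¬ BadCell K L ξ u := by
    intro z hz
    have h1 := not_allBad_goodLevel (hnb z hz)
    simp only [AllBad, not_forall] at h1
    obtain ⟨u, hu, hub⟩ := h1
    rw [mem_tile] at hu
    refine ⟨u, ?_, hu, hub⟩
    rw [mem_tile] at hz ⊢
    rw [← hz]
    exact coarse_congr ((goodLevel_le (hnb z (mem_tile.2 hz))).trans hJH) hu
  have hpt : ∀ z ∈ tile (topScale K L) 0, ∃ p : ↥hfin.toFinset,
      coarse (goodLevel (BadCell K L ξ) z) (cellOf K L p.1)
        = coarse (goodLevel (BadCell K L ξ) z) z ∧ ¬ BadCell K L ξ (cellOf K L p.1) := by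
    intro z hz
    obtain ⟨u, hu, huz, hub⟩ := hgood z hz
    obtain ⟨p, hp, -, -, -, hpu, -⟩ := exists_pair_of_not_badCell hd hK hL hu hub
    exact ⟨⟨p, hfin.mem_toFinset.2 hp⟩, by rwa [hpu], by rwa [hpu]⟩
  obtain ⟨p₀, -⟩ := hpt 0 (mem_tile_zero.2 fun i => by simp)
  have : Nonempty ↥hfin.toFinset := ⟨p₀⟩
  choose! pt hpt1 hpt2 using hpt
  have hw : ∀ (x : ↥hfin.toFinset) (m : ℕ), ∀ u ∈ tile (topScale K L) 0,
      coarse m u = coarse m (cellOf K L x.1) → ¬ BadCell K L ξ u →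
      1 ≤ scaleRes α D m * wgt α hfin.toFinset i x := by
    intro x m u hu hux hub
    obtain ⟨p, hp, q, hq, hpq, hpu, hqu⟩ := exists_pair_of_not_badCell hd hK hL hu hub
    obtain ⟨y, hy, hyx, hyu⟩ : ∃ y ∈ ξ ∩ cube d L, y ≠ x.1 ∧ cellOf K L y = u := by
      by_cases h : p = x.1
      · exact ⟨q, hq, fun e => hpq (h.trans e.symm), hqu⟩
      · exact ⟨p, hp, h, hpu⟩
    refine one_le_mul_wgt i (hR m) (hfin.mem_toFinset.2 hy) hyx ?_
    refine one_le_scaleRes_mul_rate hα.le hr (dist_le_of_cellOf hK hL (hcube x) hy.2 fun k => ?_)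
    rw [hyu]
    refine (abs_sub_le_of_coarse_eq hux.symm k).trans ?_
    linarith [pow_pos (two_pos (α := ℝ)) m]
  have hw_lower : ∀ x : ↥hfin.toFinset,
      1 ≤ scaleRes α D (goodLevel (BadCell K L ξ) (cellOf K L x.1))
        * wgt α hfin.toFinset i x := by
    intro x
    obtain ⟨u, hu, hux, hub⟩ := hgood _ (cellOf_mem_tile K L x.1)
    exact hw x _ u hu hux hub
  refine ⟨pt, ⟨fun x => cellOf_mem_tile K L x.1, fun z hz => goodLevel_le (hnb z hz), hpt1, hR,
    fun x y => (rate_pos α x.1 y.1).le, fun x y => rate_symm α x.1 y.1, fun x => ?_,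
    fun z hz => ?_, fun k z hz hz' => ?_, fun x => ?_, hw_lower, fun b hb => ?_,
    fun b _ => hup b⟩⟩
  · exact pos_of_mul_pos_right (zero_lt_one.trans_le (hw_lower x))
      (zero_le_one.trans (hR _))
  · rw [div_le_iff₀' (zero_lt_one.trans_le (hR 0))]
    exact hw (pt z) 0 _ (cellOf_mem_tile K L _) rfl (hpt2 z hz)
  · refine one_le_scaleRes_mul_rate hα.le hr
      (dist_le_of_cellOf hK hL (hcube _) (hcube _) fun l => ?_)
    have h1 := abs_le.1 (abs_sub_le_of_coarse_eq
      (coarse_congr (le_max_left _ (goodLevel (BadCell K L ξ) (next k z))) (hpt1 z hz)) l)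
    have h2 := abs_le.1 (abs_sub_le_of_coarse_eq
      (coarse_congr (le_max_right (goodLevel (BadCell K L ξ) z) _) (hpt1 _ hz')) l)
    have h3 := abs_le.1 (abs_sub_next_le k z l)
    have h4 : (1 : ℝ) ≤ 2 ^ max (goodLevel (BadCell K L ξ) z)
        (goodLevel (BadCell K L ξ) (next k z)) := one_le_pow₀ (by norm_num)
    rw [abs_le]
    constructor <;> linarith
  · refine one_le_scaleRes_mul_rate hα.le hr
      (dist_le_of_cellOf hK hL (hcube _) (hcube _) fun l => ?_)
    refine (abs_sub_le_of_coarse_eq (hpt1 _ (cellOf_mem_tile K L x.1)).symm l).trans ?_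
    linarith [pow_pos (two_pos (α := ℝ)) (goodLevel (BadCell K L ξ) (cellOf K L x.1))]
  · exact SparseBad.sum_goodLevel_le (one_le_scaleCost hD0) (scaleCost_mono hα.le hD0) hj hJH hJ1
      hs hb

end Network

section Volume

lemma ofReal_sum_rate_le_Rfun {d : ℕ} {α : ℝ} {A : Set (Pt d)} {ξ : Config d}
    {F E : Finset (Pt d)} (hF : ∀ x ∈ F, x ∈ ξ ∩ A) (hE : ∀ y ∈ E, y ∈ ξ) :
    ENNReal.ofReal (∑ x ∈ F, ∑ y ∈ E, rate α x y) ≤ Rfun α A ξ := by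
  rw [ENNReal.ofReal_sum_of_nonneg fun x _ => Finset.sum_nonneg fun y _ => (rate_pos α x y).le]
  have h1 : ∀ x : Pt d, ENNReal.ofReal (∑ y ∈ E, rate α x y)
      ≤ ∑' y : ↥ξ, ENNReal.ofReal (rate α x y) := by
    intro x
    rw [ENNReal.ofReal_sum_of_nonneg fun y _ => (rate_pos α x y).le]
    refine le_trans (le_of_eq ?_)
      (ENNReal.sum_le_tsum (E.attach.map ⟨fun y => (⟨y.1, hE _ y.2⟩ : ↥ξ), fun a b h =>
        Subtype.ext (Subtype.mk.inj h)⟩))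
    rw [Finset.sum_map]
    exact (Finset.sum_attach E fun y => ENNReal.ofReal (rate α x y)).symm
  refine (Finset.sum_le_sum fun x _ => h1 x).trans (le_trans (le_of_eq ?_)
    (ENNReal.sum_le_tsum (F.attach.map ⟨fun x => (⟨x.1, hF _ x.2⟩ : ↥(ξ ∩ A)), fun a b h =>
      Subtype.ext (Subtype.mk.inj h)⟩)))
  rw [Finset.sum_map]
  exact (Finset.sum_attach F fun x => ∑' y : ↥ξ, ENNReal.ofReal (rate α x y)).symm

/-- The volume of a tile, given the bounds on the cubes covering it. -/
lemma sum_wgt_tile_le {d : ℕ} {α : ℝ} (hα : 0 < α) {K : ℝ} (hK : 0 < K) {L : ℕ}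
    (hL : 4 * K ≤ L) {ξ : Config d} (hfin : (ξ ∩ cube d L).Finite) {ε C : ℝ} (hC : 0 < C)
    (hV : ∀ x : Fin d → ℤ, (Vcube d L ε x ∩ cube d L).Nonempty →
      Rfun α (Vcube d L ε x) ξ ≤ ENNReal.ofReal (C * (L : ℝ) ^ (ε * d)))
    {M : ℕ} {M₂ : ℝ} {J : ℕ} (hM : cellSide K L * 2 ^ J ≤ M * (L : ℝ) ^ ε)
    (hM₂ : (L : ℝ) ^ ε ≤ M₂ * 2 ^ J) (i : ℕ) (b : Fin d → ℕ) :
    ∑ x : ↥hfin.toFinset with coarse J (cellOf K L x.1) = b, wgt α hfin.toFinset i x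
      ≤ (M + 1) ^ d * (C * M₂ ^ d) * 2 ^ (J * d) := by
  classical
  have ha : 0 < cellSide K L := by linarith [le_cellSide hK hL]
  have hL0 : (0 : ℝ) < L := by linarith
  set s : ℝ := (L : ℝ) ^ ε with hs
  have hs0 : 0 < s := Real.rpow_pos_of_pos hL0 ε
  set E := hfin.toFinset with hE
  set lo : Fin d → ℝ := fun k => -((L : ℝ) / 2) + cellSide K L * (2 ^ J * b k) with hlo
  set S : Finset (Fin d → ℤ) :=
    Fintype.piFinset fun k => Finset.Icc ⌊lo k / s⌋ (⌊lo k / s⌋ + M) with hS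
  have hScard : S.card = (M + 1) ^ d := by
    rw [hS, Fintype.card_piFinset]
    simp only [Int.card_Icc]
    rw [Finset.prod_congr rfl fun k _ => (by omega :
      (⌊lo k / s⌋ + (M : ℤ) + 1 - ⌊lo k / s⌋).toNat = M + 1)]
    simp
  let idx : Pt d → Fin d → ℤ := fun p k => ⌊p k / s⌋
  have hidx : ∀ x : ↥E, coarse J (cellOf K L x.1) = b → idx x.1 ∈ S := by
    intro x hx
    refine Fintype.mem_piFinset.2 fun k => ?_
    have hxc : x.1 ∈ cube d L := (hfin.mem_toFinset.1 x.2).2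
    obtain ⟨h1, h2⟩ := cellOf_spec hK hL hxc k
    have h3 : cellOf K L x.1 k / 2 ^ J = b k := congrFun hx k
    have h4 := Nat.div_add_mod (cellOf K L x.1 k) (2 ^ J)
    have h5 := Nat.mod_lt (cellOf K L x.1 k) (y := 2 ^ J) (by positivity)
    rw [h3] at h4
    have h6 : (2 : ℝ) ^ J * b k ≤ cellOf K L x.1 k := by
      have : 2 ^ J * b k ≤ cellOf K L x.1 k := by omega
      exact_mod_cast this
    have h7 : (cellOf K L x.1 k : ℝ) + 1 ≤ 2 ^ J * b k + 2 ^ J := by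
      have : cellOf K L x.1 k + 1 ≤ 2 ^ J * b k + 2 ^ J := by omega
      exact_mod_cast this
    unfold cellCorner at h1 h2
    rw [Finset.mem_Icc]
    constructor
    · refine Int.floor_le_floor (div_le_div_of_nonneg_right ?_ hs0.le)
      simp only [hlo]
      nlinarith
    · rw [← Int.floor_add_natCast]
      refine Int.floor_le_floor ?_
      rw [div_add' _ _ _ hs0.ne']
      refine div_le_div_of_nonneg_right ?_ hs0.le
      simp only [hlo]
      nlinarith
  have hcell : ∀ n ∈ S, ∑ x : ↥E with coarse J (cellOf K L x.1) = b ∧ idx x.1 = n,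
      ∑ y ∈ E, rate α x.1 y ≤ C * s ^ d := by
    intro n _
    have hmem : ∀ x : Pt d, idx x = n → x ∈ Vcube d L ε n := by
      rintro x rfl k
      have h1 := Int.floor_le (x k / s)
      have h2 := Int.lt_floor_add_one (x k / s)
      rw [le_div_iff₀ hs0] at h1
      rw [div_lt_iff₀ hs0] at h2
      constructor <;> linarith
    rcases (Finset.univ.filter fun x : ↥E =>
      coarse J (cellOf K L x.1) = b ∧ idx x.1 = n).eq_empty_or_nonempty with h | ⟨x, hx⟩
    · rw [h, Finset.sum_empty]
      positivity
    · have hxc : x.1 ∈ cube d L := (hfin.mem_toFinset.1 x.2).2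
      have h1 := hV n ⟨x.1, hmem _ (Finset.mem_filter.1 hx).2.2, hxc⟩
      have h2 := (ofReal_sum_rate_le_Rfun (α := α) (A := Vcube d L ε n) (ξ := ξ)
        (F := (Finset.univ.filter fun x : ↥E =>
          coarse J (cellOf K L x.1) = b ∧ idx x.1 = n).map (Function.Embedding.subtype _))
        (E := E) (fun y hy => by
          obtain ⟨w, hw, rfl⟩ := Finset.mem_map.1 hy
          exact ⟨(hfin.mem_toFinset.1 w.2).1, hmem _ (Finset.mem_filter.1 hw).2.2⟩)
        (fun y hy => (hfin.mem_toFinset.1 hy).1)).trans h1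
      rw [Finset.sum_map, ENNReal.ofReal_le_ofReal_iff (by positivity),
        Real.rpow_mul_natCast hL0.le] at h2
      exact h2
  calc ∑ x : ↥E with coarse J (cellOf K L x.1) = b, wgt α E i x
      ≤ ∑ x : ↥E with coarse J (cellOf K L x.1) = b, ∑ y ∈ E, rate α x.1 y :=
        Finset.sum_le_sum fun x _ => wgt_le_sum_rate hα i x.2
    _ = ∑ n ∈ S, ∑ x : ↥E with coarse J (cellOf K L x.1) = b ∧ idx x.1 = n,
          ∑ y ∈ E, rate α x.1 y := by
        rw [← Finset.sum_fiberwise_of_maps_to (t := S) (g := fun x : ↥E => idx x.1)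
          fun x hx => hidx x (Finset.mem_filter.1 hx).2]
        exact Finset.sum_congr rfl fun n _ => by rw [Finset.filter_filter]
    _ ≤ ∑ _n ∈ S, C * s ^ d := Finset.sum_le_sum hcell
    _ = (M + 1) ^ d * (C * s ^ d) := by
        rw [Finset.sum_const, hScard, nsmul_eq_mul]
        push_cast
        rfl
    _ ≤ (M + 1) ^ d * (C * (M₂ * 2 ^ J) ^ d) := by gcongr
    _ = (M + 1) ^ d * (C * M₂ ^ d) * 2 ^ (J * d) := by rw [mul_pow, pow_mul]; ring

lemma microScale_bounds {d : ℕ} (hd : 1 ≤ d) {K : ℝ} (hK : 0 < K) {L : ℕ} (hL : 4 * K ≤ L) :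
    cellSide K L * 2 ^ microScale d K L ≤
        (⌈8 * K / (4 * K) ^ (1 / (4 * d : ℝ))⌉₊ : ℝ) * (L : ℝ) ^ (1 / (4 * d : ℝ)) ∧
      (L : ℝ) ^ (1 / (4 * d : ℝ)) ≤ 2 * (8 * K) ^ (1 / (4 * d : ℝ)) * 2 ^ microScale d K L := by
  have hd0 : (0 : ℝ) < 4 * d := by exact_mod_cast (by omega : 0 < 4 * d)
  have hroot : ∀ n : ℕ, ((2 : ℝ) ^ (n * (4 * d))) ^ (1 / (4 * d : ℝ)) = 2 ^ n := by
    intro n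
    rw [pow_mul, ← Real.rpow_natCast (_ ^ n), ← Real.rpow_mul (by positivity)]
    push_cast
    rw [mul_one_div_cancel hd0.ne', Real.rpow_one]
  have hε : (0 : ℝ) ≤ 1 / (4 * d : ℝ) := by positivity
  constructor
  · have h1 : (2 : ℝ) ^ (microScale d K L * (4 * d)) * (4 * K) ≤ L := by
      refine le_trans (mul_le_mul_of_nonneg_right ?_ (by positivity)) (pow_topScale_le hK hL)
      exact pow_le_pow_right₀ (by norm_num) (Nat.div_mul_le_self _ _)
    have h2 := Real.rpow_le_rpow (by positivity) h1 hε
    rw [Real.mul_rpow (by positivity) (by positivity), hroot] at h2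
    have h3 : (0 : ℝ) < (4 * K) ^ (1 / (4 * d : ℝ)) := by positivity
    calc cellSide K L * 2 ^ microScale d K L ≤ 8 * K * 2 ^ microScale d K L := by
          gcongr; exact (cellSide_lt hK L).le
      _ ≤ 8 * K * ((L : ℝ) ^ (1 / (4 * d : ℝ)) / (4 * K) ^ (1 / (4 * d : ℝ))) := by
          gcongr; rwa [le_div_iff₀ h3]
      _ = 8 * K / (4 * K) ^ (1 / (4 * d : ℝ)) * (L : ℝ) ^ (1 / (4 * d : ℝ)) := by ring
      _ ≤ _ := by gcongr; exact Nat.le_ceil _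
  · have h1 : (L : ℝ) ≤ 2 ^ ((microScale d K L + 1) * (4 * d)) * (8 * K) := by
      refine (lt_pow_topScale hK L).le.trans (mul_le_mul_of_nonneg_right ?_ (by positivity))
      refine pow_le_pow_right₀ (by norm_num) ?_
      have h2 := Nat.lt_mul_div_succ (topScale K L) (by omega : 0 < 4 * d)
      rw [mul_comm]
      exact h2.le
    have h2 := Real.rpow_le_rpow (by positivity) h1 hε
    rw [Real.mul_rpow (by positivity) (by positivity), hroot, pow_succ] at h2
    linarith

end Volume

section Assembly

lemma gen_row_sum {d : ℕ} (α : ℝ) (E : Finset (Pt d)) (i : ℕ) (x : ↥E) :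
    ∑ y, gen α E i x y = 0 := by
  rw [← Finset.add_sum_erase _ _ (Finset.mem_univ x)]
  have h : ∑ y ∈ Finset.univ.erase x, gen α E i x y
      = ∑ z ∈ E.erase x.1, rate α x.1 z / wgt α E i x.1 := by
    refine Finset.sum_bij (fun y _ => y.1) (fun y hy => ?_) (fun y _ y' _ h => Subtype.ext h)
      (fun z hz => ?_) (fun y hy => ?_)
    · exact Finset.mem_erase.2 ⟨fun e => Finset.ne_of_mem_erase hy (Subtype.ext e), y.2⟩
    · exact ⟨⟨z, Finset.mem_of_mem_erase hz⟩, Finset.mem_erase.2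
        ⟨fun e => Finset.ne_of_mem_erase hz (congrArg Subtype.val e), Finset.mem_univ _⟩, rfl⟩
    · simp [gen, (Finset.ne_of_mem_erase hy).symm]
  rw [h]
  simp [gen]

lemma mixTime_le_of_dyadicNet {d : ℕ} (hd : 1 ≤ d) {α : ℝ} {E : Finset (Pt d)} {i : ℕ}
    {H J : ℕ} {CR Cw c₀ : ℝ} {R : ℕ → ℝ} {cl : ↥E → Fin d → ℕ} {pt : (Fin d → ℕ) → ↥E}
    {lev : (Fin d → ℕ) → ℕ}
    (N : DyadicNet H J CR Cw c₀ R (fun x : ↥E => wgt α E i x) (fun x y => rate α x.1 y.1)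
      cl pt lev)
    (hCR : 0 < CR) (hCw : 0 < Cw) (hc₀ : 0 < c₀) (hc₁ : c₀ ≤ 1) (hJH : 2 * J * d < H)
    (hΛ : (2 * (H * d) : ℝ) * 4 ^ (2 * J * d) ≤ 4 ^ H) :
    mixTime α E i ≤ ENNReal.ofReal (2 * ((2 + 4 * (2 ^ d * (1 + 2 * CR * Cw / c₀))) *
      (16 * (d : ℝ) ^ 2 * CR * Cw * 4 ^ d + CR * (2 + 8 * (d : ℝ) ^ 2) * Cw) * 4 ^ H)) := by
  refine iInf_le_of_le _ (iInf_le_of_le ?_ (iInf_le_of_le (fun x y => ?_) le_rfl))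
  · positivity
  · have h := N.mixing hCR hCw hc₀ hc₁ hd hJH hΛ (gen α E i) (gen_row_sum α E i)
      (fun x y hxy => by
        simp only [gen, Matrix.of_apply, if_neg hxy]
        exact mul_div_cancel₀ _ (N.w_pos x).ne') x y
    rw [heatKernel, (hasSum_semi_apply _ _ _ _).tsum_eq, nu, Wsum,
      ← Finset.sum_coe_sort E (wgt α E i)]
    exact h

end Assembly

/-- Theorem 1.2: `τ^i(L) ≤ C L²` a.s. eventually. -/
theorem stmt_2 (hd : 2 ≤ d) (α : ℝ) (hα0 : 0 < α) (hαd : α < d)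
    (P : Measure (Config d)) (hP : IsPointProcess P)
    (hA1 : AssumptionA1 P) (hA2 : AssumptionA2 α P) :
    ∃ C : ℝ, 0 < C ∧ ∀ i ∈ ({1, 2, 3} : Set ℕ),
      ∀ᵐ ξ ∂P, ∀ᶠ L : ℕ in atTop, ∀ hfin : (ξ ∩ cube d L).Finite,
        mixTime α hfin.toFinset i ≤ ENNReal.ofReal (C * (L : ℝ) ^ 2) := by
  have hd1 : 1 ≤ d := by omega
  have hdR : (0 : ℝ) < d := by exact_mod_cast hd1
  obtain ⟨K, hK, hsparse⟩ := eventually_sparse hd1 hP hA1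
  set D : ℝ := (32 * K * d) ^ α with hD
  have hD0 : 0 ≤ D := by positivity
  obtain ⟨j₀, hj₀⟩ := eventually_atTop.1 (eventually_scaleCost_le (D := D) hα0 hαd)
  have hs := hsparse (fun j => 2 ^ j * scaleCost d α D (j + 1)) j₀
    (fun j => mul_pos (by positivity) (zero_lt_one.trans_le (one_le_scaleCost hD0 _))) hj₀
  have hε1 : 1 / (4 * d : ℝ) < 1 := by
    rw [div_lt_one (by positivity)]
    have : (1 : ℝ) ≤ d := by exact_mod_cast hd1
    linarith
  obtain ⟨C₀, hC₀, hV⟩ := hA2 (1 / (4 * d : ℝ)) (by positivity) hε1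
  set M : ℕ := ⌈8 * K / (4 * K) ^ (1 / (4 * d : ℝ))⌉₊
  set M₂ : ℝ := 2 * (8 * K) ^ (1 / (4 * d : ℝ))
  set Cw : ℝ := (M + 1) ^ d * (C₀ * M₂ ^ d)
  have hCw : 0 < Cw := by positivity
  set CR : ℝ := scaleCost d α D j₀ + 2
  have hCR : 0 < CR := by linarith [one_le_scaleCost (d := d) (α := α) hD0 j₀]
  set c₀ : ℝ := 1 / scaleRes α D 0
  have hR0 := one_le_scaleRes (α := α) hD0 0
  have hc₀ : 0 < c₀ := by positivity
  have hc₁ : c₀ ≤ 1 := (div_le_one (by linarith)).2 hR0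
  set A : ℝ := 2 * ((2 + 4 * (2 ^ d * (1 + 2 * CR * Cw / c₀))) *
    (16 * (d : ℝ) ^ 2 * CR * Cw * 4 ^ d + CR * (2 + 8 * (d : ℝ) ^ 2) * Cw))
  have hA : 0 < A := by positivity
  refine ⟨A / (4 * K) ^ 2, by positivity, fun i _ => ?_⟩
  have hexp : ∀ᶠ H : ℕ in atTop, (2 * d * H : ℝ) ≤ 2 ^ H := by
    filter_upwards [((isLittleO_pow_const_const_pow_of_one_lt (R := ℝ) 1
      (one_lt_two (α := ℝ))).const_mul_left (2 * d)).def zero_lt_one] with H hH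
    simpa using (le_abs_self _).trans hH
  obtain ⟨H₀, hH₀⟩ := eventually_atTop.1 hexp
  obtain ⟨L₀, hL₀⟩ := exists_nat_ge (4 * K)
  filter_upwards [hs, hV] with ξ hsξ hVξ
  filter_upwards [hsξ, hVξ, eventually_ge_atTop L₀,
    (tendsto_microScale hd1 hK).eventually_ge_atTop (max j₀ (max 1 H₀))] with L hsL hVL hLL hJ hfin
  have hL : 4 * K ≤ L := hL₀.trans (by exact_mod_cast hLL)
  have hJj : j₀ ≤ microScale d K L := (le_max_left _ _).trans hJ
  have hJ1 : 1 ≤ microScale d K L := (le_max_left _ _).trans ((le_max_right _ _).trans hJ)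
  have hJH₀ : H₀ ≤ microScale d K L := (le_max_right _ _).trans ((le_max_right _ _).trans hJ)
  have hJH : microScale d K L ≤ topScale K L := Nat.div_le_self _ _
  have h4 : 2 * (2 * microScale d K L * d) ≤ topScale K L := by
    have := Nat.div_mul_le_self (topScale K L) (4 * d)
    rw [microScale]
    linarith
  obtain ⟨hM, hM₂⟩ := microScale_bounds hd1 hK hL
  obtain ⟨pt, N⟩ := exists_dyadicNet hd1 hα0 hK hL hfin hJj hJ1 hsL i
    (sum_wgt_tile_le hα0 hK hL hfin hC₀ hVL hM hM₂ i)
  have hJd : 0 < 2 * microScale d K L * d := by positivity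
  refine (mixTime_le_of_dyadicNet hd1 N hCR hCw hc₀ hc₁ (by omega) ?_).trans
    (ENNReal.ofReal_le_ofReal ?_)
  · have h5 : (4 : ℝ) ^ (2 * microScale d K L * d) ≤ 2 ^ topScale K L := by
      rw [show (4 : ℝ) = 2 ^ 2 by norm_num, ← pow_mul]
      exact pow_le_pow_right₀ (by norm_num) h4
    have h6 := hH₀ _ (hJH₀.trans hJH)
    calc (2 * (topScale K L * d) : ℝ) * 4 ^ (2 * microScale d K L * d)
        ≤ 2 ^ topScale K L * 2 ^ topScale K L := by
          refine mul_le_mul ?_ h5 (by positivity) (by positivity)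
          linarith
      _ = 4 ^ topScale K L := by rw [← mul_pow]; norm_num
  · have h7 : (4 : ℝ) ^ topScale K L * (4 * K) ^ 2 ≤ (L : ℝ) ^ 2 := by
      rw [show (4 : ℝ) ^ topScale K L = (2 ^ topScale K L) ^ 2 by
        rw [← pow_mul, mul_comm, pow_mul]; norm_num, ← mul_pow]
      exact pow_le_pow_left₀ (by positivity) (pow_topScale_le hK hL) 2
    rw [div_mul_eq_mul_div, le_div_iff₀ (by positivity)]
    calc _ = A * (4 ^ topScale K L * (4 * K) ^ 2) := by simp only [A]; ring
      _ ≤ A * (L : ℝ) ^ 2 := mul_le_mul_of_nonneg_left h7 hA.le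

end
end

section
/- Let d ≥ 2, α > 0 and let P be a simple point process on ℝ^d. Suppose there exist constants C < ∞ and c > 0 such that, P-a.s. for all sufficiently large L: (i) C^{−1}·L^d ≤ #(ξ_L) ≤ C·L^d; (ii) ξ(Λ_{L/2})·ξ(Λ_L ∖ Λ_{3L/4}) ≥ c·L^{2d}; and (iii) Σ_{x,y∈ξ_L} e^{−|x−y|^α}·(|x|−|y|)² ≤ C·L^d. Then there exists δ > 0 such that, P-a.s. for all sufficiently large L, the Poincaré constant of model 1 satisfies γ¹(L) ≥ δ·L². -/
open MeasureTheory Filter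
open scoped ENNReal

noncomputable section

variable {d : ℕ}

/-- If `f` separates `A ⊆ E` from `B ⊆ E` by a gap `g`, the unnormalized variance of `f` over `E`
is at least `|A| |B| g² / 2`. -/
lemma card_mul_card_mul_sq_le_variance {ι : Type*} {E A B : Finset ι} (hA : A ⊆ E) (hB : B ⊆ E)
    {f : ι → ℝ} {g : ℝ} (hg : 0 ≤ g) (hgap : ∀ a ∈ A, ∀ b ∈ B, g ≤ f b - f a) :
    (A.card : ℝ) * B.card * g ^ 2 / 2 ≤
      E.card * (∑ x ∈ E, f x ^ 2) - (∑ x ∈ E, f x) ^ 2 := by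
  have hexp : ∑ x ∈ E, ∑ y ∈ E, (f y - f x) ^ 2 =
      2 * (E.card * (∑ x ∈ E, f x ^ 2) - (∑ x ∈ E, f x) ^ 2) := by
    have h (x y : ι) : (f y - f x) ^ 2 = f y ^ 2 - 2 * (f x * f y) + f x ^ 2 := by ring
    simp only [h, Finset.sum_add_distrib, Finset.sum_sub_distrib, ← Finset.mul_sum,
      Finset.sum_const, nsmul_eq_mul, ← Finset.sum_mul]
    ring
  have hsub : ∑ x ∈ A, ∑ y ∈ B, (f y - f x) ^ 2 ≤ ∑ x ∈ E, ∑ y ∈ E, (f y - f x) ^ 2 :=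
    (Finset.sum_le_sum fun x _ =>
      Finset.sum_le_sum_of_subset_of_nonneg hB fun y _ _ => sq_nonneg _).trans
      (Finset.sum_le_sum_of_subset_of_nonneg hA fun x _ _ =>
        Finset.sum_nonneg fun y _ => sq_nonneg _)
  have hlow : (A.card : ℝ) * B.card * g ^ 2 ≤ ∑ x ∈ A, ∑ y ∈ B, (f y - f x) ^ 2 := by
    calc (A.card : ℝ) * B.card * g ^ 2 = ∑ x ∈ A, ∑ y ∈ B, g ^ 2 := by
          simp [mul_assoc]
      _ ≤ _ := Finset.sum_le_sum fun x hx => Finset.sum_le_sum fun y hy =>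
          pow_le_pow_left₀ hg (hgap x hx y hy) 2
  linarith

lemma nu_one (α : ℝ) (E : Finset (Pt d)) (x : Pt d) : nu α E 1 x = (E.card : ℝ)⁻¹ := by
  simp [nu, wgt, Wsum]

lemma varNu_one (α : ℝ) {E : Finset (Pt d)} (hE : E.Nonempty) (f : Pt d → ℝ) :
    varNu α E 1 f =
      (E.card * (∑ x ∈ E, f x ^ 2) - (∑ x ∈ E, f x) ^ 2) / (E.card : ℝ) ^ 2 := by
  have : (E.card : ℝ) ≠ 0 := by exact_mod_cast hE.card_pos.ne'
  simp only [varNu, nu_one, ← Finset.mul_sum]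
  field_simp

lemma dirichlet_one (α : ℝ) (E : Finset (Pt d)) (f : Pt d → ℝ) :
    dirichlet α E 1 f =
      (∑ x ∈ E, ∑ y ∈ E, rate α x y * (f x - f y) ^ 2) / (2 * E.card) := by
  have herase (x : Pt d) : ∑ y ∈ E.erase x, rate α x y * (f x - f y) ^ 2 =
      ∑ y ∈ E, rate α x y * (f x - f y) ^ 2 :=
    Finset.sum_erase _ (by simp)
  simp only [dirichlet, nu_one, wgt, if_true, div_one, mul_assoc, ← Finset.mul_sum, herase]
  simp only [div_eq_mul_inv, mul_inv]
  ring

lemma dirichlet_one_pos (α : ℝ) {E : Finset (Pt d)} {f : Pt d → ℝ} (hf : Nonconst E f) :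
    0 < dirichlet α E 1 f := by
  obtain ⟨x, hx, y, hy, hxy⟩ := hf
  have hterm (x y : Pt d) : 0 ≤ rate α x y * (f x - f y) ^ 2 :=
    mul_nonneg (Real.exp_pos _).le (sq_nonneg _)
  have hcard : (0 : ℝ) < E.card := by exact_mod_cast Finset.card_pos.2 ⟨x, hx⟩
  rw [dirichlet_one]
  refine div_pos ?_ (by positivity)
  refine Finset.sum_pos' (fun x _ => Finset.sum_nonneg fun y _ => hterm x y) ⟨x, hx, ?_⟩
  refine Finset.sum_pos' (fun y _ => hterm x y) ⟨y, hy, ?_⟩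
  exact mul_pos (Real.exp_pos _) (sq_pos_of_ne_zero (sub_ne_zero.2 hxy))

lemma cube_mono {L M : ℝ} (h : L ≤ M) : cube d L ⊆ cube d M :=
  fun _ hp i => (hp i).trans (by linarith)

lemma norm_le_of_mem_cube {L : ℝ} {p : Pt d} (hL : 0 ≤ L) (hp : p ∈ cube d L) :
    ‖p‖ ≤ d * (L / 2) := by
  rw [EuclideanSpace.norm_eq]
  refine Real.sqrt_le_iff.2 ⟨by positivity, ?_⟩
  calc ∑ i, ‖p i‖ ^ 2 ≤ ∑ _i : Fin d, (L / 2) ^ 2 :=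
        Finset.sum_le_sum fun i _ => pow_le_pow_left₀ (norm_nonneg _) (hp i) 2
    _ = d * (L / 2) ^ 2 := by simp
    _ ≤ (d : ℝ) ^ 2 * (L / 2) ^ 2 := by
        gcongr
        exact_mod_cast Nat.le_self_pow two_ne_zero d
    _ = _ := by ring

lemma half_lt_norm_of_notMem_cube {L : ℝ} {p : Pt d} (hp : p ∉ cube d L) : L / 2 < ‖p‖ := by
  simp only [cube, Set.mem_ofPred_eq, not_forall, not_le] at hp
  obtain ⟨i, hi⟩ := hp
  exact hi.trans_le (PiLp.norm_apply_le p i)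

/-- Remark 1: lower bound `γ¹(L) ≥ δ L²` for model 1. -/
theorem stmt_3 (hd : 2 ≤ d) (α : ℝ) (hα : 0 < α)
    (P : Measure (Config d)) (hP : IsPointProcess P)
    (C c : ℝ) (hC : 0 < C) (hc : 0 < c)
    (hyp : ∀ᵐ ξ ∂P, ∀ᶠ L : ℕ in atTop,
      ∃ hfin : (ξ ∩ cube d L).Finite,
        (C⁻¹ * (L : ℝ) ^ d ≤ (hfin.toFinset.card : ℝ) ∧
          (hfin.toFinset.card : ℝ) ≤ C * (L : ℝ) ^ d) ∧
        c * (L : ℝ) ^ (2 * d) ≤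
          ((ξ ∩ cube d ((L : ℝ) / 2)).ncard : ℝ) *
            ((ξ ∩ (cube d L \ cube d (3 * (L : ℝ) / 4))).ncard : ℝ) ∧
        ∑ x ∈ hfin.toFinset, ∑ y ∈ hfin.toFinset,
            rate α x y * (‖x‖ - ‖y‖) ^ 2 ≤ C * (L : ℝ) ^ d) :
    ∃ δ : ℝ, 0 < δ ∧ ∀ᵐ ξ ∂P, ∀ᶠ L : ℕ in atTop,
      ∀ hfin : (ξ ∩ cube d L).Finite,
        ENNReal.ofReal (δ * (L : ℝ) ^ 2) ≤ gammaP α hfin.toFinset 1 := by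
  have hd0 : (0 : ℝ) < d := by exact_mod_cast (by omega : 0 < d)
  set κ : ℝ := C⁻¹ * (8 * d : ℝ)⁻¹ ^ d * (c / C) * (1 / 4) ^ 2 / 2 with hκ
  have hκ0 : 0 < κ := by positivity
  refine ⟨κ / C ^ 2 / (C ^ 2 / 2), by positivity, ?_⟩
  filter_upwards [hyp] with ξ hξ
  have hdiv : Tendsto (fun L : ℕ => L / (4 * d)) atTop atTop :=
    Nat.tendsto_div_const_atTop (by omega)
  filter_upwards [hξ, hdiv.eventually hξ, eventually_ge_atTop (4 * d)] with L hL hM hdL hfin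
  obtain ⟨_, ⟨hlow, hup⟩, hprod, henergy⟩ := hL
  obtain ⟨hfinM, ⟨hlowM, -⟩, -, -⟩ := hM
  set M : ℕ := L / (4 * d) with hMdef
  set E := hfin.toFinset with hE
  have hL0 : (0 : ℝ) < L := by exact_mod_cast (by omega : 0 < L)
  have hMle : 4 * d * (M : ℝ) ≤ L := by exact_mod_cast Nat.mul_div_le L (4 * d)
  have hMge : (8 * d : ℝ)⁻¹ * L ≤ M := by
    have h1 : 1 ≤ M := (Nat.one_le_div_iff (by omega)).2 hdL
    have h2 : L < 4 * d * (M + 1) := Nat.lt_mul_div_succ L (by omega)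
    have h3 : L ≤ 8 * d * M := by nlinarith
    rw [inv_mul_le_iff₀ (by positivity)]
    exact_mod_cast h3
  have hML : (M : ℝ) ≤ L := by exact_mod_cast Nat.div_le_self L (4 * d)
  have hcard : (0 : ℝ) < E.card := lt_of_lt_of_le (by positivity) hlow
  have hEne : E.Nonempty := Finset.card_pos.1 (by exact_mod_cast hcard)
  have hfinB : (ξ ∩ (cube d L \ cube d (3 * (L : ℝ) / 4))).Finite :=
    hfin.subset (Set.inter_subset_inter_right _ Set.sdiff_subset)
  set A := hfinM.toFinset with hA
  set B := hfinB.toFinset with hB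
  have hAE : A ⊆ E := Set.Finite.toFinset_subset_toFinset.2
    (Set.inter_subset_inter_right _ (cube_mono hML))
  have hBE : B ⊆ E := Set.Finite.toFinset_subset_toFinset.2
    (Set.inter_subset_inter_right _ Set.sdiff_subset)
  have hAcard : C⁻¹ * ((8 * d : ℝ)⁻¹ ^ d * (L : ℝ) ^ d) ≤ A.card := by
    refine le_trans ?_ hlowM
    rw [← mul_pow]
    gcongr
  have hBcard : c / C * (L : ℝ) ^ d ≤ B.card := by
    have hhalf : ((ξ ∩ cube d ((L : ℝ) / 2)).ncard : ℝ) ≤ C * (L : ℝ) ^ d := by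
      refine le_trans ?_ hup
      rw [← Set.ncard_eq_toFinset_card _ hfin]
      exact_mod_cast Set.ncard_le_ncard
        (Set.inter_subset_inter_right _ (cube_mono (by linarith))) hfin
    rw [Set.ncard_eq_toFinset_card _ hfinB] at hprod
    have h := hprod.trans (mul_le_mul_of_nonneg_right hhalf (Nat.cast_nonneg _))
    have hLd : (0 : ℝ) < (L : ℝ) ^ d := by positivity
    rw [div_mul_eq_mul_div, div_le_iff₀ hC]
    refine le_of_mul_le_mul_right ?_ hLd
    calc c * (L : ℝ) ^ d * (L : ℝ) ^ d = c * (L : ℝ) ^ (2 * d) := by ring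
      _ ≤ _ := h
      _ = _ := by ring
  have hgap : ∀ a ∈ A, ∀ b ∈ B, 1 / 4 * (L : ℝ) ≤ ‖b‖ - ‖a‖ := by
    intro a ha b hb
    have h1 := norm_le_of_mem_cube (Nat.cast_nonneg M) ((Set.Finite.mem_toFinset _).1 ha).2
    have h2 := half_lt_norm_of_notMem_cube ((Set.Finite.mem_toFinset _).1 hb).2.2
    linarith
  have hvar : κ / C ^ 2 * (L : ℝ) ^ 2 ≤ varNu α E 1 fun x => ‖x‖ := by
    rw [varNu_one α hEne, le_div_iff₀ (by positivity)]
    refine le_trans ?_ (card_mul_card_mul_sq_le_variance hAE hBE (by positivity) hgap)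
    calc κ / C ^ 2 * (L : ℝ) ^ 2 * (E.card : ℝ) ^ 2
        ≤ κ / C ^ 2 * (L : ℝ) ^ 2 * (C * (L : ℝ) ^ d) ^ 2 := by gcongr
      _ = C⁻¹ * ((8 * d : ℝ)⁻¹ ^ d * (L : ℝ) ^ d) * (c / C * (L : ℝ) ^ d) *
            (1 / 4 * (L : ℝ)) ^ 2 / 2 := by
          rw [hκ]
          field_simp
      _ ≤ _ := by gcongr
  have hdir : (dirichlet α E 1 fun x => ‖x‖) ≤ C ^ 2 / 2 := by
    rw [dirichlet_one, div_le_iff₀ (by positivity)]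
    calc _ ≤ C * (L : ℝ) ^ d := henergy
      _ = C ^ 2 * (C⁻¹ * (L : ℝ) ^ d) := by field_simp
      _ ≤ C ^ 2 * E.card := by gcongr
      _ = _ := by ring
  have hnonconst : Nonconst E fun x => ‖x‖ := by
    have hApos : (0 : ℝ) < A.card := lt_of_lt_of_le (by positivity) hAcard
    have hBpos : (0 : ℝ) < B.card := lt_of_lt_of_le (by positivity) hBcard
    obtain ⟨a, ha⟩ := Finset.card_pos.1 (by exact_mod_cast hApos : 0 < A.card)
    obtain ⟨b, hb⟩ := Finset.card_pos.1 (by exact_mod_cast hBpos : 0 < B.card)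
    refine ⟨a, hAE ha, b, hBE hb, ne_of_lt ?_⟩
    linarith [hgap a ha b hb]
  refine le_trans (ENNReal.ofReal_le_ofReal ?_) (le_iSup₂_of_le _ hnonconst le_rfl)
  rw [div_mul_eq_mul_div]
  have hpos := dirichlet_one_pos α hnonconst
  gcongr
  exact le_trans (by positivity) hvar

end
end
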